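/- arXiv:1905.12928 — 2 statements merged into one kernel-verified Lean document; each statement's English description precedes it below -/
import Mathlib

section
/- Let d ≥ 1, β ≥ 0 and h > 0. Then every Gibbs measure for the nearest-neighbour ferromagnetic Ising model on ℤ^d at inverse temperature β and magnetic field h is weak mixing. -/
open MeasureTheory Filter

namespace IsingP

abbrev Site (d : ℕ) := Fin d → ℤ
abbrev Config (d : ℕ) := Site d → Bool

noncomputable def spin (b : Bool) : ℝ := if b then 1 else -1

def nbrs {d : ℕ} (i : Site d) : Finset (Site d) :=
  Finset.univ.image
    (fun q : Fin d × Bool => fun k => if k = q.1 then i k + (if q.2 then 1 else -1) else i k)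

noncomputable def hamElem {d : ℕ} (β h : ℝ) (Λ : Finset (Site d)) (η ω : Config d) : ℝ :=
  β * (2⁻¹ * ∑ i ∈ Λ, ∑ j ∈ nbrs i ∩ Λ, spin (η i) * spin (η j))
    + β * ∑ i ∈ Λ, ∑ j ∈ nbrs i \ Λ, spin (η i) * spin (ω j)
    + h * ∑ i ∈ Λ, spin (η i)

def patch {d : ℕ} (Λ : Finset (Site d)) (η : {x // x ∈ Λ} → Bool) (ω : Config d) : Config d :=
  fun i => if hi : i ∈ Λ then η ⟨i, hi⟩ else ω i

noncomputable def localDensity {d : ℕ} (β h : ℝ) (Λ : Finset (Site d))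
    (f : Config d → ℝ) (ω : Config d) : ℝ :=
  (∑ η : {x // x ∈ Λ} → Bool, f (patch Λ η ω) * Real.exp (hamElem β h Λ (patch Λ η ω) ω)) /
    (∑ η : {x // x ∈ Λ} → Bool, Real.exp (hamElem β h Λ (patch Λ η ω) ω))

def IsGibbs (d : ℕ) (β h : ℝ) (μ : Measure (Config d)) : Prop :=
  IsProbabilityMeasure μ ∧
    ∀ (Λ : Finset (Site d)) (f : Config d → ℝ), Measurable f → (∃ M, ∀ σ, |f σ| ≤ M) →
      ∫ σ, f σ ∂μ = ∫ ω, localDensity β h Λ f ω ∂μ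

def cylEvents {d : ℕ} (Δ : Set (Site d)) : MeasurableSpace (Config d) :=
  MeasurableSpace.comap (fun σ (i : Δ) => σ i.val) inferInstance

noncomputable def dist1 {d : ℕ} (a b : Site d) : ℝ := ((∑ k, |a k - b k| : ℤ) : ℝ)

def WeakMixing (d : ℕ) (μ : Measure (Config d)) : Prop :=
  ∃ C : ℝ, 0 ≤ C ∧ ∃ c : ℝ, 0 < c ∧
    ∀ (Δ Δ' : Set (Site d)) (A B : Set (Config d)),
      MeasurableSet[cylEvents Δ] A → MeasurableSet[cylEvents Δ'] B → 0 < μ B →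
      ENNReal.ofReal |(μ (A ∩ B) / μ B).toReal - (μ A).toReal| ≤
        ENNReal.ofReal C *
          ∑' (i : Δ) (j : Δ'), ENNReal.ofReal (Real.exp (-c * dist1 i.val j.val))

end IsingP


set_option linter.unusedSectionVars false
set_option linter.unusedSimpArgs false
set_option linter.unusedVariables false
namespace IsingAux
open Finset IsingP

lemma spin_true : spin true = 1 := by simp [spin]
lemma spin_false : spin false = -1 := by simp [spin]

/-! ### Four replicas -/

abbrev Quad := Bool × Bool × Bool × Bool

noncomputable def qal (q : Quad) : ℝ := spin q.1 + spin q.2.1 + spin q.2.2.1 + spin q.2.2.2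
noncomputable def qbe (q : Quad) : ℝ := spin q.2.2.1 + spin q.2.2.2 - spin q.1 - spin q.2.1
noncomputable def qga (q : Quad) : ℝ := spin q.1 - spin q.2.1 + spin q.2.2.1 - spin q.2.2.2
noncomputable def qde (q : Quad) : ℝ := spin q.1 - spin q.2.1 - spin q.2.2.1 + spin q.2.2.2

lemma quad_site_nonneg (a b c e : ℕ) :
    0 ≤ ∑ q : Quad, qal q ^ a * qbe q ^ b * qga q ^ c * qde q ^ e := by
  have h4 : ∀ n : ℕ, 0 ≤ (4 : ℝ) ^ n + (-4) ^ n := by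
    intro n
    rcases Nat.even_or_odd n with h | h
    · rw [h.neg_pow]; positivity
    · rw [h.neg_pow]; simp
  have e2 : ∀ n : ℕ, Even n → (-2 : ℝ) ^ n = 2 ^ n := fun n h => h.neg_pow 2
  have o2 : ∀ n : ℕ, Odd n → (-2 : ℝ) ^ n = - 2 ^ n := fun n h => h.neg_pow 2
  have z : ∀ n : ℕ, 0 ≤ (0 : ℝ) ^ n := fun n => by positivity
  have key : ∑ q : Quad, qal q ^ a * qbe q ^ b * qga q ^ c * qde q ^ e =
      (4 ^ a + (-4) ^ a) * (0 ^ b * 0 ^ c * 0 ^ e) + (4 ^ b + (-4) ^ b) * (0 ^ a * 0 ^ c * 0 ^ e)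
      + (4 ^ c + (-4) ^ c) * (0 ^ a * 0 ^ b * 0 ^ e) + (4 ^ e + (-4) ^ e) * (0 ^ a * 0 ^ b * 0 ^ c)
      + (2 ^ a * 2 ^ b * (-2) ^ c * (-2) ^ e + 2 ^ a * 2 ^ b * 2 ^ c * 2 ^ e
        + 2 ^ a * (-2) ^ b * (-2) ^ c * 2 ^ e + 2 ^ a * (-2) ^ b * 2 ^ c * (-2) ^ e
        + (-2) ^ a * (-2) ^ b * 2 ^ c * 2 ^ e + (-2) ^ a * (-2) ^ b * (-2) ^ c * (-2) ^ e
        + (-2) ^ a * 2 ^ b * 2 ^ c * (-2) ^ e + (-2) ^ a * 2 ^ b * (-2) ^ c * 2 ^ e) := by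
    simp only [Fintype.sum_prod_type, Fintype.sum_bool, qal, qbe, qga, qde, spin_true, spin_false]
    norm_num
    ring
  rw [key]
  have h8 : 0 ≤ ((2:ℝ) ^ a * 2 ^ b * (-2) ^ c * (-2) ^ e + 2 ^ a * 2 ^ b * 2 ^ c * 2 ^ e
        + 2 ^ a * (-2) ^ b * (-2) ^ c * 2 ^ e + 2 ^ a * (-2) ^ b * 2 ^ c * (-2) ^ e
        + (-2) ^ a * (-2) ^ b * 2 ^ c * 2 ^ e + (-2) ^ a * (-2) ^ b * (-2) ^ c * (-2) ^ e
        + (-2) ^ a * 2 ^ b * 2 ^ c * (-2) ^ e + (-2) ^ a * 2 ^ b * (-2) ^ c * 2 ^ e) := by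
    have hp : 0 ≤ (2:ℝ) ^ a * 2 ^ b * 2 ^ c * 2 ^ e := by positivity
    rcases Nat.even_or_odd a with ha | ha <;> rcases Nat.even_or_odd b with hb | hb <;>
    rcases Nat.even_or_odd c with hc | hc <;> rcases Nat.even_or_odd e with he | he <;>
    simp only [e2, o2, ha, hb, hc, he] <;> linarith
  have := mul_nonneg (h4 a) (mul_nonneg (mul_nonneg (z b) (z c)) (z e))
  have := mul_nonneg (h4 b) (mul_nonneg (mul_nonneg (z a) (z c)) (z e))
  have := mul_nonneg (h4 c) (mul_nonneg (mul_nonneg (z a) (z b)) (z e))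
  have := mul_nonneg (h4 e) (mul_nonneg (mul_nonneg (z a) (z b)) (z c))
  linarith

section Replica
variable {V : Type*} [Fintype V] [DecidableEq V]

/-- The cone of functions generated by monomials in the rotated replica variables. -/
inductive Cone : ((V → Quad) → ℝ) → Prop
  | mono (a b c e : V → ℕ) : Cone (fun θ => ∏ i, (qal (θ i) ^ a i * qbe (θ i) ^ b i *
      qga (θ i) ^ c i * qde (θ i) ^ e i))
  | zero : Cone (fun _ => 0)
  | add {F G : (V → Quad) → ℝ} : Cone F → Cone G → Cone (fun θ => F θ + G θ)
  | smul {F : (V → Quad) → ℝ} (r : ℝ) : 0 ≤ r → Cone F → Cone (fun θ => r * F θ)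
  | lim {F : (V → Quad) → ℝ} (u : ℕ → (V → Quad) → ℝ) : (∀ n, Cone (u n)) →
      (∀ θ, Tendsto (fun n => u n θ) atTop (nhds (F θ))) → Cone F

lemma Cone.mul_mono {F : (V → Quad) → ℝ} (hF : Cone F) (a b c e : V → ℕ) :
    Cone (fun θ => F θ * ∏ i, (qal (θ i) ^ a i * qbe (θ i) ^ b i *
      qga (θ i) ^ c i * qde (θ i) ^ e i)) := by
  induction hF with
  | mono a' b' c' e' =>
    convert Cone.mono (a' + a) (b' + b) (c' + c) (e' + e) using 2 with θ
    rw [← Finset.prod_mul_distrib]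
    refine Finset.prod_congr rfl fun i _ => ?_
    simp only [Pi.add_apply, pow_add]; ring
  | zero => simpa using Cone.zero
  | add _ _ h1 h2 => simpa only [add_mul] using h1.add h2
  | smul r hr _ h => simpa only [mul_assoc] using h.smul r hr
  | lim u _ hl h => exact Cone.lim _ h fun θ => (hl θ).mul_const _

lemma Cone.mul {F G : (V → Quad) → ℝ} (hF : Cone F) (hG : Cone G) :
    Cone (fun θ => F θ * G θ) := by
  induction hG with
  | mono a b c e => exact hF.mul_mono a b c e
  | zero => simpa using Cone.zero
  | add _ _ h1 h2 => simpa only [mul_add] using h1.add h2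
  | smul r hr _ h => simpa only [mul_left_comm] using h.smul r hr
  | lim u _ hl h => exact Cone.lim _ h fun θ => (hl θ).const_mul _

lemma Cone.one : Cone (fun _ : V → Quad => (1:ℝ)) := by
  simpa using Cone.mono (V := V) 0 0 0 0

lemma Cone.const (r : ℝ) (hr : 0 ≤ r) : Cone (fun _ : V → Quad => r) := by
  simpa using Cone.one.smul (V := V) r hr

lemma Cone.pow {F : (V → Quad) → ℝ} (hF : Cone F) (n : ℕ) : Cone (fun θ => F θ ^ n) := by
  induction n with
  | zero => simpa using Cone.one
  | succ n ih => simpa only [pow_succ] using ih.mul hF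

lemma Cone.sum {ι : Type*} (s : Finset ι) (F : ι → (V → Quad) → ℝ)
    (hF : ∀ i ∈ s, Cone (F i)) : Cone (fun θ => ∑ i ∈ s, F i θ) := by
  classical
  induction s using Finset.induction_on with
  | empty => simpa using Cone.zero
  | insert a s ha ih =>
    simp only [Finset.sum_insert ha]
    exact (hF a (by simp)).add (ih fun i hi => hF i (by simp [hi]))

lemma Cone.exp {F : (V → Quad) → ℝ} (hF : Cone F) : Cone (fun θ => Real.exp (F θ)) := by
  refine Cone.lim (fun n θ => ∑ k ∈ range n, ((k.factorial : ℝ)⁻¹) * F θ ^ k) (fun n => ?_) ?_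
  · exact Cone.sum _ _ fun k _ => (hF.pow k).smul _ (by positivity)
  · intro θ
    have := (NormedSpace.expSeries_div_hasSum_exp (𝔸 := ℝ) (F θ)).tendsto_sum_nat
    rw [← Real.exp_eq_exp_ℝ] at this
    simpa only [div_eq_inv_mul] using this

lemma Cone.al (x : V) : Cone (fun θ : V → Quad => qal (θ x)) := by
  convert Cone.mono (V := V) (Pi.single x 1) 0 0 0 using 2 with θ
  rw [Finset.prod_eq_single x] <;> simp +contextual [Pi.single_apply]
lemma Cone.be (x : V) : Cone (fun θ : V → Quad => qbe (θ x)) := by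
  convert Cone.mono (V := V) 0 (Pi.single x 1) 0 0 using 2 with θ
  rw [Finset.prod_eq_single x] <;> simp +contextual [Pi.single_apply]
lemma Cone.ga (x : V) : Cone (fun θ : V → Quad => qga (θ x)) := by
  convert Cone.mono (V := V) 0 0 (Pi.single x 1) 0 using 2 with θ
  rw [Finset.prod_eq_single x] <;> simp +contextual [Pi.single_apply]
lemma Cone.de (x : V) : Cone (fun θ : V → Quad => qde (θ x)) := by
  convert Cone.mono (V := V) 0 0 0 (Pi.single x 1) using 2 with θ
  rw [Finset.prod_eq_single x] <;> simp +contextual [Pi.single_apply]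

/-- Sites outside `Λ` are frozen to `+` in the first/third and `-` in the second/fourth replica. -/
noncomputable def frz (Λ : Finset V) (i : V) (q : Quad) : ℝ :=
  if i ∈ Λ then 1 else if q = (true, false, true, false) then 1 else 0

lemma frz_site_nonneg (Λ : Finset V) (i : V) (a b c e : ℕ) :
    0 ≤ ∑ q : Quad, qal q ^ a * qbe q ^ b * qga q ^ c * qde q ^ e * frz Λ i q := by
  by_cases hi : i ∈ Λ
  · simpa [frz, hi] using quad_site_nonneg a b c e
  · simp only [frz, hi, if_false, mul_ite, mul_one, mul_zero, Finset.sum_ite_eq', Finset.mem_univ,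
      if_true, qal, qbe, qga, qde, spin_true, spin_false]
    norm_num
    positivity

lemma Cone.sum_nonneg (Λ : Finset V) {F : (V → Quad) → ℝ} (hF : Cone F) :
    0 ≤ ∑ θ : V → Quad, F θ * ∏ i, frz Λ i (θ i) := by
  induction hF with
  | mono a b c e =>
    simp only [← Finset.prod_mul_distrib]
    rw [← Fintype.prod_sum (fun i q => qal q ^ a i * qbe q ^ b i * qga q ^ c i * qde q ^ e i *
      frz Λ i q)]
    exact Finset.prod_nonneg fun i _ => frz_site_nonneg Λ i _ _ _ _
  | zero => simp
  | add _ _ h1 h2 => simp only [add_mul, Finset.sum_add_distrib]; linarith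
  | smul r hr _ h => simp only [mul_assoc, ← Finset.mul_sum]; exact mul_nonneg hr h
  | lim u _ hl h =>
    refine ge_of_tendsto' (tendsto_finsetSum _ fun θ _ => (hl θ).mul_const _) h

end Replica


section Weights
variable {V : Type*} [Fintype V] [DecidableEq V]

noncomputable def en (J : V → V → ℝ) (h : V → ℝ) (σ : V → Bool) : ℝ :=
  ∑ i, ∑ j, J i j * (spin (σ i) * spin (σ j)) + ∑ i, h i * spin (σ i)

noncomputable def wt (J : V → V → ℝ) (h : V → ℝ) (Λ : Finset V) (ω σ : V → Bool) : ℝ :=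
  if ∀ i, i ∉ Λ → σ i = ω i then Real.exp (en J h σ) else 0

noncomputable def ZZ (J : V → V → ℝ) (h : V → ℝ) (Λ : Finset V) (ω : V → Bool)
    (f : (V → Bool) → ℝ) : ℝ := ∑ σ, f σ * wt J h Λ ω σ

noncomputable def Ex (J : V → V → ℝ) (h : V → ℝ) (Λ : Finset V) (ω : V → Bool)
    (f : (V → Bool) → ℝ) : ℝ := ZZ J h Λ ω f / ZZ J h Λ ω (fun _ => 1)

abbrev pl : V → Bool := fun _ => true
abbrev mi : V → Bool := fun _ => false

lemma wt_nonneg (J : V → V → ℝ) (h : V → ℝ) (Λ : Finset V) (ω σ : V → Bool) :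
    0 ≤ wt J h Λ ω σ := by
  unfold wt; split_ifs <;> positivity

lemma ZZ_one_pos (J : V → V → ℝ) (h : V → ℝ) (Λ : Finset V) (ω : V → Bool) :
    0 < ZZ J h Λ ω (fun _ => 1) := by
  unfold ZZ
  refine Finset.sum_pos' (fun σ _ => by simpa using wt_nonneg J h Λ ω σ) ⟨ω, mem_univ _, ?_⟩
  simp [wt, Real.exp_pos]

def quadEquiv : ((V → Bool) × (V → Bool)) × ((V → Bool) × (V → Bool)) ≃ (V → Quad) where
  toFun p := fun i => (p.1.1 i, p.1.2 i, p.2.1 i, p.2.2 i)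
  invFun θ := ((fun i => (θ i).1, fun i => (θ i).2.1), (fun i => (θ i).2.2.1, fun i => (θ i).2.2.2))
  left_inv p := rfl
  right_inv θ := rfl

lemma wt_quad (J : V → V → ℝ) (h : V → ℝ) (Λ : Finset V) (σ σ' τ τ' : V → Bool) :
    (wt J h Λ pl σ * wt J h Λ mi σ') * (wt J h Λ pl τ * wt J h Λ mi τ') =
      Real.exp (en J h σ + en J h σ' + en J h τ + en J h τ') *
        ∏ i, frz Λ i (quadEquiv ((σ, σ'), (τ, τ')) i) := by
  by_cases H : ∀ i, i ∉ Λ → (σ i = true ∧ σ' i = false ∧ τ i = true ∧ τ' i = false)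
  · have h1 : ∏ i, frz Λ i (quadEquiv ((σ, σ'), (τ, τ')) i) = 1 := by
      refine Finset.prod_eq_one fun i _ => ?_
      by_cases hi : i ∈ Λ
      · simp [frz, hi]
      · obtain ⟨a, b, c, e⟩ := H i hi
        simp [frz, hi, quadEquiv, a, b, c, e]
    rw [h1]
    unfold wt
    rw [if_pos (fun i hi => (H i hi).1), if_pos (fun i hi => (H i hi).2.1),
      if_pos (fun i hi => (H i hi).2.2.1), if_pos (fun i hi => (H i hi).2.2.2)]
    rw [Real.exp_add, Real.exp_add, Real.exp_add]; ring
  · push Not at H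
    obtain ⟨i, hi, H⟩ := H
    have h1 : ∏ i, frz Λ i (quadEquiv ((σ, σ'), (τ, τ')) i) = 0 := by
      refine Finset.prod_eq_zero (mem_univ i) ?_
      simp only [frz, hi, if_false, quadEquiv, Equiv.coe_fn_mk, Prod.mk.injEq, ite_eq_right_iff]
      rintro ⟨a, b, c, e⟩
      exact absurd e (H a b c)
    rw [h1, mul_zero]
    unfold wt
    split_ifs with a b c e <;> simp
    exact H (a i hi) (b i hi) (c i hi) (e i hi)

lemma en_quad (J : V → V → ℝ) (h : V → ℝ) (σ σ' τ τ' : V → Bool) :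
    en J h σ + en J h σ' + en J h τ + en J h τ' =
      (fun θ : V → Quad => ∑ i, ∑ j, (J i j / 4) * (qal (θ i) * qal (θ j) + qbe (θ i) * qbe (θ j)
        + qga (θ i) * qga (θ j) + qde (θ i) * qde (θ j)) + ∑ i, h i * qal (θ i))
        (quadEquiv ((σ, σ'), (τ, τ'))) := by
  have : ∀ a b c d e f g k : ℝ, (a + b) + (c + d) + (e + f) + (g + k)
    = (a + c + e + g) + (b + d + f + k) := by intros; ring
  simp only [en]
  rw [this]
  refine congrArg₂ (· + ·) ?_ ?_
  · simp only [← Finset.sum_add_distrib]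
    refine Finset.sum_congr rfl fun i _ => Finset.sum_congr rfl fun j _ => ?_
    simp only [quadEquiv, Equiv.coe_fn_mk, qal, qbe, qga, qde]; ring
  · simp only [← Finset.sum_add_distrib]
    refine Finset.sum_congr rfl fun i _ => ?_
    simp only [quadEquiv, Equiv.coe_fn_mk, qal]; ring

lemma cone_boltz (J : V → V → ℝ) (h : V → ℝ) (hJ : ∀ i j, 0 ≤ J i j) (hh : ∀ i, 0 ≤ h i) :
    Cone (fun θ : V → Quad => Real.exp (∑ i, ∑ j, (J i j / 4) * (qal (θ i) * qal (θ j)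
        + qbe (θ i) * qbe (θ j) + qga (θ i) * qga (θ j) + qde (θ i) * qde (θ j))
        + ∑ i, h i * qal (θ i))) := by
  refine Cone.exp (Cone.add (Cone.sum _ _ fun i _ => Cone.sum _ _ fun j _ => ?_)
    (Cone.sum _ _ fun i _ => (Cone.al i).smul _ (hh i)))
  refine Cone.smul _ (by have := hJ i j; positivity) ?_
  exact ((((Cone.al i).mul (Cone.al j)).add ((Cone.be i).mul (Cone.be j))).add
    ((Cone.ga i).mul (Cone.ga j))).add ((Cone.de i).mul (Cone.de j))

/-- `f` is a function of a pair of replicas whose symmetric and antisymmetric parts are in the cone. -/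
def DCone (f : (V → Bool) → (V → Bool) → ℝ) : Prop :=
  Cone (fun θ : V → Quad => f (fun i => (θ i).2.2.1) (fun i => (θ i).2.2.2)
      + f (fun i => (θ i).1) (fun i => (θ i).2.1)) ∧
  Cone (fun θ : V → Quad => f (fun i => (θ i).2.2.1) (fun i => (θ i).2.2.2)
      - f (fun i => (θ i).1) (fun i => (θ i).2.1))

lemma DCone.const (r : ℝ) (hr : 0 ≤ r) : DCone (V := V) (fun _ _ => r) := by
  refine ⟨?_, ?_⟩
  · exact (Cone.const r hr).add (Cone.const r hr)
  · simpa using Cone.zero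

lemma DCone.t (x : V) : DCone (V := V) (fun σ σ' => spin (σ x) + spin (σ' x)) := by
  refine ⟨?_, ?_⟩
  · convert Cone.al x using 2; simp only [qal]; ring
  · convert Cone.be x using 2; simp only [qbe]; ring

lemma DCone.add {f g : (V → Bool) → (V → Bool) → ℝ} (hf : DCone f) (hg : DCone g) :
    DCone (fun σ σ' => f σ σ' + g σ σ') := by
  refine ⟨?_, ?_⟩
  · convert hf.1.add hg.1 using 2; ring
  · convert hf.2.add hg.2 using 2; ring

lemma DCone.mul {f g : (V → Bool) → (V → Bool) → ℝ} (hf : DCone f) (hg : DCone g) :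
    DCone (fun σ σ' => f σ σ' * g σ σ') := by
  refine ⟨?_, ?_⟩
  · convert ((hf.1.mul hg.1).add (hf.2.mul hg.2)).smul (1/2) (by norm_num) using 2; ring
  · convert ((hf.1.mul hg.2).add (hf.2.mul hg.1)).smul (1/2) (by norm_num) using 2; ring

lemma DCone.prod {ι : Type*} (s : Finset ι) (f : ι → (V → Bool) → (V → Bool) → ℝ)
    (hf : ∀ i ∈ s, DCone (f i)) : DCone (fun σ σ' => ∏ i ∈ s, f i σ σ') := by
  classical
  induction s using Finset.induction_on with
  | empty => simpa using DCone.const (V := V) 1 zero_le_one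
  | insert a s ha ih =>
    simp only [Finset.prod_insert ha]
    exact (hf a (by simp)).mul (ih fun i hi => hf i (by simp [hi]))

/-- Lebowitz-type inequality. -/
lemma lebowitz_raw (J : V → V → ℝ) (h : V → ℝ) (hJ : ∀ i j, 0 ≤ J i j) (hh : ∀ i, 0 ≤ h i)
    (Λ : Finset V) (y : V) (f : (V → Bool) → (V → Bool) → ℝ) (hf : DCone f) :
    (∑ p : (V → Bool) × (V → Bool), (spin (p.1 y) - spin (p.2 y)) * f p.1 p.2 *
        (wt J h Λ pl p.1 * wt J h Λ mi p.2)) *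
      (∑ p : (V → Bool) × (V → Bool), wt J h Λ pl p.1 * wt J h Λ mi p.2) ≤
    (∑ p : (V → Bool) × (V → Bool), (spin (p.1 y) - spin (p.2 y)) *
        (wt J h Λ pl p.1 * wt J h Λ mi p.2)) *
      (∑ p : (V → Bool) × (V → Bool), f p.1 p.2 * (wt J h Λ pl p.1 * wt J h Λ mi p.2)) := by
  set m : (V → Bool) × (V → Bool) → ℝ := fun p => wt J h Λ pl p.1 * wt J h Λ mi p.2 with hm
  set q : (V → Bool) × (V → Bool) → ℝ := fun p => spin (p.1 y) - spin (p.2 y) with hq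
  have key : 0 ≤ ∑ p : ((V → Bool) × (V → Bool)) × ((V → Bool) × (V → Bool)),
      (q p.1 - q p.2) * (f p.2.1 p.2.2 - f p.1.1 p.1.2) * (m p.1 * m p.2) := by
    have hc := (((Cone.de y).mul hf.2).mul (cone_boltz J h hJ hh)).sum_nonneg Λ
    refine hc.trans (le_of_eq ?_)
    rw [← quadEquiv.sum_comp]
    refine Finset.sum_congr rfl fun p _ => ?_
    obtain ⟨⟨σ, σ'⟩, ⟨τ, τ'⟩⟩ := p
    simp only [hm]
    rw [wt_quad, en_quad]
    simp only [hq, quadEquiv, Equiv.coe_fn_mk, qde]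
    ring
  have expand : ∑ p : ((V → Bool) × (V → Bool)) × ((V → Bool) × (V → Bool)),
      (q p.1 - q p.2) * (f p.2.1 p.2.2 - f p.1.1 p.1.2) * (m p.1 * m p.2) =
      2 * ((∑ p, q p * m p) * (∑ p, f p.1 p.2 * m p) - (∑ p, q p * f p.1 p.2 * m p) * ∑ p, m p) := by
    have e1 : ∀ u v : (V → Bool) × (V → Bool) → ℝ, (∑ p, u p) * (∑ p, v p) =
        ∑ p : ((V → Bool) × (V → Bool)) × ((V → Bool) × (V → Bool)), u p.1 * v p.2 := by
      intro u v
      rw [Finset.sum_mul_sum]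
      exact (Fintype.sum_prod_type (fun p : ((V → Bool) × (V → Bool)) × ((V → Bool) × (V → Bool)) =>
        u p.1 * v p.2)).symm
    have e2 : 2 * ((∑ p, q p * m p) * (∑ p, f p.1 p.2 * m p)
        - (∑ p, q p * f p.1 p.2 * m p) * ∑ p, m p)
      = (∑ p, q p * m p) * (∑ p, f p.1 p.2 * m p) + (∑ p, f p.1 p.2 * m p) * (∑ p, q p * m p)
        - (∑ p, q p * f p.1 p.2 * m p) * ∑ p, m p - (∑ p, m p) * (∑ p, q p * f p.1 p.2 * m p) := by
      ring
    rw [e2]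
    simp only [e1, ← Finset.sum_add_distrib, ← Finset.sum_sub_distrib]
    refine Finset.sum_congr rfl fun p _ => ?_
    ring
  rw [expand] at key
  linarith

lemma ZZ_pair (J : V → V → ℝ) (h : V → ℝ) (Λ : Finset V) (u v : (V → Bool) → ℝ) :
    ∑ p : (V → Bool) × (V → Bool), (u p.1 * v p.2) * (wt J h Λ pl p.1 * wt J h Λ mi p.2) =
      ZZ J h Λ pl u * ZZ J h Λ mi v := by
  unfold ZZ
  rw [Finset.sum_mul_sum, Fintype.sum_prod_type]
  refine Finset.sum_congr rfl fun i _ => Finset.sum_congr rfl fun j _ => ?_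
  ring

/-- The influence of the boundary condition on the spin at `x`. -/
noncomputable def gap (J : V → V → ℝ) (h : V → ℝ) (Λ : Finset V) (x : V) : ℝ :=
  Ex J h Λ pl (fun σ => spin (σ x)) - Ex J h Λ mi (fun σ => spin (σ x))

/-- Conditioned form for a product function. -/
lemma lebowitz (J : V → V → ℝ) (h : V → ℝ) (hJ : ∀ i j, 0 ≤ J i j) (hh : ∀ i, 0 ≤ h i)
    (Λ : Finset V) (y : V) (u : (V → Bool) → ℝ)
    (hf : DCone (fun σ σ' => u σ * u σ'))
    (hp : 0 < ZZ J h Λ pl u) (hm : 0 < ZZ J h Λ mi u) :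
    ZZ J h Λ pl (fun σ => spin (σ y) * u σ) / ZZ J h Λ pl u -
      ZZ J h Λ mi (fun σ => spin (σ y) * u σ) / ZZ J h Λ mi u ≤ gap J h Λ y := by
  have H := lebowitz_raw J h hJ hh Λ y _ hf
  have e1 : ∑ p : (V → Bool) × (V → Bool), (spin (p.1 y) - spin (p.2 y)) * (u p.1 * u p.2) *
        (wt J h Λ pl p.1 * wt J h Λ mi p.2) =
      ZZ J h Λ pl (fun σ => spin (σ y) * u σ) * ZZ J h Λ mi u -
      ZZ J h Λ pl u * ZZ J h Λ mi (fun σ => spin (σ y) * u σ) := by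
    rw [← ZZ_pair, ← ZZ_pair, ← Finset.sum_sub_distrib]
    refine Finset.sum_congr rfl fun p _ => ?_
    ring
  have e2 : ∑ p : (V → Bool) × (V → Bool), (spin (p.1 y) - spin (p.2 y)) *
        (wt J h Λ pl p.1 * wt J h Λ mi p.2) =
      ZZ J h Λ pl (fun σ => spin (σ y)) * ZZ J h Λ mi (fun _ => 1) -
      ZZ J h Λ pl (fun _ => 1) * ZZ J h Λ mi (fun σ => spin (σ y)) := by
    rw [← ZZ_pair, ← ZZ_pair, ← Finset.sum_sub_distrib]
    refine Finset.sum_congr rfl fun p _ => ?_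
    ring
  have e3 : ∑ p : (V → Bool) × (V → Bool), (wt J h Λ pl p.1 * wt J h Λ mi p.2) =
      ZZ J h Λ pl (fun _ => 1) * ZZ J h Λ mi (fun _ => 1) := by
    rw [← ZZ_pair]; simp
  have e4 := ZZ_pair J h Λ u u
  rw [e1, e2, e3, e4] at H
  have p1 := ZZ_one_pos J h Λ pl
  have p2 := ZZ_one_pos J h Λ mi
  unfold gap Ex
  rw [div_sub_div _ _ hp.ne' hm.ne', div_sub_div _ _ p1.ne' p2.ne', div_le_div_iff₀ (by positivity)
    (by positivity)]
  linarith

lemma dcone_exp (k : V → ℝ) (hk : ∀ i, 0 ≤ k i) :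
    DCone (fun σ σ' : V → Bool => Real.exp (∑ i, k i * spin (σ i)) *
      Real.exp (∑ i, k i * spin (σ' i))) := by
  have : (fun σ σ' : V → Bool => Real.exp (∑ i, k i * spin (σ i)) *
      Real.exp (∑ i, k i * spin (σ' i))) = fun σ σ' => ∏ i,
      (1 + (Real.sinh (2 * k i) / 2) * (spin (σ i) + spin (σ' i)) +
        ((Real.cosh (2 * k i) - 1) / 4) *
          ((spin (σ i) + spin (σ' i)) * (spin (σ i) + spin (σ' i)))) := by
    funext σ σ'
    rw [← Real.exp_add, ← Finset.sum_add_distrib, Real.exp_sum]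
    refine Finset.prod_congr rfl fun i _ => ?_
    rw [Real.cosh_eq, Real.sinh_eq]
    cases σ i <;> cases σ' i <;> simp only [spin_true, spin_false]
    · rw [show k i * -1 + k i * -1 = -(2 * k i) by ring]; ring
    · norm_num
    · norm_num
    · rw [show k i * 1 + k i * 1 = (2 * k i) by ring]; ring
  rw [this]
  refine DCone.prod _ _ fun i _ => ?_
  have hs : 0 ≤ Real.sinh (2 * k i) := Real.sinh_nonneg_iff.2 (by linarith [hk i])
  have hc : 1 ≤ Real.cosh (2 * k i) := Real.one_le_cosh _
  exact ((DCone.const 1 zero_le_one).add ((DCone.const _ (by positivity)).mul (DCone.t i))).add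
    ((DCone.const _ (by linarith)).mul ((DCone.t i).mul (DCone.t i)))

lemma wt_add_field (J : V → V → ℝ) (h k : V → ℝ) (Λ : Finset V) (ω σ : V → Bool) :
    wt J (fun i => h i + k i) Λ ω σ = Real.exp (∑ i, k i * spin (σ i)) * wt J h Λ ω σ := by
  unfold wt
  split_ifs
  · rw [← Real.exp_add]; congr 1; simp only [en, add_mul, Finset.sum_add_distrib]; ring
  · simp

/-- The gap is decreasing in the (nonnegative) field. -/
lemma gap_anti (J : V → V → ℝ) (h h' : V → ℝ) (hJ : ∀ i j, 0 ≤ J i j) (hh : ∀ i, 0 ≤ h i)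
    (hle : ∀ i, h i ≤ h' i) (Λ : Finset V) (y : V) :
    gap J h' Λ y ≤ gap J h Λ y := by
  set k : V → ℝ := fun i => h' i - h i with hk
  have hh' : h' = fun i => h i + k i := by funext i; simp [hk]
  have hz : ∀ ω (g : (V → Bool) → ℝ), ZZ J h' Λ ω g =
      ZZ J h Λ ω (fun σ => g σ * Real.exp (∑ i, k i * spin (σ i))) := by
    intro ω g
    unfold ZZ
    refine Finset.sum_congr rfl fun σ _ => ?_
    rw [hh', wt_add_field]; ring
  have hz1 : ∀ ω, ZZ J h' Λ ω (fun _ => 1) =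
      ZZ J h Λ ω (fun σ => Real.exp (∑ i, k i * spin (σ i))) := by
    intro ω; rw [hz]; simp
  have := lebowitz J h hJ hh Λ y (fun σ => Real.exp (∑ i, k i * spin (σ i)))
    (dcone_exp k fun i => by simp [hk, hle i])
    (by rw [← hz1]; exact ZZ_one_pos _ _ _ _) (by rw [← hz1]; exact ZZ_one_pos _ _ _ _)
  rw [← hz1, ← hz1, ← hz, ← hz] at this
  exact this

/-- Indicator that all spins of `S` are plus. -/
noncomputable def ind (S : Finset V) (σ : V → Bool) : ℝ := if ∀ i ∈ S, σ i = true then 1 else 0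

lemma ind_nonneg (S : Finset V) (σ : V → Bool) : 0 ≤ ind S σ := by
  unfold ind; split_ifs <;> norm_num

lemma ind_eq_prod (S : Finset V) (σ : V → Bool) : ind S σ = ∏ i ∈ S, (1 + spin (σ i)) / 2 := by
  unfold ind
  split_ifs with H
  · symm; refine Finset.prod_eq_one fun i hi => ?_
    rw [H i hi, spin_true]; norm_num
  · push Not at H
    obtain ⟨i, hi, H⟩ := H
    symm; refine Finset.prod_eq_zero hi ?_
    have : σ i = false := by simpa using H
    rw [this, spin_false]; norm_num

lemma dcone_ind (S : Finset V) : DCone (fun σ σ' : V → Bool => ind S σ * ind S σ') := by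
  have : (fun σ σ' : V → Bool => ind S σ * ind S σ') = fun σ σ' => ∏ i ∈ S,
      ((1/4) * (spin (σ i) + spin (σ' i)) +
        (1/8) * ((spin (σ i) + spin (σ' i)) * (spin (σ i) + spin (σ' i)))) := by
    funext σ σ'
    rw [ind_eq_prod, ind_eq_prod, ← Finset.prod_mul_distrib]
    refine Finset.prod_congr rfl fun i _ => ?_
    cases σ i <;> cases σ' i <;> simp only [spin_true, spin_false] <;> norm_num
  rw [this]
  refine DCone.prod _ _ fun i _ => ?_
  exact ((DCone.const _ (by norm_num)).mul (DCone.t i)).add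
    ((DCone.const _ (by norm_num)).mul ((DCone.t i).mul (DCone.t i)))

end Weights


section Tools
variable {V : Type*} [Fintype V] [DecidableEq V]

lemma holley_div (f g φ : (V → Bool) → ℝ) (hf : ∀ a, 0 ≤ f a) (hg : ∀ a, 0 ≤ g a)
    (hfs : 0 < ∑ a, f a) (hgs : 0 < ∑ a, g a) (hφ : Monotone φ)
    (h : ∀ a b, f a * g b ≤ f (a ⊓ b) * g (a ⊔ b)) :
    (∑ a, φ a * f a) / (∑ a, f a) ≤ (∑ a, φ a * g a) / (∑ a, g a) := by
  set m := φ ⊥ with hm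
  have H := holley (fun a => f a / ∑ a, f a) (fun a => g a / ∑ a, g a) (fun a => φ a - m)
    (fun a => by simpa using hφ bot_le)
    (fun a => div_nonneg (hf a) hfs.le) (fun a => div_nonneg (hg a) hgs.le)
    (fun a b hab => by simpa using hφ hab)
    (by rw [← Finset.sum_div, ← Finset.sum_div, div_self hfs.ne', div_self hgs.ne'])
    (fun a b => by
      rw [div_mul_div_comm, div_mul_div_comm]
      exact div_le_div_of_nonneg_right (h a b) (by positivity))
  have e : ∀ k : (V → Bool) → ℝ, 0 < ∑ a, k a → ∑ a, (φ a - m) * (k a / ∑ a, k a) =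
      (∑ a, φ a * k a) / (∑ a, k a) - m := by
    intro k hk
    have : ∀ a, (φ a - m) * (k a / ∑ a, k a) = (φ a * k a) / (∑ a, k a) - m * k a / (∑ a, k a) := by
      intro a; ring
    simp only [this, Finset.sum_sub_distrib, ← Finset.sum_div, ← Finset.mul_sum]
    rw [mul_div_assoc, div_self hk.ne', mul_one]
  rw [e f hfs, e g hgs] at H
  linarith

lemma spin_mono {a b : Bool} (h : a ≤ b) : spin a ≤ spin b := by
  revert h
  cases a <;> cases b <;> simp [spin]

lemma en_supermod (J : V → V → ℝ) (h : V → ℝ) (hJ : ∀ i j, 0 ≤ J i j) (a b : V → Bool) :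
    en J h a + en J h b ≤ en J h (a ⊓ b) + en J h (a ⊔ b) := by
  unfold en
  have h1 : ∑ i, h i * spin (a i) + ∑ i, h i * spin (b i) =
      ∑ i, h i * spin ((a ⊓ b) i) + ∑ i, h i * spin ((a ⊔ b) i) := by
    rw [← Finset.sum_add_distrib, ← Finset.sum_add_distrib]
    refine Finset.sum_congr rfl fun i _ => ?_
    simp only [Pi.inf_apply, Pi.sup_apply]
    cases a i <;> cases b i <;> simp [spin]
  have h2 : ∑ i, ∑ j, J i j * (spin (a i) * spin (a j)) + ∑ i, ∑ j, J i j * (spin (b i) * spin (b j))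
      ≤ ∑ i, ∑ j, J i j * (spin ((a ⊓ b) i) * spin ((a ⊓ b) j)) +
        ∑ i, ∑ j, J i j * (spin ((a ⊔ b) i) * spin ((a ⊔ b) j)) := by
    simp only [← Finset.sum_add_distrib]
    refine Finset.sum_le_sum fun i _ => Finset.sum_le_sum fun j _ => ?_
    rw [← mul_add, ← mul_add]
    refine mul_le_mul_of_nonneg_left ?_ (hJ i j)
    simp only [Pi.inf_apply, Pi.sup_apply]
    cases a i <;> cases b i <;> cases a j <;> cases b j <;> norm_num [spin]
  linarith

lemma wt_supermod (J : V → V → ℝ) (h : V → ℝ) (hJ : ∀ i j, 0 ≤ J i j) (Λ : Finset V)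
    {ω ω' : V → Bool} (hω : ω ≤ ω') (a b : V → Bool) :
    wt J h Λ ω a * wt J h Λ ω' b ≤ wt J h Λ ω (a ⊓ b) * wt J h Λ ω' (a ⊔ b) := by
  by_cases ha : ∀ i, i ∉ Λ → a i = ω i
  · by_cases hb : ∀ i, i ∉ Λ → b i = ω' i
    · have h1 : ∀ i, i ∉ Λ → (a ⊓ b) i = ω i := fun i hi => by
        rw [Pi.inf_apply, ha i hi, hb i hi]; exact inf_eq_left.2 (hω i)
      have h2 : ∀ i, i ∉ Λ → (a ⊔ b) i = ω' i := fun i hi => by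
        rw [Pi.sup_apply, ha i hi, hb i hi]; exact sup_eq_right.2 (hω i)
      unfold wt
      rw [if_pos ha, if_pos hb, if_pos h1, if_pos h2, ← Real.exp_add, ← Real.exp_add]
      exact Real.exp_le_exp.2 (en_supermod J h hJ a b)
    · have : wt J h Λ ω' b = 0 := if_neg hb
      rw [this, mul_zero]; exact mul_nonneg (wt_nonneg _ _ _ _ _) (wt_nonneg _ _ _ _ _)
  · have : wt J h Λ ω a = 0 := if_neg ha
    rw [this, zero_mul]; exact mul_nonneg (wt_nonneg _ _ _ _ _) (wt_nonneg _ _ _ _ _)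

lemma ZZ_one (J : V → V → ℝ) (h : V → ℝ) (Λ : Finset V) (ω : V → Bool) :
    ZZ J h Λ ω (fun _ => 1) = ∑ σ, wt J h Λ ω σ := by simp [ZZ]

lemma Ex_mono (J : V → V → ℝ) (h : V → ℝ) (hJ : ∀ i j, 0 ≤ J i j) (Λ : Finset V)
    {ω ω' : V → Bool} (hω : ω ≤ ω') (f : (V → Bool) → ℝ) (hf : Monotone f) :
    Ex J h Λ ω f ≤ Ex J h Λ ω' f := by
  unfold Ex
  rw [ZZ_one, ZZ_one]
  refine holley_div _ _ f (wt_nonneg _ _ _ _) (wt_nonneg _ _ _ _) ?_ ?_ hf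
    (wt_supermod J h hJ Λ hω)
  · rw [← ZZ_one]; exact ZZ_one_pos _ _ _ _
  · rw [← ZZ_one]; exact ZZ_one_pos _ _ _ _

lemma mono_spin (x : V) : Monotone (fun σ : V → Bool => spin (σ x)) :=
  fun a b hab => spin_mono (hab x)

lemma mi_le_pl : (mi : V → Bool) ≤ pl := fun _ => by simp

lemma gap_nonneg (J : V → V → ℝ) (h : V → ℝ) (hJ : ∀ i j, 0 ≤ J i j) (Λ : Finset V) (x : V) :
    0 ≤ gap J h Λ x := sub_nonneg.2 (Ex_mono J h hJ Λ mi_le_pl _ (mono_spin x))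

lemma ind_mono (S : Finset V) : Monotone (ind S) := by
  intro a b hab
  unfold ind
  split_ifs with h1 h2 h2
  · exact le_rfl
  · exact absurd (fun i hi => by
      have := hab i
      rw [h1 i hi] at this
      exact top_le_iff.1 this) h2
  · norm_num
  · exact le_rfl

lemma Ex_const (J : V → V → ℝ) (h : V → ℝ) (Λ : Finset V) (ω : V → Bool) (c : ℝ) :
    Ex J h Λ ω (fun _ => c) = c := by
  have := ZZ_one_pos J h Λ ω
  unfold Ex
  rw [div_eq_iff this.ne']
  simp [ZZ, Finset.mul_sum]

lemma Ex_le_of_le (J : V → V → ℝ) (h : V → ℝ) (Λ : Finset V) (ω : V → Bool)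
    (f g : (V → Bool) → ℝ) (hfg : ∀ σ, f σ ≤ g σ) : Ex J h Λ ω f ≤ Ex J h Λ ω g := by
  unfold Ex
  refine div_le_div_of_nonneg_right ?_ (ZZ_one_pos J h Λ ω).le
  exact Finset.sum_le_sum fun σ _ => mul_le_mul_of_nonneg_right (hfg σ) (wt_nonneg _ _ _ _ _)

lemma Ex_add (J : V → V → ℝ) (h : V → ℝ) (Λ : Finset V) (ω : V → Bool)
    (f g : (V → Bool) → ℝ) : Ex J h Λ ω (fun σ => f σ + g σ) = Ex J h Λ ω f + Ex J h Λ ω g := by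
  unfold Ex ZZ
  simp only [add_mul, Finset.sum_add_distrib, add_div]

lemma Ex_smul (J : V → V → ℝ) (h : V → ℝ) (Λ : Finset V) (ω : V → Bool) (c : ℝ)
    (f : (V → Bool) → ℝ) : Ex J h Λ ω (fun σ => c * f σ) = c * Ex J h Λ ω f := by
  unfold Ex ZZ
  simp only [mul_assoc, ← Finset.mul_sum, mul_div_assoc]

lemma Ex_sum {ι : Type*} (J : V → V → ℝ) (h : V → ℝ) (Λ : Finset V) (ω : V → Bool) (s : Finset ι)
    (f : ι → (V → Bool) → ℝ) :
    Ex J h Λ ω (fun σ => ∑ i ∈ s, f i σ) = ∑ i ∈ s, Ex J h Λ ω (f i) := by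
  unfold Ex ZZ
  rw [← Finset.sum_div]
  congr 1
  simp only [Finset.sum_mul]
  exact Finset.sum_comm

lemma abs_spin (b : Bool) : |spin b| = 1 := by cases b <;> simp [spin]

lemma gap_le_two (J : V → V → ℝ) (h : V → ℝ) (Λ : Finset V) (x : V) : gap J h Λ x ≤ 2 := by
  have h1 : Ex J h Λ pl (fun σ => spin (σ x)) ≤ 1 := by
    rw [← Ex_const J h Λ pl 1]
    exact Ex_le_of_le _ _ _ _ _ _ fun σ => (abs_le.1 (abs_spin (σ x)).le).2
  have h2 : -1 ≤ Ex J h Λ mi (fun σ => spin (σ x)) := by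
    rw [← Ex_const J h Λ mi (-1)]
    exact Ex_le_of_le _ _ _ _ _ _ fun σ => (abs_le.1 (abs_spin (σ x)).le).1
  unfold gap; linarith

/-! ### Flip -/

lemma en_flip (J : V → V → ℝ) (h : V → ℝ) (hJ : ∀ i j, 0 ≤ J i j) (hh : ∀ i, 0 ≤ h i) (b : ℝ)
    (hb : ∀ i, ∑ j, J i j ≤ b) (hb' : ∀ j, ∑ i, J i j ≤ b) (y : V) (σ : V → Bool)
    (hy : σ y = true) : en J h (Function.update σ y false) ≤ en J h σ + 4 * b := by
  unfold en
  have h1 : ∑ i, h i * spin (Function.update σ y false i) ≤ ∑ i, h i * spin (σ i) := by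
    refine Finset.sum_le_sum fun i _ => mul_le_mul_of_nonneg_left ?_ (hh i)
    by_cases hi : i = y
    · subst hi; simp [hy, spin]
    · simp [hi]
  have h2 : ∑ i, ∑ j, J i j * (spin (Function.update σ y false i) * spin (Function.update σ y false j))
      ≤ ∑ i, ∑ j, (J i j * (spin (σ i) * spin (σ j)) + J i j * (if i = y then 2 else 0)
        + J i j * (if j = y then 2 else 0)) := by
    refine Finset.sum_le_sum fun i _ => Finset.sum_le_sum fun j _ => ?_
    rw [← mul_add, ← mul_add]
    refine mul_le_mul_of_nonneg_left ?_ (hJ i j)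
    by_cases hi : i = y <;> by_cases hj : j = y
    · simp [hi, hj, hy, spin]; try norm_num
    · simp only [hi, Function.update_self, ne_eq, hj, not_false_eq_true, Function.update_of_ne, hy]
      cases σ j <;> norm_num [spin]
    · simp only [hi, hj, Function.update_self, ne_eq, not_false_eq_true, Function.update_of_ne, hy]
      cases σ i <;> norm_num [spin]
    · simp [hi, hj]
  have h3 : ∑ i, ∑ j, (J i j * (spin (σ i) * spin (σ j)) + J i j * (if i = y then 2 else 0)
        + J i j * (if j = y then 2 else 0)) = ∑ i, ∑ j, J i j * (spin (σ i) * spin (σ j))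
        + 2 * ∑ j, J y j + 2 * ∑ i, J i y := by
    simp only [Finset.sum_add_distrib]
    congr 1
    · congr 1
      rw [Finset.sum_eq_single y]
      · simp only [if_true, ← Finset.sum_mul, mul_comm]
      · intro i _ hi; simp [hi]
      · simp
    · rw [Finset.mul_sum]
      refine Finset.sum_congr rfl fun i _ => ?_
      simp [mul_comm]
  linarith [hb y, hb' y]

def flipE (y : V) : (V → Bool) ≃ (V → Bool) where
  toFun σ := Function.update σ y (!σ y)
  invFun σ := Function.update σ y (!σ y)
  left_inv σ := by simp
  right_inv σ := by simp

lemma ZZ_ind_flip (J : V → V → ℝ) (h : V → ℝ) (hJ : ∀ i j, 0 ≤ J i j) (hh : ∀ i, 0 ≤ h i) (b : ℝ)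
    (hb : ∀ i, ∑ j, J i j ≤ b) (hb' : ∀ j, ∑ i, J i j ≤ b) (Λ : Finset V) (ω : V → Bool)
    (S : Finset V) (y : V) (hyΛ : y ∈ Λ) (hyS : y ∉ S) :
    ZZ J h Λ ω (ind S) ≤ (1 + Real.exp (4 * b)) * ZZ J h Λ ω (ind (insert y S)) := by
  have e1 : ZZ J h Λ ω (ind S) = ZZ J h Λ ω (ind (insert y S)) +
      ∑ σ, (ind S σ * (if σ y = false then 1 else 0)) * wt J h Λ ω σ := by
    unfold ZZ
    rw [← Finset.sum_add_distrib]
    refine Finset.sum_congr rfl fun σ _ => ?_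
    rw [← add_mul]
    congr 1
    unfold ind
    by_cases hy : σ y = true
    · simp [hy]
    · have : σ y = false := by simpa using hy
      simp [this]
  have e2 : ∑ σ, (ind S σ * (if σ y = false then 1 else 0)) * wt J h Λ ω σ ≤
      Real.exp (4 * b) * ZZ J h Λ ω (ind (insert y S)) := by
    rw [← (flipE y).sum_comp]
    unfold ZZ
    rw [Finset.mul_sum]
    refine Finset.sum_le_sum fun σ _ => ?_
    by_cases hy : σ y = true
    · have hf : flipE y σ = Function.update σ y false := by simp [flipE, hy]
      rw [hf]
      have i1 : ind S (Function.update σ y false) = ind (insert y S) σ := by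
        unfold ind
        refine if_congr ?_ rfl rfl
        simp only [Finset.mem_insert, forall_eq_or_imp, hy, true_and]
        refine forall₂_congr fun i hi => ?_
        rw [Function.update_of_ne (by rintro rfl; exact hyS hi)]
      have i2 : wt J h Λ ω (Function.update σ y false) ≤ Real.exp (4 * b) * wt J h Λ ω σ := by
        unfold wt
        have : (∀ i, i ∉ Λ → Function.update σ y false i = ω i) ↔ ∀ i, i ∉ Λ → σ i = ω i := by
          refine forall₂_congr fun i hi => ?_
          rw [Function.update_of_ne (by rintro rfl; exact hi hyΛ)]
        by_cases H : ∀ i, i ∉ Λ → σ i = ω i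
        · rw [if_pos (this.2 H), if_pos H, ← Real.exp_add]
          refine Real.exp_le_exp.2 ?_
          linarith [en_flip J h hJ hh b hb hb' y σ hy]
        · rw [if_neg (fun h => H (this.1 h)), if_neg H, mul_zero]
      rw [i1]
      simp only [Function.update_self, if_true, mul_one]
      calc _ ≤ ind (insert y S) σ * (Real.exp (4 * b) * wt J h Λ ω σ) :=
            mul_le_mul_of_nonneg_left i2 (ind_nonneg _ _)
        _ = _ := by ring
    · have hy' : σ y = false := by simpa using hy
      have : flipE y σ y = true := by simp [flipE, hy']
      simp only [this, Bool.true_eq_false, if_false, mul_zero, zero_mul]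
      exact mul_nonneg (Real.exp_pos _).le (mul_nonneg (ind_nonneg _ _) (wt_nonneg _ _ _ _ _))
  linarith

/-! ### Swap -/

def swp {α : Type*} (A : Finset V) (σ σ' : V → α) : V → α := fun i => if i ∈ A then σ' i else σ i

lemma swp_swp {α : Type*} (A : Finset V) (σ σ' : V → α) :
    swp A (swp A σ σ') (swp A σ' σ) = σ := by
  funext i; by_cases hi : i ∈ A <;> simp [swp, hi]

def swpE (A : Finset V) : (V → Bool) × (V → Bool) ≃ (V → Bool) × (V → Bool) where
  toFun p := (swp A p.1 p.2, swp A p.2 p.1)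
  invFun p := (swp A p.1 p.2, swp A p.2 p.1)
  left_inv p := by simp [swp_swp]
  right_inv p := by simp [swp_swp]

lemma en_swap (J : V → V → ℝ) (h k : V → ℝ) (A : Finset V) (σ σ' : V → Bool)
    (hs : ∀ i ∈ A, ∀ j, j ∉ A → (J i j ≠ 0 ∨ J j i ≠ 0) → σ j = σ' j) :
    en J h σ + en J k σ' = en J (swp A h k) (swp A σ σ') + en J (swp A k h) (swp A σ' σ) := by
  unfold en
  have h1 : ∑ i, h i * spin (σ i) + ∑ i, k i * spin (σ' i) =
      ∑ i, swp A h k i * spin (swp A σ σ' i) + ∑ i, swp A k h i * spin (swp A σ' σ i) := by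
    rw [← Finset.sum_add_distrib, ← Finset.sum_add_distrib]
    refine Finset.sum_congr rfl fun i _ => ?_
    by_cases hi : i ∈ A <;> simp [swp, hi, add_comm]
  have h2 : ∑ i, ∑ j, J i j * (spin (σ i) * spin (σ j)) +
      ∑ i, ∑ j, J i j * (spin (σ' i) * spin (σ' j))
      = ∑ i, ∑ j, J i j * (spin (swp A σ σ' i) * spin (swp A σ σ' j)) +
        ∑ i, ∑ j, J i j * (spin (swp A σ' σ i) * spin (swp A σ' σ j)) := by
    simp only [← Finset.sum_add_distrib]
    refine Finset.sum_congr rfl fun i _ => Finset.sum_congr rfl fun j _ => ?_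
    by_cases h0 : J i j = 0
    · simp [h0]
    by_cases hi : i ∈ A <;> by_cases hj : j ∈ A
    · simp [swp, hi, hj, add_comm]
    · simp [swp, hi, hj, hs i hi j hj (Or.inl h0), add_comm]
    · simp [swp, hi, hj, hs j hj i hi (Or.inr h0), add_comm]
    · simp [swp, hi, hj]
  linarith

lemma wt_swap (J : V → V → ℝ) (h k : V → ℝ) (Λ A : Finset V) (hA : A ⊆ Λ) (ω ω' σ σ' : V → Bool)
    (hs : (∀ i, i ∉ Λ → σ i = ω i) → (∀ i, i ∉ Λ → σ' i = ω' i) →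
      ∀ i ∈ A, ∀ j, j ∉ A → (J i j ≠ 0 ∨ J j i ≠ 0) → σ j = σ' j) :
    wt J h Λ ω σ * wt J k Λ ω' σ' =
      wt J (swp A h k) Λ ω (swp A σ σ') * wt J (swp A k h) Λ ω' (swp A σ' σ) := by
  have e : ∀ (ω σ σ' : V → Bool), (∀ i, i ∉ Λ → swp A σ σ' i = ω i) ↔ ∀ i, i ∉ Λ → σ i = ω i := by
    intro ω σ σ'
    refine forall₂_congr fun i hi => ?_
    have hiA : i ∉ A := fun h => hi (hA h)
    simp [swp, hiA]
  unfold wt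
  simp only [e]
  by_cases h1 : ∀ i, i ∉ Λ → σ i = ω i
  · by_cases h2 : ∀ i, i ∉ Λ → σ' i = ω' i
    · rw [if_pos h1, if_pos h2, if_pos h1, if_pos h2, ← Real.exp_add, ← Real.exp_add,
        en_swap J h k A σ σ' (hs h1 h2)]
    · rw [if_neg h2, if_neg h2]; simp
  · rw [if_neg h1, if_neg h1]; simp

/-- The conditional expectation of a function supported in `Λ` depends only on the neighbours. -/
lemma Ex_local (J : V → V → ℝ) (h : V → ℝ) (Λ : Finset V) (ω ω' : V → Bool)
    (hs : ∀ i ∈ Λ, ∀ j, j ∉ Λ → (J i j ≠ 0 ∨ J j i ≠ 0) → ω j = ω' j) (x : V) (hx : x ∈ Λ) :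
    Ex J h Λ ω (fun σ => spin (σ x)) = Ex J h Λ ω' (fun σ => spin (σ x)) := by
  have p1 := ZZ_one_pos J h Λ ω
  have p2 := ZZ_one_pos J h Λ ω'
  unfold Ex
  rw [div_eq_div_iff p1.ne' p2.ne']
  unfold ZZ
  rw [mul_comm (∑ σ : V → Bool, spin (σ x) * wt J h Λ ω' σ)]
  rw [Finset.sum_mul_sum, Finset.sum_mul_sum, ← Fintype.sum_prod_type', ← Fintype.sum_prod_type',
    ← (swpE Λ).sum_comp]
  refine Finset.sum_congr rfl fun p _ => ?_
  have := wt_swap J h h Λ Λ subset_rfl ω ω' p.1 p.2 (fun h1 h2 i hi j hj hJ => by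
    rw [h1 j hj, h2 j hj]; exact hs i hi j hj hJ)
  have hw : swp Λ h h = h := by funext i; simp [swp]
  rw [hw] at this
  have hx' : swp Λ p.1 p.2 x = p.2 x := by simp [swp, hx]
  simp only [swpE, Equiv.coe_fn_mk, hx', one_mul]
  calc _ = spin (p.2 x) * (wt J h Λ ω (swp Λ p.1 p.2) * wt J h Λ ω' (swp Λ p.2 p.1)) := by ring
    _ = _ := by rw [← this]; ring

lemma ZZ_ind_swap (J : V → V → ℝ) (h k : V → ℝ) (Λ A S : Finset V) (hA : A ⊆ Λ)
    (hAS : Disjoint A S) (hk : ∀ i, i ∉ A → k i = h i)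
    (hs : ∀ i ∈ A, ∀ j, j ∉ A → (J i j ≠ 0 ∨ J j i ≠ 0) → j ∈ S) :
    ZZ J k Λ pl (ind S) * ZZ J h Λ mi (ind S) = ZZ J h Λ pl (ind S) * ZZ J k Λ mi (ind S) := by
  unfold ZZ
  rw [Finset.sum_mul_sum, Finset.sum_mul_sum, ← Fintype.sum_prod_type', ← Fintype.sum_prod_type',
    ← (swpE A).sum_comp (fun p : (V → Bool) × (V → Bool) =>
      ind S p.1 * wt J h Λ pl p.1 * (ind S p.2 * wt J k Λ mi p.2))]
  refine Finset.sum_congr rfl fun p _ => ?_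
  have hi : ∀ σ σ' : V → Bool, ind S (swp A σ σ') = ind S σ := by
    intro σ σ'
    unfold ind
    refine if_congr (forall₂_congr fun i hi => ?_) rfl rfl
    have : i ∉ A := fun h => Finset.disjoint_left.1 hAS h hi
    simp [swp, this]
  simp only [swpE, Equiv.coe_fn_mk, hi]
  by_cases h1 : ∀ i ∈ S, p.1 i = true
  · by_cases h2 : ∀ i ∈ S, p.2 i = true
    · have := wt_swap J k h Λ A hA pl mi p.1 p.2 (fun _ _ i hi j hj hJ => by
        have := hs i hi j hj hJ
        rw [h1 j this, h2 j this])
      have e1 : swp A k h = h := by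
        funext i; by_cases hi : i ∈ A <;> simp [swp, hi]
        exact hk i hi
      have e2 : swp A h k = k := by
        funext i; by_cases hi : i ∈ A <;> simp [swp, hi]
        exact (hk i hi).symm
      rw [e1, e2] at this
      linear_combination (ind S p.1 * ind S p.2) * this
    · have : ind S p.2 = 0 := if_neg h2
      simp [this]
  · have : ind S p.1 = 0 := if_neg h1
    simp [this]

end Tools


section KeyIneq
variable {V : Type*} [Fintype V] [DecidableEq V]

noncomputable def LR (J : V → V → ℝ) (h : V → ℝ) (Λ : Finset V) : ℝ :=
  Real.log (ZZ J h Λ pl (fun _ => 1)) - Real.log (ZZ J h Λ mi (fun _ => 1))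

lemma ZZ_raise (J : V → V → ℝ) (h : V → ℝ) (Λ : Finset V) (ω : V → Bool) (x : V) (δ : ℝ) :
    ZZ J (fun i => h i + if i = x then δ else 0) Λ ω (fun _ => 1) =
      ZZ J h Λ ω (fun _ => 1) *
        (Real.cosh δ + Real.sinh δ * Ex J h Λ ω (fun σ => spin (σ x))) := by
  have p := ZZ_one_pos J h Λ ω
  have e : ZZ J (fun i => h i + if i = x then δ else 0) Λ ω (fun _ => 1) =
      Real.cosh δ * ZZ J h Λ ω (fun _ => 1) + Real.sinh δ * ZZ J h Λ ω (fun σ => spin (σ x)) := by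
    unfold ZZ
    rw [Finset.mul_sum, Finset.mul_sum, ← Finset.sum_add_distrib]
    refine Finset.sum_congr rfl fun σ _ => ?_
    rw [wt_add_field J h (fun i => if i = x then δ else 0)]
    have : ∑ i, (if i = x then δ else 0) * spin (σ i) = δ * spin (σ x) := by simp
    rw [this, Real.cosh_eq, Real.sinh_eq]
    beta_reduce
    cases σ x
    · rw [spin_false, show δ * -1 = -δ by ring]; ring
    · rw [spin_true, mul_one]; ring
  rw [e]; unfold Ex; field_simp

lemma Ex_spin_bd (J : V → V → ℝ) (h : V → ℝ) (Λ : Finset V) (ω : V → Bool) (x : V) :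
    -1 ≤ Ex J h Λ ω (fun σ => spin (σ x)) ∧ Ex J h Λ ω (fun σ => spin (σ x)) ≤ 1 := by
  constructor
  · rw [← Ex_const J h Λ ω (-1)]
    exact Ex_le_of_le _ _ _ _ _ _ fun σ => (abs_le.1 (abs_spin (σ x)).le).1
  · rw [← Ex_const J h Λ ω 1]
    exact Ex_le_of_le _ _ _ _ _ _ fun σ => (abs_le.1 (abs_spin (σ x)).le).2

lemma LR_step (J : V → V → ℝ) (h : V → ℝ) (hJ : ∀ i j, 0 ≤ J i j) (Λ : Finset V) (x : V) (δ : ℝ)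
    (hδ : 0 < δ) :
    LR J h Λ + Real.sinh δ * Real.exp (-δ) * gap J h Λ x ≤
      LR J (fun i => h i + if i = x then δ else 0) Λ := by
  have p1 := ZZ_one_pos J h Λ pl
  have p2 := ZZ_one_pos J h Λ mi
  have hs : 0 < Real.sinh δ := Real.sinh_pos_iff.2 hδ
  have g0 := gap_nonneg J h hJ Λ x
  unfold LR
  rw [ZZ_raise, ZZ_raise]
  unfold gap at *
  set mp := Ex J h Λ pl (fun σ => spin (σ x))
  set mm := Ex J h Λ mi (fun σ => spin (σ x))
  obtain ⟨a1, a2⟩ : -1 ≤ mp ∧ mp ≤ 1 := Ex_spin_bd J h Λ pl x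
  obtain ⟨b1, b2⟩ : -1 ≤ mm ∧ mm ≤ 1 := Ex_spin_bd J h Λ mi x
  have hcs : Real.cosh δ - Real.sinh δ = Real.exp (-δ) := Real.cosh_sub_sinh δ
  have hcs' : Real.cosh δ + Real.sinh δ = Real.exp δ := Real.cosh_add_sinh δ
  have e1 := Real.exp_pos (-δ)
  have q1 : 0 < Real.cosh δ + Real.sinh δ * mp := by nlinarith
  have q2 : 0 < Real.cosh δ + Real.sinh δ * mm := by nlinarith
  have q3 : Real.cosh δ + Real.sinh δ * mp ≤ Real.exp δ := by nlinarith
  rw [Real.log_mul p1.ne' q1.ne', Real.log_mul p2.ne' q2.ne']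
  have hl := Real.log_le_sub_one_of_pos (div_pos q2 q1)
  rw [Real.log_div q2.ne' q1.ne'] at hl
  have : (Real.cosh δ + Real.sinh δ * mm) / (Real.cosh δ + Real.sinh δ * mp) - 1
      ≤ - (Real.sinh δ * Real.exp (-δ) * (mp - mm)) := by
    rw [div_sub_one q1.ne', div_le_iff₀ q1]
    have : Real.exp (-δ) * (Real.cosh δ + Real.sinh δ * mp) ≤ 1 := by
      calc _ ≤ Real.exp (-δ) * Real.exp δ := by gcongr
        _ = 1 := by rw [← Real.exp_add]; simp
    have h3 : 0 ≤ Real.sinh δ * (mp - mm) := by positivity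
    nlinarith
  linarith

lemma LR_raise (J : V → V → ℝ) (hJ : ∀ i j, 0 ≤ J i j) (Λ : Finset V) (t δ : ℝ) (ht : 0 ≤ t)
    (hδ : 0 < δ) (A : Finset V) :
    LR J (fun _ => t) Λ + Real.sinh δ * Real.exp (-δ) * ∑ x ∈ A, gap J (fun _ => t + δ) Λ x ≤
      LR J (fun i => t + if i ∈ A then δ else 0) Λ := by
  induction A using Finset.induction_on with
  | empty => simp
  | insert a A ha ih =>
    have h1 := LR_step J (fun i => t + if i ∈ A then δ else 0) hJ Λ a δ hδ
    have e : (fun i => (t + if i ∈ A then δ else 0) + if i = a then δ else 0) =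
        fun i => t + if i ∈ insert a A then δ else 0 := by
      funext i
      by_cases hi : i = a
      · subst hi; simp [ha]
      · simp [hi]
    rw [e] at h1
    have h2 := gap_anti J (fun i => t + if i ∈ A then δ else 0) (fun _ => t + δ) hJ
      (fun i => by split_ifs <;> linarith) (fun i => by split_ifs <;> linarith) Λ a
    have hs : 0 < Real.sinh δ := Real.sinh_pos_iff.2 hδ
    have h3 : Real.sinh δ * Real.exp (-δ) * gap J (fun _ => t + δ) Λ a ≤
      Real.sinh δ * Real.exp (-δ) * gap J (fun i => t + if i ∈ A then δ else 0) Λ a := by gcongr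
    rw [Finset.sum_insert ha, mul_add]
    linarith

lemma ind_empty : ind (∅ : Finset V) = fun _ => 1 := by funext σ; simp [ind]

lemma ZZ_ind_pos (J : V → V → ℝ) (h : V → ℝ) (hJ : ∀ i j, 0 ≤ J i j) (hh : ∀ i, 0 ≤ h i) (b : ℝ)
    (hb : ∀ i, ∑ j, J i j ≤ b) (hb' : ∀ j, ∑ i, J i j ≤ b) (Λ : Finset V) (ω : V → Bool)
    (S : Finset V) (hS : S ⊆ Λ) : 0 < ZZ J h Λ ω (ind S) := by
  induction S using Finset.induction_on with
  | empty => rw [ind_empty]; exact ZZ_one_pos _ _ _ _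
  | insert a S ha ih =>
    have h1 := ZZ_ind_flip J h hJ hh b hb hb' Λ ω S a (hS (by simp)) ha
    have h2 := ih (fun i hi => hS (by simp [hi]))
    have h3 := Real.exp_pos (4 * b)
    by_contra hcon
    nlinarith

lemma LR_cond (J : V → V → ℝ) (h : V → ℝ) (hJ : ∀ i j, 0 ≤ J i j) (hh : ∀ i, 0 ≤ h i) (b : ℝ)
    (hb : ∀ i, ∑ j, J i j ≤ b) (hb' : ∀ j, ∑ i, J i j ≤ b) (Λ : Finset V)
    (S : Finset V) (hS : S ⊆ Λ) :
    Real.log (ZZ J h Λ pl (ind S)) - Real.log (ZZ J h Λ mi (ind S)) ≤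
      LR J h Λ + (1 + Real.exp (4 * b)) / 2 * ∑ y ∈ S, gap J h Λ y := by
  induction S using Finset.induction_on with
  | empty => rw [ind_empty]; simp [LR]
  | insert a S ha ih =>
    have hS' : S ⊆ Λ := fun i hi => hS (by simp [hi])
    have ih := ih hS'
    have haΛ : a ∈ Λ := hS (by simp)
    have f2 := ZZ_ind_flip J h hJ hh b hb hb' Λ mi S a haΛ ha
    have P1 := ZZ_ind_pos J h hJ hh b hb hb' Λ pl S hS'
    have P2 := ZZ_ind_pos J h hJ hh b hb hb' Λ mi S hS'
    have Q1 := ZZ_ind_pos J h hJ hh b hb hb' Λ pl _ hS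
    have Q2 := ZZ_ind_pos J h hJ hh b hb hb' Λ mi _ hS
    have L := lebowitz J h hJ hh Λ a (ind S) (dcone_ind S) P1 P2
    have e : ∀ ω, ZZ J h Λ ω (fun σ => spin (σ a) * ind S σ) =
        2 * ZZ J h Λ ω (ind (insert a S)) - ZZ J h Λ ω (ind S) := by
      intro ω
      unfold ZZ
      rw [Finset.mul_sum, ← Finset.sum_sub_distrib]
      refine Finset.sum_congr rfl fun σ _ => ?_
      have : spin (σ a) * ind S σ = 2 * ind (insert a S) σ - ind S σ := by
        rw [ind_eq_prod, ind_eq_prod, Finset.prod_insert ha]; ring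
      beta_reduce
      rw [this]; ring
    rw [e, e] at L
    have hg := gap_nonneg J h hJ Λ a
    rw [Finset.sum_insert ha]
    set X1 := ZZ J h Λ pl (ind S)
    set X2 := ZZ J h Λ mi (ind S)
    set Y1 := ZZ J h Λ pl (ind (insert a S))
    set Y2 := ZZ J h Λ mi (ind (insert a S))
    set E := Real.exp (4 * b)
    have hE : 0 < E := Real.exp_pos _
    have hl := Real.log_le_sub_one_of_pos (div_pos (div_pos Q1 P1) (div_pos Q2 P2))
    rw [Real.log_div (div_pos Q1 P1).ne' (div_pos Q2 P2).ne', Real.log_div Q1.ne' P1.ne',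
      Real.log_div Q2.ne' P2.ne'] at hl
    have L2 : 2 * (Y1 / X1 - Y2 / X2) ≤ gap J h Λ a := by
      rw [sub_div, sub_div, div_self P1.ne', div_self P2.ne', mul_div_assoc, mul_div_assoc] at L
      linarith
    have f3 : 1 ≤ (1 + E) * (Y2 / X2) := by
      rw [← mul_div_assoc, le_div_iff₀ P2, one_mul]; exact f2
    set p1 := Y1 / X1
    set p2 := Y2 / X2
    have hp2 : 0 < p2 := div_pos Q2 P2
    have : p1 / p2 - 1 ≤ (1 + E) / 2 * gap J h Λ a := by
      rw [div_sub_one hp2.ne', div_le_iff₀ hp2]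
      nlinarith
    linarith

/-- Key inequality. -/
lemma key_ineq (J : V → V → ℝ) (hJ : ∀ i j, 0 ≤ J i j) (b : ℝ)
    (hb : ∀ i, ∑ j, J i j ≤ b) (hb' : ∀ j, ∑ i, J i j ≤ b) (Λ A S : Finset V)
    (hA : A ⊆ Λ) (hS : S ⊆ Λ) (hAS : Disjoint A S)
    (hs : ∀ i ∈ A, ∀ j, j ∉ A → (J i j ≠ 0 ∨ J j i ≠ 0) → j ∈ S)
    (t δ : ℝ) (ht : 0 ≤ t) (hδ : 0 < δ) :
    Real.sinh δ * Real.exp (-δ) * ∑ x ∈ A, gap J (fun _ => t + δ) Λ x ≤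
      (1 + Real.exp (4 * b)) / 2 * ∑ y ∈ S, gap J (fun _ => t) Λ y := by
  have hh : ∀ _ : V, 0 ≤ t := fun _ => ht
  set k : V → ℝ := fun i => t + if i ∈ A then δ else 0 with hk
  have hk0 : ∀ i, 0 ≤ k i := fun i => by simp only [hk]; split_ifs <;> linarith
  have h1 := LR_raise J hJ Λ t δ ht hδ A
  have h2 := LR_cond J (fun _ => t) hJ hh b hb hb' Λ S hS
  have h3 := ZZ_ind_swap J (fun _ => t) k Λ A S hA hAS (fun i hi => by simp [hk, hi]) hs
  have P1 := ZZ_ind_pos J (fun _ => t) hJ hh b hb hb' Λ pl S hS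
  have P2 := ZZ_ind_pos J (fun _ => t) hJ hh b hb hb' Λ mi S hS
  have Q1 := ZZ_ind_pos J k hJ hk0 b hb hb' Λ pl S hS
  have Q2 := ZZ_ind_pos J k hJ hk0 b hb hb' Λ mi S hS
  have R1 := ZZ_one_pos J k Λ pl
  have R2 := ZZ_one_pos J k Λ mi
  have h4 := Ex_mono J k hJ Λ mi_le_pl (ind S) (ind_mono S)
  unfold Ex at h4
  have h5 := congrArg Real.log h3
  rw [Real.log_mul Q1.ne' P2.ne', Real.log_mul P1.ne' Q2.ne'] at h5
  have h6 := Real.log_le_log (div_pos Q2 R2) h4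
  rw [Real.log_div Q2.ne' R2.ne', Real.log_div Q1.ne' R1.ne'] at h6
  have h7 : LR J k Λ = Real.log (ZZ J k Λ pl (fun _ => 1)) - Real.log (ZZ J k Λ mi (fun _ => 1)) := rfl
  linarith

end KeyIneq


section Iteration
variable {V : Type*} [Fintype V] [DecidableEq V]

/-- Geometric assumptions. -/
structure Geo (J : V → V → ℝ) (ρ : V → V → ℕ) (b K : ℝ) (d : ℕ) : Prop where
  nn : ∀ i j, 0 ≤ J i j
  s1 : ∀ i, ∑ j, J i j ≤ b
  s2 : ∀ j, ∑ i, J i j ≤ b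
  self : ∀ i, ρ i i = 0
  symm : ∀ i j, ρ i j = ρ j i
  tri : ∀ i j k, ρ i k ≤ ρ i j + ρ j k
  rng : ∀ i j, J i j ≠ 0 → ρ i j ≤ 1
  vol : ∀ x k, ((univ.filter (fun y => ρ x y ≤ k)).card : ℝ) ≤ K * ((k : ℝ) + 1) ^ d

def bal (ρ : V → V → ℕ) (x : V) (k : ℕ) : Finset V := univ.filter (fun y => ρ x y ≤ k)

lemma mem_bal (ρ : V → V → ℕ) (x y : V) (k : ℕ) : y ∈ bal ρ x k ↔ ρ x y ≤ k := by simp [bal]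

lemma bal_mono (ρ : V → V → ℕ) (x : V) {k l : ℕ} (h : k ≤ l) : bal ρ x k ⊆ bal ρ x l := by
  intro y hy; rw [mem_bal] at *; omega

noncomputable def asum (J : V → V → ℝ) (ρ : V → V → ℕ) (x : V) (N k : ℕ) (t : ℝ) : ℝ :=
  ∑ y ∈ bal ρ x k, gap J (fun _ => t) (bal ρ x N) y

variable {J : V → V → ℝ} {ρ : V → V → ℕ} {b K : ℝ} {d : ℕ}

lemma Geo.nbr (G : Geo J ρ b K d) {i j : V} (h : J i j ≠ 0 ∨ J j i ≠ 0) : ρ i j ≤ 1 := by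
  rcases h with h | h
  · exact G.rng _ _ h
  · rw [G.symm]; exact G.rng _ _ h

lemma asum_mono (G : Geo J ρ b K d) (x : V) (N : ℕ) {k l : ℕ} (h : k ≤ l) (t : ℝ) :
    asum J ρ x N k t ≤ asum J ρ x N l t :=
  Finset.sum_le_sum_of_subset_of_nonneg (bal_mono ρ x h) fun i _ _ => gap_nonneg _ _ G.nn _ _

lemma asum_nonneg (G : Geo J ρ b K d) (x : V) (N k : ℕ) (t : ℝ) :
    0 ≤ asum J ρ x N k t := Finset.sum_nonneg fun i _ => gap_nonneg _ _ G.nn _ _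

lemma asum_step (G : Geo J ρ b K d) (x : V) (N k : ℕ) (hk : k + 1 ≤ N) (t δ : ℝ) (ht : 0 ≤ t)
    (hδ : 0 < δ) :
    Real.sinh δ * Real.exp (-δ) * asum J ρ x N k (t + δ) ≤
      (1 + Real.exp (4 * b)) / 2 * (asum J ρ x N (k + 1) t - asum J ρ x N k t) := by
  have e : asum J ρ x N (k + 1) t - asum J ρ x N k t =
      ∑ y ∈ bal ρ x (k + 1) \ bal ρ x k, gap J (fun _ => t) (bal ρ x N) y := by
    unfold asum
    rw [Finset.sum_sdiff_eq_sub (bal_mono ρ x (Nat.le_succ k))]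
  rw [e]
  refine key_ineq J G.nn b G.s1 G.s2 (bal ρ x N) (bal ρ x k) (bal ρ x (k + 1) \ bal ρ x k)
    (bal_mono ρ x (by omega)) (Finset.sdiff_subset.trans (bal_mono ρ x hk))
    Finset.disjoint_sdiff ?_ t δ ht hδ
  intro i hi j hj h
  rw [Finset.mem_sdiff]
  refine ⟨?_, hj⟩
  rw [mem_bal] at *
  have := G.tri x i j
  have := G.nbr h
  omega

lemma asum_sum (G : Geo J ρ b K d) (x : V) (N k L : ℕ) (hk : k + L ≤ N) (t δ : ℝ) (ht : 0 ≤ t)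
    (hδ : 0 < δ) :
    (Real.sinh δ * Real.exp (-δ) * L) * asum J ρ x N k (t + δ) ≤
      (1 + Real.exp (4 * b)) / 2 * asum J ρ x N (k + L) t := by
  have hC : 0 < (1 + Real.exp (4 * b)) / 2 := by positivity
  have hs : 0 < Real.sinh δ := Real.sinh_pos_iff.2 hδ
  have key : (Real.sinh δ * Real.exp (-δ) * L) * asum J ρ x N k (t + δ) ≤
      (1 + Real.exp (4 * b)) / 2 * (asum J ρ x N (k + L) t - asum J ρ x N k t) := by
    induction L with
    | zero => simp
    | succ L ih =>
      have ih := ih (by omega)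
      have h1 := asum_step G x N (k + L) (by omega) t δ ht hδ
      have h2 : Real.sinh δ * Real.exp (-δ) * asum J ρ x N k (t + δ) ≤
        Real.sinh δ * Real.exp (-δ) * asum J ρ x N (k + L) (t + δ) := by
        have := asum_mono G x N (Nat.le_add_right k L) (t + δ)
        gcongr
      rw [← add_assoc]
      push_cast
      linarith
  have := asum_nonneg G x N k t
  nlinarith

lemma asum_iter (G : Geo J ρ b K d) (x : V) (N L : ℕ) (δ : ℝ) (hδ : 0 < δ) (m : ℕ) (k : ℕ)
    (hk : k + m * L ≤ N) :
    (Real.sinh δ * Real.exp (-δ) * L) ^ m * asum J ρ x N k (m * δ) ≤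
      ((1 + Real.exp (4 * b)) / 2) ^ m * asum J ρ x N (k + m * L) 0 := by
  have hC : 0 < (1 + Real.exp (4 * b)) / 2 := by positivity
  have hs : 0 < Real.sinh δ := Real.sinh_pos_iff.2 hδ
  induction m generalizing k with
  | zero => simp
  | succ m ih =>
    have ih := ih (k + L) (by rw [add_mul] at hk; omega)
    have h1 := asum_sum G x N k L (by rw [add_mul] at hk; omega) (m * δ) δ (by positivity) hδ
    have e : ((m + 1 : ℕ) : ℝ) * δ = m * δ + δ := by push_cast; ring
    have e2 : k + (m + 1) * L = k + L + m * L := by ring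
    rw [e, e2]
    set q := Real.sinh δ * Real.exp (-δ) * L
    have hq : 0 ≤ q := by positivity
    set C := (1 + Real.exp (4 * b)) / 2
    calc q ^ (m + 1) * asum J ρ x N k (m * δ + δ) = q ^ m * (q * asum J ρ x N k (m * δ + δ)) := by ring
      _ ≤ q ^ m * (C * asum J ρ x N (k + L) (m * δ)) := by gcongr
      _ = C * (q ^ m * asum J ρ x N (k + L) (m * δ)) := by ring
      _ ≤ C * (C ^ m * asum J ρ x N (k + L + m * L) 0) := by gcongr
      _ = _ := by ring

lemma gap_poly (G : Geo J ρ b K d) (x : V) (L : ℕ) (δ : ℝ) (hδ : 0 < δ) (m : ℕ) :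
    (Real.sinh δ * Real.exp (-δ) * L) ^ m * gap J (fun _ => m * δ) (bal ρ x (m * L)) x ≤
      ((1 + Real.exp (4 * b)) / 2) ^ m * (2 * (K * ((m * L : ℝ) + 1) ^ d)) := by
  have h1 := asum_iter G x (m * L) L δ hδ m 0 (by omega)
  rw [zero_add] at h1
  have hs : 0 < Real.sinh δ := Real.sinh_pos_iff.2 hδ
  have h2 : gap J (fun _ => m * δ) (bal ρ x (m * L)) x ≤ asum J ρ x (m * L) 0 (m * δ) := by
    unfold asum
    refine Finset.single_le_sum (f := fun y => gap J (fun _ => m * δ) (bal ρ x (m * L)) y)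
      (fun i _ => gap_nonneg _ _ G.nn _ _) ?_
    rw [mem_bal, G.self]
  have h3 : asum J ρ x (m * L) (m * L) 0 ≤ 2 * (K * ((m * L : ℝ) + 1) ^ d) := by
    have := G.vol x (m * L)
    push_cast at this
    calc _ ≤ ∑ y ∈ bal ρ x (m * L), (2 : ℝ) := Finset.sum_le_sum fun y _ => gap_le_two _ _ _ _
      _ = 2 * ((bal ρ x (m * L)).card : ℝ) := by rw [Finset.sum_const, nsmul_eq_mul]; ring
      _ ≤ _ := by gcongr; exact this
  calc _ ≤ (Real.sinh δ * Real.exp (-δ) * L) ^ m * asum J ρ x (m * L) 0 (m * δ) := by gcongr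
    _ ≤ _ := h1
    _ ≤ _ := by gcongr

/-- There is a scale with very small gap. -/
lemma exists_scale (b K h : ℝ) (hh : 0 < h) (hK : 0 ≤ K) (d : ℕ) :
    ∃ M : ℕ, ∀ {V : Type} [Fintype V] [DecidableEq V] (J : V → V → ℝ) (ρ : V → V → ℕ)
      (_ : Geo J ρ b K d) (x : V),
      gap J (fun _ => h) (bal ρ x M) x * (K * ((M : ℝ) + 2) ^ d) ≤ 1 := by
  set m : ℕ := 2 * d + 1 with hm
  have hm0 : (0 : ℝ) < m := by positivity
  set δ : ℝ := h / m with hδd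
  have hδ : 0 < δ := by positivity
  have hmδ : (m : ℝ) * δ = h := by rw [hδd]; field_simp
  have hs : 0 < Real.sinh δ := Real.sinh_pos_iff.2 hδ
  set κ := Real.sinh δ * Real.exp (-δ) with hκ
  have hκ0 : 0 < κ := by positivity
  set C := (1 + Real.exp (4 * b)) / 2 with hC
  have hC0 : 0 < C := by positivity
  obtain ⟨L, hL⟩ := exists_nat_gt (C ^ m * (2 * K) * K * (3 * m) ^ (2 * d) / κ ^ m)
  have hL0 : (0 : ℝ) < L := lt_of_le_of_lt (by positivity) hL
  have hL1 : (1 : ℝ) ≤ L := by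
    have : 0 < L := by exact_mod_cast hL0
    exact_mod_cast this
  have hm1 : (1 : ℝ) ≤ m := by
    have : 1 ≤ m := by omega
    exact_mod_cast this
  refine ⟨m * L, fun {V} _ _ J ρ G x => ?_⟩
  have h1 := gap_poly G x L δ hδ m
  rw [hmδ] at h1
  rw [div_lt_iff₀ (by positivity)] at hL
  have g0 := gap_nonneg J (fun _ => h) G.nn (bal ρ x (m * L)) x
  set g := gap J (fun _ => h) (bal ρ x (m * L)) x
  have hmL : (1 : ℝ) ≤ m * L := one_le_mul_of_one_le_of_one_le hm1 hL1
  have b1 : ((m * L : ℝ) + 1) ^ d ≤ (3 * (m * L)) ^ d := by gcongr; linarith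
  have b2 : ((m * L : ℝ) + 2) ^ d ≤ (3 * (m * L)) ^ d := by gcongr; linarith
  have hq : 0 < (κ * L) ^ m := by positivity
  push_cast
  have main : (κ * L) ^ m * (g * (K * ((m * L : ℝ) + 2) ^ d)) ≤ (κ * L) ^ m * 1 := by
    calc (κ * L) ^ m * (g * (K * ((m * L : ℝ) + 2) ^ d))
        = ((κ * L) ^ m * g) * (K * ((m * L : ℝ) + 2) ^ d) := by ring
      _ ≤ (C ^ m * (2 * (K * ((m * L : ℝ) + 1) ^ d))) * (K * ((m * L : ℝ) + 2) ^ d) := by gcongr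
      _ ≤ (C ^ m * (2 * (K * (3 * (m * L)) ^ d))) * (K * (3 * (m * L)) ^ d) := by gcongr
      _ = (C ^ m * (2 * K) * K * (3 * m) ^ (2 * d)) * (L : ℝ) ^ (2 * d) := by
          rw [show (3 * ((m : ℝ) * L)) = (3 * m) * L by ring, mul_pow, two_mul d, pow_add, pow_add]; ring
      _ ≤ (L * κ ^ m) * (L : ℝ) ^ (2 * d) := by gcongr
      _ = (κ * L) ^ m * 1 := by rw [hm, mul_pow κ (L : ℝ)]; ring
  exact le_of_mul_le_mul_left main hq

end Iteration


section Decay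
variable {V : Type*} [Fintype V] [DecidableEq V]

lemma wt_reverse (J : V → V → ℝ) (h : V → ℝ) (Λ Λ' : Finset V) (hΛ : Λ' ⊆ Λ) (ω σ τ : V → Bool) :
    wt J h Λ ω σ * (wt J h Λ' σ τ / ZZ J h Λ' σ (fun _ => 1)) =
      wt J h Λ ω τ * (wt J h Λ' τ σ / ZZ J h Λ' τ (fun _ => 1)) := by
  by_cases H : ∀ i, i ∉ Λ' → τ i = σ i
  · have H' : ∀ i, i ∉ Λ' → σ i = τ i := fun i hi => (H i hi).symm
    have hZ : ZZ J h Λ' σ (fun _ => 1) = ZZ J h Λ' τ (fun _ => 1) := by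
      unfold ZZ
      refine Finset.sum_congr rfl fun η _ => ?_
      congr 1
      unfold wt
      refine if_congr (forall₂_congr fun i hi => ?_) rfl rfl
      rw [H i hi]
    have hω : (∀ i, i ∉ Λ → σ i = ω i) ↔ (∀ i, i ∉ Λ → τ i = ω i) := by
      refine forall₂_congr fun i hi => ?_
      rw [H i (fun h => hi (hΛ h))]
    rw [hZ]
    unfold wt
    rw [if_pos H, if_pos H']
    simp only [hω]
    split_ifs
    · ring
    · ring
  · have H' : ¬ ∀ i, i ∉ Λ' → σ i = τ i := fun h => H fun i hi => (h i hi).symm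
    have e1 : wt J h Λ' σ τ = 0 := if_neg H
    have e2 : wt J h Λ' τ σ = 0 := if_neg H'
    rw [e1, e2]; simp

lemma Ex_consistent (J : V → V → ℝ) (h : V → ℝ) (Λ Λ' : Finset V) (hΛ : Λ' ⊆ Λ) (ω : V → Bool)
    (f : (V → Bool) → ℝ) :
    Ex J h Λ ω (fun σ => Ex J h Λ' σ f) = Ex J h Λ ω f := by
  unfold Ex
  congr 1
  have e : ∀ σ, ZZ J h Λ' σ f / ZZ J h Λ' σ (fun _ => 1) * wt J h Λ ω σ =
      ∑ τ, f τ * (wt J h Λ ω τ * (wt J h Λ' τ σ / ZZ J h Λ' τ (fun _ => 1))) := by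
    intro σ
    have : ZZ J h Λ' σ f = ∑ τ, f τ * wt J h Λ' σ τ := rfl
    rw [this, Finset.sum_div, Finset.sum_mul]
    refine Finset.sum_congr rfl fun τ _ => ?_
    rw [← wt_reverse J h Λ Λ' hΛ ω σ τ]; ring
  have e0 : ZZ J h Λ ω (fun σ => ZZ J h Λ' σ f / ZZ J h Λ' σ (fun _ => 1)) =
      ∑ σ, ZZ J h Λ' σ f / ZZ J h Λ' σ (fun _ => 1) * wt J h Λ ω σ := rfl
  rw [e0]
  simp only [e]
  rw [Finset.sum_comm]
  have e2 : ZZ J h Λ ω f = ∑ σ, f σ * wt J h Λ ω σ := rfl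
  rw [e2]
  refine Finset.sum_congr rfl fun τ _ => ?_
  rw [← Finset.mul_sum, ← Finset.mul_sum, ← Finset.sum_div, ← ZZ_one,
    div_self (ZZ_one_pos J h Λ' τ).ne', mul_one]

lemma gap_domain (J : V → V → ℝ) (h : V → ℝ) (hJ : ∀ i j, 0 ≤ J i j) (Λ Λ' : Finset V)
    (hΛ : Λ' ⊆ Λ) (x : V) : gap J h Λ x ≤ gap J h Λ' x := by
  unfold gap
  rw [← Ex_consistent J h Λ Λ' hΛ pl, ← Ex_consistent J h Λ Λ' hΛ mi]
  have h1 := Ex_le_of_le J h Λ pl (fun σ => Ex J h Λ' σ fun σ => spin (σ x))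
    (fun _ => Ex J h Λ' pl fun σ => spin (σ x))
    (fun σ => Ex_mono J h hJ Λ' (fun i => by simp) _ (mono_spin x))
  have h2 := Ex_le_of_le J h Λ mi (fun _ => Ex J h Λ' mi fun σ => spin (σ x))
    (fun σ => Ex J h Λ' σ fun σ => spin (σ x))
    (fun σ => Ex_mono J h hJ Λ' (fun i => by simp) _ (mono_spin x))
  rw [Ex_const] at h1 h2
  linarith

/-- Comparison of a local observable with the magnetisation on its support. -/
lemma mono_aux (S : Finset V) (φ : (V → Bool) → ℝ) (γ : ℝ)
    (h1 : ∀ a b, (∀ i ∈ S, a i = b i) → φ a = φ b)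
    (h2 : ∀ a b, a ≤ b → φ b - φ a ≤ γ) (hγ : 0 ≤ γ) :
    Monotone (fun σ => γ / 2 * ∑ y ∈ S, spin (σ y) + (-1) * φ σ) := by
  intro a b hab
  beta_reduce
  by_cases H : ∀ i ∈ S, a i = b i
  · rw [h1 a b H, Finset.sum_congr rfl fun i hi => by rw [H i hi]]
  · push Not at H
    obtain ⟨y, hy, hne⟩ := H
    have h3 : spin (b y) - spin (a y) ≤ ∑ i ∈ S, (spin (b i) - spin (a i)) :=
      Finset.single_le_sum (f := fun i => spin (b i) - spin (a i))
        (fun i _ => sub_nonneg.2 (spin_mono (hab i))) hy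
    have h4 : spin (b y) - spin (a y) = 2 := by
      have := hab y
      revert this hne
      cases a y <;> cases b y <;> simp [spin]
      norm_num
    rw [Finset.sum_sub_distrib, h4] at h3
    have := h2 a b hab
    nlinarith

lemma Ex_diff_le (J : V → V → ℝ) (h : V → ℝ) (hJ : ∀ i j, 0 ≤ J i j) (Λ S : Finset V)
    (φ : (V → Bool) → ℝ) (γ : ℝ)
    (h1 : ∀ a b, (∀ i ∈ S, a i = b i) → φ a = φ b)
    (h2 : ∀ a b, a ≤ b → φ b - φ a ≤ γ) (hγ : 0 ≤ γ) {ω ω' : V → Bool} (hω : ω ≤ ω') :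
    Ex J h Λ ω' φ - Ex J h Λ ω φ ≤ γ / 2 * ∑ y ∈ S, (Ex J h Λ ω' (fun σ => spin (σ y)) -
      Ex J h Λ ω (fun σ => spin (σ y))) := by
  have H := Ex_mono J h hJ Λ hω _ (mono_aux S φ γ h1 h2 hγ)
  rw [Ex_add J h Λ ω (fun σ => γ / 2 * ∑ y ∈ S, spin (σ y)),
    Ex_add J h Λ ω' (fun σ => γ / 2 * ∑ y ∈ S, spin (σ y)), Ex_smul, Ex_smul, Ex_smul, Ex_smul,
    Ex_sum, Ex_sum] at H
  rw [Finset.sum_sub_distrib]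
  linarith

variable {J : V → V → ℝ} {ρ : V → V → ℕ} {b K : ℝ} {d : ℕ}

lemma gap_fs (G : Geo J ρ b K d) (h : V → ℝ) (x : V) (M N : ℕ) (Λ : Finset V)
    (hΛ : bal ρ x (N + M + 1) ⊆ Λ) :
    gap J h Λ x ≤ gap J h (bal ρ x M) x / 2 * ∑ y ∈ bal ρ x (M + 1), gap J h Λ y := by
  have hsub : bal ρ x M ⊆ Λ := (bal_mono ρ x (by omega)).trans hΛ
  have hx : x ∈ bal ρ x M := by rw [mem_bal, G.self]; omega
  have H := Ex_diff_le J h G.nn Λ (bal ρ x (M + 1) \ bal ρ x M)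
    (fun σ => Ex J h (bal ρ x M) σ (fun σ => spin (σ x))) (gap J h (bal ρ x M) x)
    (fun a b hab => Ex_local J h _ a b (fun i hi j hj hJ => hab j (by
      rw [Finset.mem_sdiff]
      refine ⟨?_, hj⟩
      rw [mem_bal] at *
      have := G.tri x i j
      have := G.nbr hJ
      omega)) x hx)
    (fun a b hab => by
      have h1 := Ex_mono J h G.nn (bal ρ x M) (ω := b) (ω' := pl) (fun i => by simp) _ (mono_spin x)
      have h2 := Ex_mono J h G.nn (bal ρ x M) (ω := mi) (ω' := a) (fun i => by simp) _ (mono_spin x)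
      unfold gap; linarith)
    (gap_nonneg _ _ G.nn _ _) mi_le_pl
  rw [Ex_consistent J h Λ _ hsub, Ex_consistent J h Λ _ hsub] at H
  have g0 := gap_nonneg J h G.nn (bal ρ x M) x
  refine H.trans ?_
  refine mul_le_mul_of_nonneg_left ?_ (by positivity)
  exact Finset.sum_le_sum_of_subset_of_nonneg Finset.sdiff_subset
    fun i _ _ => gap_nonneg _ _ G.nn _ _

lemma gap_geom (G : Geo J ρ b K d) (h : V → ℝ) (M : ℕ) 
    (hM : ∀ x, gap J h (bal ρ x M) x * (K * ((M : ℝ) + 2) ^ d) ≤ 1) (q : ℕ) (x : V) (Λ : Finset V)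
    (hΛ : bal ρ x (q * (M + 1)) ⊆ Λ) : gap J h Λ x ≤ 2 * (1 / 2) ^ q := by
  induction q generalizing x Λ with
  | zero => simpa using gap_le_two J h Λ x
  | succ q ih =>
    have hΛ' : bal ρ x (q * (M + 1) + M + 1) ⊆ Λ := by
      rw [show q * (M + 1) + M + 1 = (q + 1) * (M + 1) by ring]; exact hΛ
    have h1 := gap_fs G h x M (q * (M + 1)) Λ hΛ'
    have g0 := gap_nonneg J h G.nn (bal ρ x M) x
    have hv := G.vol x (M + 1)
    push_cast at hv
    rw [add_assoc, show (1 : ℝ) + 1 = 2 by norm_num] at hv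
    have h2 : ∑ y ∈ bal ρ x (M + 1), gap J h Λ y ≤ (K * ((M : ℝ) + 2) ^ d) * (2 * (1 / 2) ^ q) := by
      calc _ ≤ ∑ y ∈ bal ρ x (M + 1), 2 * (1 / 2 : ℝ) ^ q := by
            refine Finset.sum_le_sum fun y hy => ih y Λ ?_
            intro z hz
            refine hΛ' ?_
            rw [mem_bal] at *
            have := G.tri x y z
            omega
        _ = ((bal ρ x (M + 1)).card : ℝ) * (2 * (1 / 2) ^ q) := by rw [Finset.sum_const, nsmul_eq_mul]
        _ ≤ _ := by gcongr; exact hv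
    have h3 := hM x
    have hp : (0 : ℝ) ≤ (1 / 2) ^ q := by positivity
    calc _ ≤ _ := h1
      _ ≤ gap J h (bal ρ x M) x / 2 * ((K * ((M : ℝ) + 2) ^ d) * (2 * (1 / 2) ^ q)) := by gcongr
      _ = (gap J h (bal ρ x M) x * (K * ((M : ℝ) + 2) ^ d)) * (1 / 2) ^ q := by ring
      _ ≤ 1 * (1 / 2) ^ q := by gcongr
      _ = 2 * (1 / 2) ^ (q + 1) := by ring

/-- Uniform exponential decay of the gap. -/
theorem gap_decay (b K h : ℝ) (hh : 0 < h) (hK : 0 ≤ K) (d : ℕ) :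
    ∃ c : ℝ, 0 < c ∧ ∀ {V : Type} [Fintype V] [DecidableEq V] (J : V → V → ℝ) (ρ : V → V → ℕ)
      (_ : Geo J ρ b K d) (x : V) (n : ℕ) (Λ : Finset V), bal ρ x n ⊆ Λ →
      gap J (fun _ => h) Λ x ≤ 4 * Real.exp (-c * n) := by
  obtain ⟨M, hM⟩ := exists_scale b K h hh hK d
  have hl : 0 < Real.log 2 := Real.log_pos (by norm_num)
  refine ⟨Real.log 2 / (M + 1), by positivity, fun {V} _ _ J ρ G x n Λ hΛ => ?_⟩
  have h1 := gap_geom G (fun _ => h) M (hM J ρ G) (n / (M + 1)) x Λ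
    ((bal_mono ρ x (Nat.div_mul_le_self n (M + 1))).trans hΛ)
  refine h1.trans ?_
  have h2 : (1 / 2 : ℝ) ^ (n / (M + 1)) = Real.exp (-(Real.log 2 * (n / (M + 1) : ℕ))) := by
    rw [mul_comm, ← mul_neg, Real.exp_nat_mul, Real.exp_neg, Real.exp_log (by norm_num), one_div]
  have h3 : (n : ℝ) ≤ ((n / (M + 1) : ℕ) + 1 : ℝ) * (M + 1) := by
    have := (Nat.lt_div_mul_add (a := n) (Nat.succ_pos M)).le
    have h4 : n ≤ (n / (M + 1) + 1) * (M + 1) := by rw [add_mul, one_mul]; exact this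
    exact_mod_cast h4
  have h5 : (n : ℝ) / (M + 1) ≤ ((n / (M + 1) : ℕ) + 1 : ℝ) := by
    rw [div_le_iff₀ (by positivity)]; exact h3
  rw [h2]
  have h6 : Real.exp (-(Real.log 2 * (n / (M + 1) : ℕ))) ≤ 2 * Real.exp (-(Real.log 2 / (M + 1)) * n) := by
    nth_rewrite 2 [← Real.exp_log (show (0:ℝ) < 2 by norm_num)]
    rw [← Real.exp_add]
    refine Real.exp_le_exp.2 ?_
    have : -(Real.log 2 / (M + 1)) * n = - (Real.log 2 * (n / (M + 1))) := by ring
    rw [this]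
    nlinarith
  linarith

end Decay


section Transfer
variable {d : ℕ}

def nd (i j : Site d) : ℕ := ∑ k, (i k - j k).natAbs

lemma dist1_eq (i j : Site d) : dist1 i j = nd i j := by
  unfold dist1 nd
  push_cast
  simp

lemma nd_self (i : Site d) : nd i i = 0 := by simp [nd]

lemma nd_symm (i j : Site d) : nd i j = nd j i := by
  unfold nd
  exact Finset.sum_congr rfl fun k _ => by omega

lemma nd_tri (i j k : Site d) : nd i k ≤ nd i j + nd j k := by
  unfold nd
  rw [← Finset.sum_add_distrib]
  exact Finset.sum_le_sum fun l _ => by omega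

lemma nd_eq_zero {i j : Site d} (h : nd i j = 0) : i = j := by
  unfold nd at h
  rw [Finset.sum_eq_zero_iff] at h
  funext k
  have := h k (mem_univ k)
  omega

lemma nbrs_symm {i j : Site d} (h : j ∈ nbrs i) : i ∈ nbrs j := by
  unfold nbrs at *
  simp only [Finset.mem_image, Finset.mem_univ, true_and] at *
  obtain ⟨⟨a, s⟩, rfl⟩ := h
  refine ⟨(a, !s), ?_⟩
  funext k
  by_cases hk : k = a
  · cases s <;> simp [hk]
  · simp [hk]

lemma nbrs_nd {i j : Site d} (h : j ∈ nbrs i) : nd i j ≤ 1 := by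
  unfold nbrs at h
  simp only [Finset.mem_image, Finset.mem_univ, true_and] at h
  obtain ⟨⟨a, s⟩, rfl⟩ := h
  unfold nd
  rw [Finset.sum_eq_single a]
  · cases s <;> simp
  · intro k _ hk; simp [hk]
  · simp

lemma nbrs_card (i : Site d) : (nbrs i).card ≤ 2 * d := by
  unfold nbrs
  refine Finset.card_image_le.trans ?_
  simp [mul_comm]

noncomputable def zbal (x : Site d) (k : ℕ) : Finset (Site d) :=
  (Fintype.piFinset fun c => Finset.Icc (x c - k) (x c + k)).filter (fun y => nd x y ≤ k)

lemma mem_zbal (x y : Site d) (k : ℕ) : y ∈ zbal x k ↔ nd x y ≤ k := by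
  unfold zbal
  rw [Finset.mem_filter]
  refine ⟨fun h => h.2, fun h => ⟨?_, h⟩⟩
  rw [Fintype.mem_piFinset]
  intro c
  have : (x c - y c).natAbs ≤ nd x y :=
    Finset.single_le_sum (f := fun c => (x c - y c).natAbs) (fun _ _ => Nat.zero_le _) (mem_univ c)
  rw [Finset.mem_Icc]
  omega

lemma zbal_card (x : Site d) (k : ℕ) : (zbal x k).card ≤ (2 * k + 1) ^ d := by
  unfold zbal
  refine (Finset.card_filter_le _ _).trans ?_
  rw [Fintype.card_piFinset]
  have : ∀ c, (Finset.Icc (x c - (k : ℤ)) (x c + k)).card = 2 * k + 1 := by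
    intro c; rw [Int.card_Icc]; omega
  simp [this]

noncomputable def JW (β : ℝ) (W : Finset (Site d)) (i j : {x // x ∈ W}) : ℝ :=
  if j.1 ∈ nbrs i.1 then β / 2 else 0

lemma JW_symm (β : ℝ) (W : Finset (Site d)) (i j : {x // x ∈ W}) : JW β W i j = JW β W j i := by
  unfold JW
  exact if_congr ⟨nbrs_symm, nbrs_symm⟩ rfl rfl

lemma JW_sum (β : ℝ) (hβ : 0 ≤ β) (W : Finset (Site d)) (i : {x // x ∈ W}) :
    ∑ j, JW β W i j ≤ d * β := by
  have e : ∑ j, JW β W i j = ∑ j ∈ W, if j ∈ nbrs i.1 then β / 2 else 0 :=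
    Finset.sum_coe_sort W (fun j => if j ∈ nbrs i.1 then β / 2 else 0)
  rw [e, ← Finset.sum_filter, Finset.sum_const, nsmul_eq_mul]
  have h1 : (W.filter (fun j => j ∈ nbrs i.1)).card ≤ 2 * d := by
    refine le_trans (Finset.card_le_card ?_) (nbrs_card i.1)
    intro j hj; exact (Finset.mem_filter.1 hj).2
  have h2 : ((W.filter (fun j => j ∈ nbrs i.1)).card : ℝ) ≤ 2 * d := by exact_mod_cast h1
  nlinarith

lemma geoW (β : ℝ) (hβ : 0 ≤ β) (W : Finset (Site d)) :
    Geo (JW β W) (fun i j => nd i.1 j.1) (d * β) (2 ^ d) d where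
  nn i j := by unfold JW; split_ifs <;> positivity
  s1 := JW_sum β hβ W
  s2 j := by
    simp only [fun i => JW_symm β W i j]
    exact JW_sum β hβ W j
  self i := nd_self _
  symm i j := nd_symm _ _
  tri i j k := nd_tri _ _ _
  rng i j h := by
    unfold JW at h
    by_cases H : j.1 ∈ nbrs i.1
    · exact nbrs_nd H
    · simp [H] at h
  vol x k := by
    have h1 : (univ.filter (fun y : {x // x ∈ W} => nd x.1 y.1 ≤ k)).card ≤ (zbal x.1 k).card := by
      refine Finset.card_le_card_of_injOn (fun y => y.1) ?_ (fun a _ b _ h => Subtype.ext h)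
      intro y hy
      rw [Finset.mem_coe, mem_zbal]
      simpa using hy
    have h2 := h1.trans (zbal_card x.1 k)
    have h3 : ((univ.filter (fun y : {x // x ∈ W} => nd x.1 y.1 ≤ k)).card : ℝ) ≤ (2 * k + 1) ^ d := by
      exact_mod_cast h2
    refine h3.trans ?_
    rw [← mul_pow]
    gcongr
    linarith

noncomputable def ext (W : Finset (Site d)) (σ : {x // x ∈ W} → Bool) (ω : Config d) : Config d :=
  fun i => if hi : i ∈ W then σ ⟨i, hi⟩ else ω i

lemma en_patch (β h : ℝ) (Λ W : Finset (Site d)) (hΛ : Λ ⊆ W) (hn : ∀ i ∈ Λ, nbrs i ⊆ W)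
    (ω : Config d) : ∃ c : ℝ, ∀ η : {x // x ∈ Λ} → Bool,
      en (JW β W) (fun _ => h) (fun v => patch Λ η ω v.1) = hamElem β h Λ (patch Λ η ω) ω + c := by
  refine ⟨(∑ i ∈ W \ Λ, ∑ j ∈ W \ Λ, if j ∈ nbrs i then β / 2 * (spin (ω i) * spin (ω j)) else 0)
    + ∑ i ∈ W \ Λ, h * spin (ω i), fun η => ?_⟩
  set s := patch Λ η ω with hs
  have hso : ∀ i ∈ W \ Λ, s i = ω i := by
    intro i hi
    rw [Finset.mem_sdiff] at hi
    simp [hs, patch, hi.2]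
  set a : Site d → Site d → ℝ := fun i j =>
    if j ∈ nbrs i then β / 2 * (spin (s i) * spin (s j)) else 0 with ha
  have asym : ∀ i j, a i j = a j i := by
    intro i j
    simp only [ha]
    refine if_congr ⟨nbrs_symm, nbrs_symm⟩ (by ring) rfl
  unfold en
  have e1 : ∑ i : {x // x ∈ W}, ∑ j : {x // x ∈ W}, JW β W i j * (spin (s i.1) * spin (s j.1)) =
      ∑ i ∈ W, ∑ j ∈ W, a i j := by
    rw [← Finset.sum_coe_sort W]
    refine Finset.sum_congr rfl fun i _ => ?_
    rw [← Finset.sum_coe_sort W]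
    refine Finset.sum_congr rfl fun j _ => ?_
    simp only [ha, JW]
    split_ifs <;> simp
  have e2 : ∑ i : {x // x ∈ W}, h * spin (s i.1) = ∑ i ∈ W, h * spin (s i) :=
    Finset.sum_coe_sort W (fun i => h * spin (s i))
  have e3 : ∑ i ∈ W, h * spin (s i) = h * ∑ i ∈ Λ, spin (s i) + ∑ i ∈ W \ Λ, h * spin (ω i) := by
    rw [← Finset.sum_sdiff hΛ, add_comm, Finset.mul_sum]
    congr 1
    exact Finset.sum_congr rfl fun i hi => by rw [hso i hi]
  have e4 : ∑ i ∈ W, ∑ j ∈ W, a i j = ∑ i ∈ Λ, ∑ j ∈ Λ, a i j + 2 * ∑ i ∈ Λ, ∑ j ∈ W \ Λ, a i j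
      + ∑ i ∈ W \ Λ, ∑ j ∈ W \ Λ, a i j := by
    have hsplit : ∀ f : Site d → ℝ, ∑ i ∈ W, f i = ∑ i ∈ W \ Λ, f i + ∑ i ∈ Λ, f i :=
      fun f => (Finset.sum_sdiff hΛ).symm
    rw [hsplit]
    simp only [hsplit, Finset.sum_add_distrib]
    have : ∑ i ∈ W \ Λ, ∑ j ∈ Λ, a i j = ∑ i ∈ Λ, ∑ j ∈ W \ Λ, a i j := by
      rw [Finset.sum_comm]
      exact Finset.sum_congr rfl fun i _ => Finset.sum_congr rfl fun j _ => asym _ _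
    rw [this]; ring
  have e5 : ∑ i ∈ Λ, ∑ j ∈ Λ, a i j =
      β * (2⁻¹ * ∑ i ∈ Λ, ∑ j ∈ nbrs i ∩ Λ, spin (s i) * spin (s j)) := by
    rw [← mul_assoc, Finset.mul_sum]
    refine Finset.sum_congr rfl fun i _ => ?_
    simp only [ha]
    rw [← Finset.sum_filter, Finset.filter_mem_eq_inter, Finset.inter_comm, Finset.mul_sum]
    exact Finset.sum_congr rfl fun j _ => by ring
  have e6 : 2 * ∑ i ∈ Λ, ∑ j ∈ W \ Λ, a i j =
      β * ∑ i ∈ Λ, ∑ j ∈ nbrs i \ Λ, spin (s i) * spin (ω j) := by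
    rw [Finset.mul_sum, Finset.mul_sum]
    refine Finset.sum_congr rfl fun i hi => ?_
    simp only [ha]
    rw [← Finset.sum_filter, Finset.mul_sum, Finset.mul_sum]
    have : (W \ Λ).filter (fun j => j ∈ nbrs i) = nbrs i \ Λ := by
      ext j
      simp only [Finset.mem_filter, Finset.mem_sdiff]
      have := @hn i hi j
      tauto
    rw [this]
    refine Finset.sum_congr rfl fun j hj => ?_
    have hj' : j ∈ W \ Λ := by
      rw [Finset.mem_sdiff] at *
      exact ⟨hn i hi hj.1, hj.2⟩
    rw [hso j hj']; ring
  have e7 : ∑ i ∈ W \ Λ, ∑ j ∈ W \ Λ, a i j =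
      ∑ i ∈ W \ Λ, ∑ j ∈ W \ Λ, if j ∈ nbrs i then β / 2 * (spin (ω i) * spin (ω j)) else 0 := by
    refine Finset.sum_congr rfl fun i hi => Finset.sum_congr rfl fun j hj => ?_
    simp only [ha]
    rw [hso i hi, hso j hj]
  rw [e1, e2, e3, e4, e5, e6, e7]
  unfold hamElem
  ring

lemma localDensity_eq (β h : ℝ) (Λ W : Finset (Site d)) (hΛ : Λ ⊆ W) (hn : ∀ i ∈ Λ, nbrs i ⊆ W)
    (f : Config d → ℝ) (ω : Config d) :
    localDensity β h Λ f ω = Ex (JW β W) (fun _ => h) (univ.filter (fun v => v.1 ∈ Λ))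
      (fun v => ω v.1) (fun σ => f (ext W σ ω)) := by
  obtain ⟨c, hc⟩ := en_patch β h Λ W hΛ hn ω
  have key : ∀ g : Config d → ℝ, ZZ (JW β W) (fun _ => h) (univ.filter (fun v => v.1 ∈ Λ))
      (fun v => ω v.1) (fun σ => g (ext W σ ω)) =
      Real.exp c * ∑ η : {x // x ∈ Λ} → Bool, g (patch Λ η ω) *
        Real.exp (hamElem β h Λ (patch Λ η ω) ω) := by
    intro g
    unfold ZZ wt
    simp only [mul_ite, mul_zero]
    rw [← Finset.sum_filter, Finset.mul_sum]
    symm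
    refine Finset.sum_bij' (fun η _ => fun v : {x // x ∈ W} => patch Λ η ω v.1)
      (fun σ _ => fun x : {x // x ∈ Λ} => σ ⟨x.1, hΛ x.2⟩) ?_ ?_ ?_ ?_ ?_
    · intro η _
      simp only [Finset.mem_filter, Finset.mem_univ, true_and]
      intro i hi
      simp [patch, hi]
    · intro σ _; exact mem_univ _
    · intro η _
      funext x
      simp [patch]
    · intro σ hσ
      simp only [Finset.mem_filter, Finset.mem_univ, true_and] at hσ
      funext v
      by_cases hv : v.1 ∈ Λ
      · simp [patch, hv]
      · simp [patch, hv, hσ v hv]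
    · intro η _
      have : ext W (fun v => patch Λ η ω v.1) ω = patch Λ η ω := by
        funext i
        by_cases hi : i ∈ W
        · simp [ext, hi]
        · have : i ∉ Λ := fun h => hi (hΛ h)
          simp [ext, hi, patch, this]
      beta_reduce
      rw [this, hc, Real.exp_add]; ring
  unfold Ex
  rw [key f]
  have := key (fun _ => 1)
  rw [this]
  unfold localDensity
  simp only [one_mul]
  rw [mul_div_mul_left _ _ (Real.exp_pos c).ne']

/-- Uniform closeness of finite volume expectations of a local observable. -/
theorem localDensity_close (d : ℕ) (β h : ℝ) (hβ : 0 ≤ β) (hh : 0 < h) :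
    ∃ c : ℝ, 0 < c ∧ ∀ (Δ : Finset (Site d)) (r : Site d → ℕ) (f : Config d → ℝ),
      (∀ a b : Config d, (∀ i ∈ Δ, a i = b i) → f a = f b) → (∀ a, 0 ≤ f a ∧ f a ≤ 1) →
      ∀ ω ω' : Config d,
        localDensity β h (Δ.biUnion fun i => zbal i (r i)) f ω -
          localDensity β h (Δ.biUnion fun i => zbal i (r i)) f ω' ≤
          ∑ i ∈ Δ, 4 * Real.exp (-c * r i) := by
  obtain ⟨c, hc, H⟩ := gap_decay (d * β) (2 ^ d) h hh (by positivity) d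
  refine ⟨c, hc, fun Δ r f hf1 hf2 ω ω' => ?_⟩
  set Λ := Δ.biUnion fun i => zbal i (r i) with hΛ
  set W : Finset (Site d) := Λ ∪ Λ.biUnion nbrs with hW
  have hΛW : Λ ⊆ W := Finset.subset_union_left
  have hn : ∀ i ∈ Λ, nbrs i ⊆ W := fun i hi =>
    (Finset.subset_biUnion_of_mem nbrs hi).trans Finset.subset_union_right
  have hΔΛ : Δ ⊆ Λ := fun i hi => by
    rw [hΛ, Finset.mem_biUnion]
    exact ⟨i, hi, by rw [mem_zbal, nd_self]; omega⟩
  have hΔW := hΔΛ.trans hΛW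
  have G := geoW β hβ W
  rw [localDensity_eq β h Λ W hΛW hn, localDensity_eq β h Λ W hΛW hn]
  set ΛV : Finset {x // x ∈ W} := univ.filter (fun v => v.1 ∈ Λ) with hΛV
  set S : Finset {x // x ∈ W} := univ.filter (fun v => v.1 ∈ Δ) with hS
  set φ : ({x // x ∈ W} → Bool) → ℝ := fun σ => f (ext W σ ω) with hφ
  have hφ' : (fun σ => f (ext W σ ω')) = φ := by
    funext σ
    refine hf1 _ _ fun i hi => ?_
    simp [ext, hΔW hi]
  rw [hφ']
  have l1 : ∀ a b, (∀ i ∈ S, a i = b i) → φ a = φ b := by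
    intro a b hab
    refine hf1 _ _ fun i hi => ?_
    simp only [ext, hΔW hi, dif_pos]
    exact hab _ (by simp [hS, hi])
  have h1 := Ex_diff_le (JW β W) (fun _ => h) G.nn ΛV S φ 1 l1
    (fun a b _ => by have := hf2 (ext W a ω); have := hf2 (ext W b ω); simp only [hφ]; linarith)
    zero_le_one (ω := mi) (ω' := fun v => ω v.1) (fun i => by simp)
  have h2 := Ex_diff_le (JW β W) (fun _ => h) G.nn ΛV S (fun σ => (-1) * φ σ) 1
    (fun a b hab => by rw [l1 a b hab])
    (fun a b _ => by have := hf2 (ext W a ω); have := hf2 (ext W b ω); simp only [hφ]; linarith)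
    zero_le_one (ω := mi) (ω' := fun v => ω' v.1) (fun i => by simp)
  rw [Ex_smul, Ex_smul] at h2
  have h3 : ∀ ω : {x // x ∈ W} → Bool, ∑ y ∈ S, (Ex (JW β W) (fun _ => h) ΛV ω (fun σ => spin (σ y)) -
      Ex (JW β W) (fun _ => h) ΛV mi (fun σ => spin (σ y))) ≤ ∑ i ∈ Δ, 4 * Real.exp (-c * r i) := by
    intro ω
    have e : ∑ i ∈ Δ, 4 * Real.exp (-c * r i) = ∑ y ∈ S, 4 * Real.exp (-c * r y.1) := by
      symm
      refine Finset.sum_bij (fun y _ => y.1) ?_ ?_ ?_ ?_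
      · intro y hy; simpa [hS] using hy
      · intro a _ b _ h; exact Subtype.ext h
      · intro i hi; exact ⟨⟨i, hΔW hi⟩, by simp [hS, hi], rfl⟩
      · intro y _; rfl
    rw [e]
    refine Finset.sum_le_sum fun y hy => ?_
    have hyΔ : y.1 ∈ Δ := by simpa [hS] using hy
    have hg := H (JW β W) (fun i j => nd i.1 j.1) G y (r y.1) ΛV (by
      intro z hz
      rw [mem_bal] at hz
      simp only [hΛV, Finset.mem_filter, Finset.mem_univ, true_and]
      rw [hΛ, Finset.mem_biUnion]
      exact ⟨y.1, hyΔ, by rw [mem_zbal]; exact hz⟩)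
    have := Ex_mono (JW β W) (fun _ => h) G.nn ΛV (ω := ω) (ω' := pl) (fun i => by simp) _ (mono_spin y)
    unfold gap at hg
    linarith
  have := h3 (fun v => ω v.1)
  have := h3 (fun v => ω' v.1)
  linarith

end Transfer


section Final
variable {d : ℕ}

lemma localDensity_mul (β h : ℝ) (Λ : Finset (Site d)) (f g : Config d → ℝ) (ω : Config d)
    (hg : ∀ a b : Config d, (∀ i, i ∉ Λ → a i = b i) → g a = g b) (e : ℝ) :
    localDensity β h Λ (fun σ => g σ * (f σ - e)) ω = g ω * (localDensity β h Λ f ω - e) := by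
  have hZ : 0 < ∑ η : {x // x ∈ Λ} → Bool, Real.exp (hamElem β h Λ (patch Λ η ω) ω) :=
    Finset.sum_pos (fun _ _ => Real.exp_pos _) Finset.univ_nonempty
  have hp : ∀ η, g (patch Λ η ω) = g ω := fun η => hg _ _ fun i hi => by simp [patch, hi]
  unfold localDensity
  rw [div_sub' hZ.ne', ← mul_div_assoc]
  congr 1
  simp only [hp]
  rw [Finset.sum_mul, ← Finset.sum_sub_distrib, Finset.mul_sum]
  exact Finset.sum_congr rfl fun η _ => by ring

lemma gibbs_bound (β h : ℝ) (μ : Measure (Config d)) (hμ : IsGibbs d β h μ) (Λ : Finset (Site d))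
    (A B : Set (Config d)) (hA : MeasurableSet A) (hB : MeasurableSet B)
    (hBΛ : ∀ a b : Config d, (∀ i, i ∉ Λ → a i = b i) → (a ∈ B ↔ b ∈ B)) (g0 ε : ℝ)
    (hg : ∀ ω, |localDensity β h Λ (A.indicator fun _ => 1) ω - g0| ≤ ε) :
    |μ.real (A ∩ B) - g0 * μ.real B| ≤ ε * μ.real B := by
  have := hμ.1
  have key : ∀ e s : ℝ, (∀ ω, 0 ≤ s * (localDensity β h Λ (A.indicator fun _ => 1) ω - e)) →
      0 ≤ s * (μ.real (A ∩ B) - e * μ.real B) := by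
    intro e s hs
    have mA : Measurable (A.indicator (fun _ => (1:ℝ)) : Config d → ℝ) :=
      measurable_const.indicator hA
    have mB : Measurable (B.indicator (fun _ => s) : Config d → ℝ) :=
      measurable_const.indicator hB
    have bA : ∀ σ : Config d, |A.indicator (fun _ => (1:ℝ)) σ| ≤ 1 := by
      intro σ; by_cases hσ : σ ∈ A <;> simp [hσ]
    have bB : ∀ σ : Config d, |B.indicator (fun _ => s) σ| ≤ |s| := by
      intro σ; by_cases hσ : σ ∈ B <;> simp [hσ]
    have h1 := hμ.2 Λ (fun σ => B.indicator (fun _ => s) σ * (A.indicator (fun _ => (1:ℝ)) σ - e))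
      (mB.mul (mA.sub_const e)) ⟨|s| * (1 + |e|), fun σ => by
        rw [abs_mul]
        refine mul_le_mul (bB σ) ?_ (abs_nonneg _) (abs_nonneg _)
        calc _ ≤ |A.indicator (fun _ => (1:ℝ)) σ| + |e| := by
              rw [sub_eq_add_neg, ← abs_neg e]; exact abs_add_le _ _
          _ ≤ _ := by linarith [bA σ]⟩
    have h2 : 0 ≤ ∫ ω, localDensity β h Λ
        (fun σ => B.indicator (fun _ => s) σ * (A.indicator (fun _ => (1:ℝ)) σ - e)) ω ∂μ := by
      refine integral_nonneg fun ω => ?_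
      rw [localDensity_mul]
      · by_cases hω : ω ∈ B
        · simpa [hω] using hs ω
        · simp [hω]
      · intro a b hab
        have := hBΛ a b hab
        by_cases ha : a ∈ B
        · simp [ha, this.1 ha]
        · have hb : b ∉ B := fun h => ha (this.2 h)
          simp [ha, hb]
    rw [← h1] at h2
    have e1 : (fun σ => B.indicator (fun _ => s) σ * (A.indicator (fun _ => (1:ℝ)) σ - e)) =
        fun σ => (A ∩ B).indicator (fun _ => s) σ - B.indicator (fun _ => s * e) σ := by
      funext σ
      by_cases h1 : σ ∈ A <;> by_cases h2 : σ ∈ B <;> simp [h1, h2] <;> ring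
    rw [e1, integral_sub, integral_indicator_const _ (hA.inter hB), integral_indicator_const _ hB] at h2
    · simp only [smul_eq_mul] at h2
      linarith
    · exact (integrable_const _).indicator (hA.inter hB)
    · exact (integrable_const _).indicator hB
  have k1 := key (g0 - ε) 1 (fun ω => by have := abs_le.1 (hg ω); linarith)
  have k2 := key (g0 + ε) (-1) (fun ω => by have := abs_le.1 (hg ω); linarith)
  rw [abs_le]
  constructor <;> linarith

lemma gibbs_finite (d : ℕ) (β h : ℝ) (hβ : 0 ≤ β) (hh : 0 < h) :
    ∃ c : ℝ, 0 < c ∧ ∀ μ : Measure (Config d), IsGibbs d β h μ →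
      ∀ (Δ : Finset (Site d)) (r : Site d → ℕ) (A B : Set (Config d)), MeasurableSet A →
      MeasurableSet B → (∀ a b : Config d, (∀ i ∈ Δ, a i = b i) → (a ∈ A ↔ b ∈ A)) →
      (∀ a b : Config d, (∀ i, (∀ j ∈ Δ, r j < nd j i) → a i = b i) → (a ∈ B ↔ b ∈ B)) →
      0 < μ.real B →
      |μ.real (A ∩ B) / μ.real B - μ.real A| ≤ ∑ i ∈ Δ, 8 * Real.exp (-c * r i) := by
  obtain ⟨c, hc, H⟩ := localDensity_close d β h hβ hh
  refine ⟨c, hc, fun μ hμ Δ r A B hA hB hAΔ hBΔ hB0 => ?_⟩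
  have := hμ.1
  set Λ := Δ.biUnion fun i => zbal i (r i) with hΛ
  set f : Config d → ℝ := A.indicator fun _ => 1 with hf
  have cl := H Δ r f (fun a b hab => by
      have := hAΔ a b hab
      by_cases ha : a ∈ A
      · simp [hf, ha, this.1 ha]
      · have hb : b ∉ A := fun h => ha (this.2 h)
        simp [hf, ha, hb])
    (fun a => by by_cases ha : a ∈ A <;> simp [hf, ha])
  rw [← hΛ] at cl
  set ε := ∑ i ∈ Δ, 4 * Real.exp (-c * r i) with hε
  set g0 := localDensity β h Λ f (fun _ => true)
  have hg : ∀ ω, |localDensity β h Λ f ω - g0| ≤ ε := by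
    intro ω
    have := cl ω (fun _ => true)
    have := cl (fun _ => true) ω
    rw [abs_le]; constructor <;> linarith
  have k1 := gibbs_bound β h μ hμ Λ A B hA hB (fun a b hab => hBΔ a b fun i hi => hab i (by
    rw [hΛ, Finset.mem_biUnion]
    rintro ⟨j, hj, hij⟩
    rw [mem_zbal] at hij
    have := hi j hj
    omega)) g0 ε hg
  have k2 := gibbs_bound β h μ hμ Λ A Set.univ hA MeasurableSet.univ (fun a b hab => by simp) g0 ε hg
  simp only [Set.inter_univ, probReal_univ, mul_one] at k2
  have k3 : |μ.real (A ∩ B) / μ.real B - g0| ≤ ε := by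
    rw [div_sub' hB0.ne', abs_div, abs_of_pos hB0, div_le_iff₀ hB0, mul_comm (μ.real B)]
    exact k1
  have e : ∑ i ∈ Δ, 8 * Real.exp (-c * r i) = ε + ε := by
    rw [hε, ← Finset.sum_add_distrib]
    exact Finset.sum_congr rfl fun i _ => by ring
  rw [e]
  calc _ = |(μ.real (A ∩ B) / μ.real B - g0) + (g0 - μ.real A)| := by congr 1; ring
    _ ≤ |μ.real (A ∩ B) / μ.real B - g0| + |g0 - μ.real A| := abs_add_le _ _
    _ ≤ ε + ε := by rw [abs_sub_comm g0]; gcongr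

/-- Approximation of cylinder events by finite cylinders. -/
lemma approx_cyl (μ : Measure (Config d)) [IsProbabilityMeasure μ] (Δ : Set (Site d))
    (A : Set (Config d)) (hA : MeasurableSet[cylEvents Δ] A) (ε : ENNReal) (hε : 0 < ε) :
    ∃ (s : Finset Δ) (A0 : Set (Config d)), MeasurableSet A0 ∧
      (∀ a b : Config d, (∀ i ∈ s, a i.1 = b i.1) → (a ∈ A0 ↔ b ∈ A0)) ∧
      μ (symmDiff A0 A) < ε := by
  obtain ⟨A', hA', rfl⟩ := hA
  set R : Config d → (Δ → Bool) := fun σ i => σ i.val with hR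
  have hRm : Measurable R := measurable_pi_lambda _ fun i => measurable_pi_apply _
  have : IsProbabilityMeasure (μ.map R) := Measure.isProbabilityMeasure_map hRm.aemeasurable
  obtain ⟨T, hT, hTε⟩ := exists_measure_symmDiff_lt_of_generateFrom_isSetRing (μ := μ.map R)
    (C := measurableCylinders fun _ : Δ => Bool)
    ⟨empty_mem_measurableCylinders _, fun _ _ h1 h2 => union_mem_measurableCylinders h1 h2,
      fun _ _ h1 h2 => sdiff_mem_measurableCylinders h1 h2⟩
    ⟨{Set.univ}, Set.countable_singleton _, by
      simpa using univ_mem_measurableCylinders (fun _ : Δ => Bool), by simp⟩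
    generateFrom_measurableCylinders.symm hA' hε
  have hTm : MeasurableSet T := MeasurableSet.of_mem_measurableCylinders hT
  rw [mem_measurableCylinders] at hT
  obtain ⟨s, S, hS, rfl⟩ := hT
  refine ⟨s, R ⁻¹' (cylinder s S), hRm hTm, ?_, ?_⟩
  · intro a b hab
    simp only [Set.mem_preimage, mem_cylinder]
    have : s.restrict (R a) = s.restrict (R b) := by
      funext i; exact hab i.1 i.2
    rw [this]
  · rw [Measure.map_apply hRm (by exact hTm.symmDiff hA')] at hTε
    exact hTε

theorem main_aux (d : ℕ) (β h : ℝ) (hβ : 0 ≤ β) (hh : 0 < h)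
    (μ : Measure (Config d)) (hμ : IsGibbs d β h μ) : WeakMixing d μ := by
  obtain ⟨c, hc, H⟩ := gibbs_finite d β h hβ hh
  have hprob := hμ.1
  have hC1 : (1 : ℝ) ≤ 8 * Real.exp c := by
    have := Real.one_le_exp hc.le
    linarith
  refine ⟨8 * Real.exp c, by linarith, c, hc, fun Δ Δ' A B hA hB hB0 => ?_⟩
  have hB1 : 0 < μ.real B := ENNReal.toReal_pos hB0.ne' (measure_ne_top _ _)
  have hle : ∀ Δ : Set (Site d), cylEvents Δ ≤ (inferInstance : MeasurableSpace (Config d)) := by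
    intro Δ
    exact Measurable.comap_le (measurable_pi_lambda _ fun i => measurable_pi_apply _)
  have hAm : MeasurableSet A := hle Δ A hA
  have hBm : MeasurableSet B := hle Δ' B hB
  have hdep : ∀ a b : Config d, (∀ i ∈ Δ', a i = b i) → (a ∈ B ↔ b ∈ B) := by
    obtain ⟨B', _, rfl⟩ := hB
    intro a b hab
    have : (fun i : Δ' => a i.val) = fun i : Δ' => b i.val := by
      funext i; exact hab i.1 i.2
    simp only [Set.mem_preimage, this]
  have hre : (μ (A ∩ B) / μ B).toReal - (μ A).toReal = μ.real (A ∩ B) / μ.real B - μ.real A := by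
    rw [ENNReal.toReal_div]; rfl
  rw [hre]
  rcases Δ'.eq_empty_or_nonempty with hE | hne
  · have hBu : B = Set.univ := by
      obtain ⟨b, hb⟩ : B.Nonempty := by
        by_contra hcon
        rw [Set.not_nonempty_iff_eq_empty] at hcon
        rw [hcon] at hB0
        simp at hB0
      ext a
      simp only [Set.mem_univ, iff_true]
      exact (hdep b a (by simp [hE])).1 hb
    rw [hBu]; simp
  by_cases hint : (Δ ∩ Δ').Nonempty
  · obtain ⟨i, hi, hi'⟩ := hint
    have h1 : |μ.real (A ∩ B) / μ.real B - μ.real A| ≤ 1 := by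
      have a1 : 0 ≤ μ.real (A ∩ B) / μ.real B := by positivity
      have a2 : μ.real (A ∩ B) / μ.real B ≤ 1 := by
        rw [div_le_one hB1]
        exact measureReal_mono Set.inter_subset_right
      have a3 : 0 ≤ μ.real A := measureReal_nonneg
      have a4 : μ.real A ≤ 1 := measureReal_le_one
      rw [abs_le]; constructor <;> linarith
    calc ENNReal.ofReal |μ.real (A ∩ B) / μ.real B - μ.real A| ≤ ENNReal.ofReal 1 :=
          ENNReal.ofReal_le_ofReal h1
      _ ≤ ENNReal.ofReal (8 * Real.exp c) * 1 := by
          rw [mul_one]; exact ENNReal.ofReal_le_ofReal hC1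
      _ ≤ _ := by
          gcongr
          have t1 : (1 : ENNReal) = ENNReal.ofReal (Real.exp (-c * dist1 i i)) := by
            simp [dist1]
          rw [t1]
          exact (ENNReal.le_tsum (f := fun j : Δ' =>
            ENNReal.ofReal (Real.exp (-c * dist1 i j.val))) ⟨i, hi'⟩).trans
            (ENNReal.le_tsum (f := fun i : Δ => ∑' j : Δ',
              ENNReal.ofReal (Real.exp (-c * dist1 i.val j.val))) ⟨i, hi⟩)
  have hr : ∀ i : Site d, ∃ r : ℕ, i ∈ Δ → (∀ j ∈ Δ', r < nd i j) ∧ ∃ j ∈ Δ', nd i j = r + 1 := by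
    intro i
    set D : Set ℕ := (fun j => nd i j) '' Δ' with hD
    have hDne : D.Nonempty := hne.image _
    refine ⟨sInf D - 1, fun hi => ?_⟩
    obtain ⟨j, hj, hjD⟩ := Nat.sInf_mem hDne
    have hpos : 0 < sInf D := by
      rw [← hjD]
      rcases Nat.eq_zero_or_pos (nd i j) with h0 | h0
      · exact absurd ⟨i, hi, by rw [nd_eq_zero h0]; exact hj⟩ hint
      · exact h0
    refine ⟨fun j' hj' => ?_, j, hj, ?_⟩
    · have : sInf D ≤ nd i j' := Nat.sInf_le ⟨j', hj', rfl⟩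
      omega
    · have hjD' : nd i j = sInf D := hjD
      omega
  choose r hr using hr
  refine ENNReal.le_of_forall_pos_le_add fun η hη _ => ?_
  set ε : ℝ := η * μ.real B / 2 with hε
  have hη' : (0 : ℝ) < η := by exact_mod_cast hη
  have hε0 : 0 < ε := by positivity
  obtain ⟨s, A0, hA0m, hA0, happ⟩ := approx_cyl μ Δ A hA (ENNReal.ofReal ε) (by simpa using hε0)
  have happ' : μ.real (symmDiff A0 A) ≤ ε := ENNReal.toReal_le_of_le_ofReal hε0.le happ.le
  have d1 : |μ.real A0 - μ.real A| ≤ ε :=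
    (abs_measureReal_sub_le_measureReal_symmDiff hA0m.nullMeasurableSet hAm.nullMeasurableSet).trans happ'
  have d2 : |μ.real (A0 ∩ B) - μ.real (A ∩ B)| ≤ ε := by
    refine (abs_measureReal_sub_le_measureReal_symmDiff (hA0m.inter hBm).nullMeasurableSet (hAm.inter hBm).nullMeasurableSet).trans
      (le_trans (measureReal_mono ?_) happ')
    intro x hx
    simp only [Set.mem_symmDiff, Set.mem_inter_iff] at *
    tauto
  set Δ0 : Finset (Site d) := s.map (Function.Embedding.subtype _) with hΔ0
  have hΔ0Δ : ∀ i ∈ Δ0, i ∈ Δ := by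
    intro i hi
    rw [hΔ0, Finset.mem_map] at hi
    obtain ⟨j, _, rfl⟩ := hi
    exact j.2
  have m1 := H μ hμ Δ0 r A0 B hA0m hBm
    (fun a b hab => hA0 a b fun i hi => hab i.1 (by
      rw [hΔ0, Finset.mem_map]; exact ⟨i, hi, rfl⟩))
    (fun a b hab => hdep a b fun i hi => hab i fun j hj => (hr j (hΔ0Δ j hj)).1 i hi) hB1
  rw [hΔ0, Finset.sum_map] at m1
  have m2 : |μ.real (A ∩ B) / μ.real B - μ.real A| ≤ ∑ i ∈ s, 8 * Real.exp (-c * r i.1) + η := by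
    have q1 : |μ.real (A ∩ B) / μ.real B - μ.real (A0 ∩ B) / μ.real B| ≤ η / 2 := by
      rw [← sub_div, abs_div, abs_of_pos hB1, div_le_iff₀ hB1, abs_sub_comm]
      refine d2.trans (le_of_eq ?_)
      rw [hε]; ring
    have q2 : ε ≤ η / 2 := by
      have : μ.real B ≤ 1 := measureReal_le_one
      rw [hε]; nlinarith
    have m1' : |μ.real (A0 ∩ B) / μ.real B - μ.real A0| ≤ ∑ i ∈ s, 8 * Real.exp (-c * r i.1) := m1
    rw [abs_le] at *
    constructor <;> linarith [q1.1, q1.2, d1.1, d1.2, m1'.1, m1'.2]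
  calc ENNReal.ofReal |μ.real (A ∩ B) / μ.real B - μ.real A|
      ≤ ENNReal.ofReal (∑ i ∈ s, 8 * Real.exp (-c * r i.1) + η) := ENNReal.ofReal_le_ofReal m2
    _ = ∑ i ∈ s, ENNReal.ofReal (8 * Real.exp (-c * r i.1)) + η := by
        rw [ENNReal.ofReal_add (Finset.sum_nonneg fun i _ => by positivity) hη'.le,
          ENNReal.ofReal_sum_of_nonneg (fun i _ => by positivity), ENNReal.ofReal_coe_nnreal]
    _ ≤ _ := by
        gcongr
        calc ∑ i ∈ s, ENNReal.ofReal (8 * Real.exp (-c * r i.1))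
            ≤ ∑ i ∈ s, ENNReal.ofReal (8 * Real.exp c) *
              ∑' j : Δ', ENNReal.ofReal (Real.exp (-c * dist1 i.val j.val)) := by
              refine Finset.sum_le_sum fun i _ => ?_
              obtain ⟨_, j, hj, hij⟩ := hr i.1 i.2
              have e : 8 * Real.exp (-c * r i.1) =
                  8 * Real.exp c * Real.exp (-c * dist1 i.val j) := by
                rw [dist1_eq, hij, mul_assoc, ← Real.exp_add]
                push_cast
                congr 2; ring
              rw [e, ENNReal.ofReal_mul (by positivity)]
              gcongr
              exact ENNReal.le_tsum (f := fun j : Δ' =>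
                ENNReal.ofReal (Real.exp (-c * dist1 i.val j.val))) ⟨j, hj⟩
          _ = ENNReal.ofReal (8 * Real.exp c) * ∑ i ∈ s,
              ∑' j : Δ', ENNReal.ofReal (Real.exp (-c * dist1 i.val j.val)) := by
              rw [Finset.mul_sum]
          _ ≤ _ := by
              gcongr
              exact ENNReal.sum_le_tsum s

end Final

end IsingAux

/-- For `d ≥ 1`, `β ≥ 0`, `h > 0`, every Gibbs measure for the
nearest-neighbour ferromagnetic Ising model on `ℤ^d` at `(β, h)` is weak mixing. -/
theorem ising_gibbs_weakMixing (d : ℕ) (hd : 1 ≤ d) (β h : ℝ) (hβ : 0 ≤ β) (hh : 0 < h)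
    (μ : MeasureTheory.Measure (IsingP.Config d)) (hμ : IsingP.IsGibbs d β h μ) :
    IsingP.WeakMixing d μ := by
  exact IsingAux.main_aux d β h hβ hh μ hμ
end

section
/- Let d ≥ 1, β₀ ≥ 0 and h₀ ≠ 0. Then there exist an open set U ⊆ ℝ² containing (β₀,h₀) and a real-analytic function F : U → ℝ such that for every (β,h) ∈ U, (2N)^{−d} log Z_{N,β,h} converges to F(β,h) as N → ∞; in particular the pressure ψ(β,h) = lim_{N→∞} (2N)^{−d} log Z_{N,β,h} exists near (β₀,h₀) and is real-analytic in (β,h) in a neighbourhood of (β₀,h₀). -/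
open Filter

namespace IsingP

noncomputable def spin' (b : Bool) : ℝ := if b then 1 else -1

noncomputable def torusEnergy (d N : ℕ) [NeZero (2 * N)] (β h : ℝ)
    (σ : (Fin d → ZMod (2 * N)) → Bool) : ℝ :=
  β * ∑ i : Fin d → ZMod (2 * N), ∑ k : Fin d,
      spin' (σ i) * spin' (σ (fun l => i l + if l = k then 1 else 0))
    + h * ∑ i : Fin d → ZMod (2 * N), spin' (σ i)

noncomputable def torusZ (d : ℕ) (β h : ℝ) (N : ℕ) : ℝ :=
  if hN : 0 < N then
    haveI : NeZero (2 * N) := ⟨by omega⟩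
    ∑ σ : (Fin d → ZMod (2 * N)) → Bool, Real.exp (torusEnergy d N β h σ)
  else 0

end IsingP



namespace IsingP

/-- Asano contraction in one pair of variables. -/
lemma asano_aux (α β γ δ : ℂ) (ρ r : ℝ) (hρ : 0 < ρ) (hr : 0 < r)
    (H : ∀ x y : ℂ, ‖x‖ ≤ ρ → ‖y‖ ≤ r → α + β * x + γ * y + δ * (x * y) ≠ 0)
    (z : ℂ) (hz : ‖z‖ ≤ ρ * r) : α + δ * z ≠ 0 := by
  intro h0
  have hα : α ≠ 0 := by simpa using H 0 0 (by simpa using hρ.le) (by simpa using hr.le)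
  have hδ : δ ≠ 0 := by
    rintro rfl
    simp at h0; exact hα h0
  have hρ' : (ρ : ℂ) ≠ 0 := by exact_mod_cast hρ.ne'
  have hr' : (r : ℂ) ≠ 0 := by exact_mod_cast hr.ne'
  set a : ℂ := δ * (ρ * r) with ha
  have ha0 : a ≠ 0 := by positivity
  set b : ℂ := β * ρ + γ * r with hb
  obtain ⟨s, hs⟩ := IsAlgClosed.exists_pow_nat_eq (b ^ 2 - 4 * a * α) (n := 2) (by norm_num)
  set t1 := (-b + s) / (2 * a) with ht1
  set t2 := (-b - s) / (2 * a) with ht2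
  have hprod : t1 * t2 = α / a := by
    rw [ht1, ht2]; field_simp; linear_combination -hs
  have key : ∀ t : ℂ, ‖t‖ ≤ 1 → α + b * t + a * t ^ 2 ≠ 0 := by
    intro t ht
    have := H (ρ * t) (r * t) (by
      rw [norm_mul, Complex.norm_real, Real.norm_of_nonneg hρ.le]
      nlinarith) (by
      rw [norm_mul, Complex.norm_real, Real.norm_of_nonneg hr.le]
      nlinarith)
    intro h; apply this; rw [← h, hb, ha]; ring
  have h1 : 1 < ‖t1‖ := by
    by_contra hh
    refine key t1 (not_lt.mp hh) ?_
    rw [ht1]; field_simp; linear_combination hs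
  have h2 : 1 < ‖t2‖ := by
    by_contra hh
    refine key t2 (not_lt.mp hh) ?_
    rw [ht2]; field_simp; linear_combination hs
  have h3 : 1 < ‖α / a‖ := by
    rw [← hprod, norm_mul]; nlinarith
  have h4 : α = - (δ * z) := by linear_combination h0
  rw [h4, ha, norm_div, norm_neg, norm_mul, norm_mul, norm_mul, Complex.norm_real,
    Complex.norm_real, Real.norm_of_nonneg hρ.le, Real.norm_of_nonneg hr.le,
    mul_div_mul_left _ _ (norm_ne_zero_iff.mpr hδ), one_lt_div (by positivity)] at h3
  linarith

lemma asano_two (A B C D a : ℂ) (ρ1 ρ2 r : ℝ) (h1 : 0 < ρ1) (h2 : 0 < ρ2) (hr : 0 < r)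
    (H : ∀ x y : ℂ, ‖x‖ ≤ ρ1 → ‖y‖ ≤ ρ2 → A + B * x + C * y + D * (x * y) ≠ 0)
    (Ha : ∀ x y : ℂ, ‖x‖ ≤ r → ‖y‖ ≤ r → 1 + a * (x + y) + x * y ≠ 0)
    (z w : ℂ) (hz : ‖z‖ ≤ ρ1 * r) (hw : ‖w‖ ≤ ρ2 * r) :
    A + a * B * z + a * C * w + D * (z * w) ≠ 0 := by
  have step1 : ∀ y y' : ℂ, ‖y‖ ≤ ρ2 → ‖y'‖ ≤ r →
      (A + C * y) * (1 + a * y') + ((B + D * y) * (a + y')) * z ≠ 0 := by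
    intro y y' hy hy'
    refine asano_aux _ ((B + D * y) * (1 + a * y')) ((A + C * y) * (a + y')) _ ρ1 r h1 hr ?_ z hz
    intro x x' hx hx'
    have := mul_ne_zero (H x y hx hy) (Ha x' y' hx' hy')
    intro h; apply this; rw [← h]; ring
  have := asano_aux (A + a * B * z) (C + a * D * z) (a * A + B * z) (a * C + D * z)
    ρ2 r h2 hr (by
      intro y y' hy hy'
      have := step1 y y' hy hy'
      intro h; apply this; rw [← h]; ring) w hw
  intro h; apply this; rw [← h]; ring

variable {V : Type*} [Fintype V] [DecidableEq V]

noncomputable def vf (b : Bool) (x : ℂ) : ℂ := if b then 1 else x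

noncomputable def PW (W : (V → Bool) → ℂ) (z : V → ℂ) : ℂ := ∑ σ, W σ * ∏ v, vf (σ v) (z v)

noncomputable def SW (W : (V → Bool) → ℂ) (z : V → ℂ) (u v : V) (b c : Bool) : ℂ :=
  ∑ σ : V → Bool, if σ u = b ∧ σ v = c then
    W σ * ∏ w ∈ (Finset.univ.erase u).erase v, vf (σ w) (z w) else 0

lemma PW_split (W : (V → Bool) → ℂ) (κ : Bool → Bool → ℂ) (z : V → ℂ) (u v : V) (huv : u ≠ v) :
    PW (fun σ => W σ * κ (σ u) (σ v)) z =
      κ true true * SW W z u v true true + κ false true * SW W z u v false true * z u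
      + κ true false * SW W z u v true false * z v
      + κ false false * SW W z u v false false * (z u * z v) := by
  unfold PW SW
  simp only [Finset.mul_sum, Finset.sum_mul, ← Finset.sum_add_distrib]
  refine Finset.sum_congr rfl fun σ _ => ?_
  rw [← Finset.mul_prod_erase Finset.univ _ (Finset.mem_univ u),
    ← Finset.mul_prod_erase (Finset.univ.erase u) _ (a := v) (by simp [huv.symm])]
  cases hu : σ u <;> cases hv : σ v <;> simp [vf] <;> ring

lemma SW_congr (W : (V → Bool) → ℂ) (z z' : V → ℂ) (u v : V) (b c : Bool)
    (h : ∀ w, w ≠ u → w ≠ v → z w = z' w) : SW W z u v b c = SW W z' u v b c := by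
  unfold SW
  refine Finset.sum_congr rfl fun σ _ => ?_
  congr 2
  refine Finset.prod_congr rfl fun w hw => ?_
  simp at hw
  rw [h w hw.2 hw.1]

def NV (W : (V → Bool) → ℂ) (ρ : V → ℝ) : Prop := ∀ z : V → ℂ, (∀ v, ‖z v‖ ≤ ρ v) → PW W z ≠ 0

noncomputable def edg (a : ℂ) (b c : Bool) : ℂ := if b = c then 1 else a

lemma NV_edge (W : (V → Bool) → ℂ) (ρ : V → ℝ) (hρ : ∀ v, 0 < ρ v) (hW : NV W ρ)
    (a : ℂ) (r : ℝ) (hr : 0 < r)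
    (Ha : ∀ x y : ℂ, ‖x‖ ≤ r → ‖y‖ ≤ r → 1 + a * (x + y) + x * y ≠ 0)
    (u v : V) (huv : u ≠ v) :
    NV (fun σ => W σ * edg a (σ u) (σ v))
      (fun w => ρ w * ((if u = w then r else 1) * (if v = w then r else 1))) := by
  intro z hz
  rw [PW_split W (edg a) z u v huv]
  have := asano_two (SW W z u v true true) (SW W z u v false true) (SW W z u v true false)
    (SW W z u v false false) a (ρ u) (ρ v) r (hρ u) (hρ v) hr ?_ Ha (z u) (z v)
    (by simpa [huv.symm] using hz u) (by simpa [huv] using hz v)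
  · intro h; apply this; rw [← h]; simp [edg]
  intro x y hx hy
  set z' := Function.update (Function.update z u x) v y with hz'
  have h1 := hW z' (by
    intro w
    by_cases hwv : w = v
    · subst hwv; simpa [hz'] using hy
    by_cases hwu : w = u
    · subst hwu; simpa [hz', hwv] using hx
    have := hz w
    simpa [hz', hwv, hwu, Ne.symm hwu, Ne.symm hwv, eq_comm] using this)
  have h2 := PW_split W (fun _ _ => 1) z' u v huv
  simp only [mul_one, one_mul] at h2
  have hc : ∀ b c, SW W z' u v b c = SW W z u v b c := fun b c => SW_congr _ _ _ _ _ _ _ (by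
    intro w h1 h2; simp [hz', h1, h2])
  have e1 : z' u = x := by simp [hz', huv]
  have e2 : z' v = y := by simp [hz']
  rw [hc, hc, hc, hc, e1, e2] at h2
  rw [← h2]; exact h1

lemma NV_base (r : ℝ) (hr1 : r < 1) : NV (fun _ : V → Bool => 1) (fun _ => r) := by
  intro z hz
  have : PW (fun _ : V → Bool => 1) z = ∏ v, (1 + z v) := by
    unfold PW
    have := Finset.prod_univ_sum (fun _ : V => (Finset.univ : Finset Bool))
      (fun v b => vf b (z v))
    rw [Fintype.piFinset_univ] at this
    simp only [one_mul]
    rw [← this]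
    simp [vf]
  rw [this, Finset.prod_ne_zero_iff]
  intro v _ h
  have h2 : z v = -1 := by linear_combination h
  have := hz v
  rw [h2] at this
  simp at this; linarith

lemma NV_edges {E : Type*} [DecidableEq E] (S : Finset E) (u v : E → V) (huv : ∀ e, u e ≠ v e)
    (a : ℂ) (r : ℝ) (hr : 0 < r) (hr1 : r < 1)
    (Ha : ∀ x y : ℂ, ‖x‖ ≤ r → ‖y‖ ≤ r → 1 + a * (x + y) + x * y ≠ 0) :
    NV (fun σ : V → Bool => ∏ e ∈ S, edg a (σ (u e)) (σ (v e)))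
      (fun w => r * ∏ e ∈ S, ((if u e = w then r else 1) * (if v e = w then r else 1))) := by
  induction S using Finset.induction_on with
  | empty => simpa using NV_base r hr1
  | insert e S he ih =>
    have := NV_edge _ _ (by
      intro w
      refine mul_pos hr (Finset.prod_pos fun e _ => ?_)
      split_ifs <;> simp [hr]) ih a r hr Ha (u e) (v e) (huv e)
    simp only [Finset.prod_insert he]
    convert this using 2
    · rw [mul_comm]
    · ring

/-- the edge polynomial has no zeros in a polydisc, stably in `a`. -/
lemma edge_nz (a0 r : ℝ) (ha0 : 0 ≤ a0) (ha1 : a0 ≤ 1) (hr : 0 < r) (hr1 : r < 1) (a : ℂ)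
    (ha : ‖a - a0‖ < (1 - r) ^ 2 / 2) (x y : ℂ) (hx : ‖x‖ ≤ r) (hy : ‖y‖ ≤ r) :
    1 + a * (x + y) + x * y ≠ 0 := by
  have h1 : ‖(a0 : ℂ) + x‖ ≤ ‖1 + a0 * x‖ := by
    rw [← sq_le_sq₀ (norm_nonneg _) (norm_nonneg _)]
    have hx2 : x.re ^ 2 + x.im ^ 2 ≤ 1 := by
      have : ‖x‖ ^ 2 ≤ 1 := by nlinarith [norm_nonneg x]
      rw [Complex.sq_norm, Complex.normSq_apply] at this
      nlinarith
    simp only [Complex.sq_norm, Complex.normSq_apply]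
    simp
    have : a0 ^ 2 ≤ 1 := by nlinarith
    nlinarith
  have h2 : 1 - r ≤ ‖1 + a0 * x‖ := by
    have : ‖(1 : ℂ)‖ - ‖(a0 : ℂ) * x‖ ≤ ‖1 + a0 * x‖ := norm_sub_le_norm_add _ _
    rw [norm_one, norm_mul, Complex.norm_real, Real.norm_of_nonneg ha0] at this
    nlinarith [norm_nonneg x]
  intro h
  have h3 : 1 + a0 * x = -(y * (a0 + x) + (a - a0) * (x + y)) := by linear_combination h
  have h4 : ‖1 + a0 * x‖ ≤ r * ‖1 + a0 * x‖ + ‖a - a0‖ * 2 := by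
    calc ‖1 + a0 * x‖ ≤ ‖y‖ * ‖(a0 : ℂ) + x‖ + ‖a - a0‖ * ‖x + y‖ := by
          rw [h3, norm_neg, ← norm_mul, ← norm_mul]; exact norm_add_le _ _
      _ ≤ _ := by
        have : ‖x + y‖ ≤ 2 := (norm_add_le _ _).trans (by linarith)
        gcongr
  nlinarith

end IsingP

namespace IsingP

/-- neighbour in direction `k` -/
def sh {d n : ℕ} (k : Fin d) (i : Fin d → ZMod n) : Fin d → ZMod n :=
  fun l => i l + if l = k then 1 else 0

noncomputable def Zc (d n : ℕ) [NeZero n] (β h : ℂ) : ℂ :=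
  ∑ σ : (Fin d → ZMod n) → Bool, Complex.exp
    (β * ∑ i : Fin d → ZMod n, ∑ k : Fin d, ((spin' (σ i) : ℂ) * (spin' (σ (sh k i)) : ℂ))
      + h * ∑ i : Fin d → ZMod n, (spin' (σ i) : ℂ))

lemma Zc_neg (d n : ℕ) [NeZero n] (β h : ℂ) : Zc d n β (-h) = Zc d n β h := by
  unfold Zc
  refine Fintype.sum_equiv (Equiv.arrowCongr (Equiv.refl _) Equiv.boolNot) _ _ fun σ => ?_
  have : ∀ b : Bool, spin' (!b) = - spin' b := by intro b; cases b <;> simp [spin']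
  simp [this]

lemma Zc_eq (d n : ℕ) [NeZero n] (β h : ℂ) :
    Zc d n β h = (∏ _e : (Fin d → ZMod n) × Fin d, Complex.exp β) *
      (∏ _i : Fin d → ZMod n, Complex.exp h) *
      PW (fun σ => ∏ e : (Fin d → ZMod n) × Fin d,
        edg (Complex.exp (-2 * β)) (σ e.1) (σ (sh e.2 e.1))) (fun _ => Complex.exp (-2 * h)) := by
  unfold Zc PW
  rw [Finset.mul_sum]
  refine Finset.sum_congr rfl fun σ _ => ?_
  have h1 : ∀ b c : Bool, Complex.exp (β * ((spin' b : ℂ) * (spin' c : ℂ))) =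
      Complex.exp β * edg (Complex.exp (-2 * β)) b c := by
    intro b c
    cases b <;> cases c <;> simp [spin', edg, ← Complex.exp_add] <;> ring_nf
  have h2 : ∀ b : Bool, Complex.exp (h * (spin' b : ℂ)) =
      Complex.exp h * vf b (Complex.exp (-2 * h)) := by
    intro b
    cases b <;> simp [spin', vf, ← Complex.exp_add] <;> ring_nf
  rw [← Fintype.sum_prod_type' (f := fun i k => ((spin' (σ i) : ℂ) * (spin' (σ (sh k i)) : ℂ))),
    Complex.exp_add, Finset.mul_sum, Finset.mul_sum, Complex.exp_sum, Complex.exp_sum]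
  simp only [h1, h2, Finset.prod_mul_distrib]
  ring

lemma sh_ne {d n : ℕ} (hn : 2 ≤ n) (k : Fin d) (i : Fin d → ZMod n) : i ≠ sh k i := by
  intro h
  have h2 := congrFun h k
  have : Fact (1 < n) := ⟨hn⟩
  simp [sh] at h2

lemma rho_eq (d n : ℕ) [NeZero n] (r : ℝ) (w : Fin d → ZMod n) :
    r * ∏ e : (Fin d → ZMod n) × Fin d,
      ((if e.1 = w then r else 1) * (if sh e.2 e.1 = w then r else 1)) = r ^ (2 * d + 1) := by
  have h : ∀ (k : Fin d) (i : Fin d → ZMod n),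
      sh k i = w ↔ i = fun l => w l - if l = k then 1 else 0 := by
    intro k i
    simp only [sh, funext_iff, eq_sub_iff_add_eq]
  rw [Fintype.prod_prod_type, Finset.prod_comm]
  simp only [h, Finset.prod_mul_distrib, Finset.prod_ite_eq', Finset.mem_univ, if_true,
    Finset.prod_const, Finset.card_univ, Fintype.card_fin]
  ring

lemma Zc_ne_zero (d n : ℕ) [NeZero n] (hn : 2 ≤ n) (β h : ℂ) (r : ℝ) (hr : 0 < r) (hr1 : r < 1)
    (Ha : ∀ x y : ℂ, ‖x‖ ≤ r → ‖y‖ ≤ r → 1 + Complex.exp (-2 * β) * (x + y) + x * y ≠ 0)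
    (hh : ‖Complex.exp (-2 * h)‖ ≤ r ^ (2 * d + 1)) : Zc d n β h ≠ 0 := by
  rw [Zc_eq]
  refine mul_ne_zero (mul_ne_zero ?_ ?_) ?_
  · exact Finset.prod_ne_zero_iff.mpr fun _ _ => Complex.exp_ne_zero _
  · exact Finset.prod_ne_zero_iff.mpr fun _ _ => Complex.exp_ne_zero _
  · refine NV_edges Finset.univ (fun e : (Fin d → ZMod n) × Fin d => e.1)
      (fun e => sh e.2 e.1) (fun e => sh_ne hn _ _) _ r hr hr1 Ha _ fun v => ?_
    simp only [rho_eq]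
    exact hh

lemma zero_free_pos (d : ℕ) (β₀ h₀ : ℝ) (hβ₀ : 0 ≤ β₀) (hh₀ : 0 < h₀) :
    ∀ᶠ p : ℂ × ℂ in nhds ((β₀ : ℂ), (h₀ : ℂ)), ∀ (n : ℕ) [NeZero n], 2 ≤ n →
      Zc d n p.1 p.2 ≠ 0 := by
  obtain ⟨r, hr, hr1, hr2⟩ : ∃ r : ℝ, 0 < r ∧ r < 1 ∧ Real.exp (-2 * h₀) < r ^ (2 * d + 1) := by
    have hc : Filter.Tendsto (fun r : ℝ => r ^ (2 * d + 1)) (nhdsWithin 1 (Set.Iio 1))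
        (nhds (1 ^ (2 * d + 1))) :=
      ((continuous_pow (2 * d + 1)).tendsto 1).mono_left nhdsWithin_le_nhds
    rw [one_pow] at hc
    have e1 := hc.eventually (lt_mem_nhds (show Real.exp (-2 * h₀) < 1 by
      rw [Real.exp_lt_one_iff]; linarith))
    have e2 : ∀ᶠ r : ℝ in nhdsWithin 1 (Set.Iio 1), r < 1 := self_mem_nhdsWithin
    have e3 : ∀ᶠ r : ℝ in nhdsWithin 1 (Set.Iio 1), 0 < r :=
      nhdsWithin_le_nhds (lt_mem_nhds one_pos)
    obtain ⟨r, h1, h2, h3⟩ := (e1.and (e2.and e3)).exists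
    exact ⟨r, h3, h2, h1⟩
  have c1 : Continuous fun p : ℂ × ℂ => ‖Complex.exp (-2 * p.1) - (Real.exp (-2 * β₀) : ℝ)‖ := by
    fun_prop
  have c2 : Continuous fun p : ℂ × ℂ => ‖Complex.exp (-2 * p.2)‖ := by fun_prop
  have e1 := (c1.tendsto ((β₀ : ℂ), (h₀ : ℂ))).eventually (gt_mem_nhds
    (show ‖Complex.exp (-2 * (β₀ : ℂ)) - (Real.exp (-2 * β₀) : ℝ)‖ < (1 - r) ^ 2 / 2 by
      push_cast
      rw [sub_self, norm_zero]
      have : 0 < 1 - r := by linarith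
      positivity))
  have e2 := (c2.tendsto ((β₀ : ℂ), (h₀ : ℂ))).eventually (gt_mem_nhds
    (show ‖Complex.exp (-2 * (h₀ : ℂ))‖ < r ^ (2 * d + 1) by
      rw [Complex.norm_exp]; simpa using hr2))
  filter_upwards [e1, e2] with p h1 h2 n _ hn
  refine Zc_ne_zero d n hn p.1 p.2 r hr hr1 ?_ h2.le
  intro x y hx hy
  exact edge_nz (Real.exp (-2 * β₀)) r (Real.exp_pos _).le
    (by rw [Real.exp_le_one_iff]; linarith) hr hr1 _ h1 x y hx hy

lemma zero_free (d : ℕ) (β₀ h₀ : ℝ) (hβ₀ : 0 ≤ β₀) (hh₀ : h₀ ≠ 0) :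
    ∀ᶠ p : ℂ × ℂ in nhds ((β₀ : ℂ), (h₀ : ℂ)), ∀ (n : ℕ) [NeZero n], 2 ≤ n →
      Zc d n p.1 p.2 ≠ 0 := by
  rcases lt_or_gt_of_ne hh₀ with h | h
  · have := zero_free_pos d β₀ (-h₀) hβ₀ (by linarith)
    have c : Continuous fun p : ℂ × ℂ => (p.1, -p.2) := by fun_prop
    have c' := c.tendsto ((β₀ : ℂ), (h₀ : ℂ))
    have := c'.eventually (p := fun p : ℂ × ℂ => ∀ (n : ℕ) [NeZero n], 2 ≤ n →
      Zc d n p.1 p.2 ≠ 0) (by simpa using this)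
    filter_upwards [this] with p hp n _ hn
    have := hp n hn
    rwa [Zc_neg] at this
  · exact zero_free_pos d β₀ h₀ hβ₀ h

end IsingP

namespace IsingP

noncomputable def En (d n : ℕ) [NeZero n] (σ : (Fin d → ZMod n) → Bool) : ℝ :=
  ∑ i : Fin d → ZMod n, ∑ k : Fin d, spin' (σ i) * spin' (σ (sh k i))

noncomputable def Mg (d n : ℕ) [NeZero n] (σ : (Fin d → ZMod n) → Bool) : ℝ :=
  ∑ i : Fin d → ZMod n, spin' (σ i)

noncomputable def Zr (d n : ℕ) [NeZero n] (β h : ℝ) : ℝ :=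
  ∑ σ : (Fin d → ZMod n) → Bool, Real.exp (β * En d n σ + h * Mg d n σ)

noncomputable def ph (n m : ℕ) (x : Fin m × ZMod n) : ZMod (n * m) :=
  ((x.2.val + n * x.1 : ℕ) : ZMod (n * m))

lemma ph_val (n m : ℕ) [NeZero n] [NeZero m] (x : Fin m × ZMod n) :
    (ph n m x).val = x.2.val + n * x.1 := by
  unfold ph
  rw [ZMod.val_natCast_of_lt]
  have h1 := ZMod.val_lt x.2
  have h2 := x.1.2
  calc x.2.val + n * x.1 < n + n * x.1 := by omega
    _ = n * (x.1 + 1) := by ring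
    _ ≤ n * m := Nat.mul_le_mul_left _ h2

lemma ph_bij (n m : ℕ) [NeZero n] [NeZero m] : Function.Bijective (ph n m) := by
  rw [Fintype.bijective_iff_injective_and_card]
  constructor
  · rintro ⟨q, p⟩ ⟨q', p'⟩ h
    have h1 := congrArg ZMod.val h
    rw [ph_val, ph_val] at h1
    simp only at h1
    have hp := ZMod.val_lt p
    have hp' := ZMod.val_lt p'
    have hn : 0 < n := Nat.pos_of_ne_zero (NeZero.ne n)
    have h2 := congrArg (· % n) h1
    have h3 := congrArg (· / n) h1
    simp only [Nat.add_mul_mod_self_left, Nat.mod_eq_of_lt hp, Nat.mod_eq_of_lt hp'] at h2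
    simp only [Nat.add_mul_div_left _ _ hn, Nat.div_eq_of_lt hp, Nat.div_eq_of_lt hp',
      zero_add] at h3
    exact Prod.ext (Fin.ext h3) (ZMod.val_injective n h2)
  · simp [ZMod.card, mul_comm]

lemma ph_step (n m : ℕ) [NeZero n] [NeZero m] (q : Fin m) (p : ZMod n) (hp : p ≠ -1) :
    ph n m (q, p) + 1 = ph n m (q, p + 1) := by
  have : (p + 1).val = p.val + 1 := by
    have h1 : p.val + 1 < n := by
      have := ZMod.val_lt p
      rcases Nat.lt_or_ge (p.val + 1) n with h | h
      · exact h
      · exfalso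
        apply hp
        have h2 : p.val + 1 = n := by omega
        have h3 : ((p.val + 1 : ℕ) : ZMod n) = 0 := by rw [h2]; simp
        push_cast at h3
        rw [ZMod.natCast_zmod_val] at h3
        exact eq_neg_of_add_eq_zero_left h3
    have h4 : p + 1 = ((p.val + 1 : ℕ) : ZMod n) := by
      push_cast; rw [ZMod.natCast_zmod_val]
    rw [h4, ZMod.val_natCast_of_lt h1]
  unfold ph
  simp only [this]
  push_cast
  ring

noncomputable def Ph (d n m : ℕ) [NeZero n] [NeZero m] :
    (Fin d → Fin m) × (Fin d → ZMod n) ≃ (Fin d → ZMod (n * m)) :=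
  (Equiv.arrowProdEquivProdArrow _ (fun _ => Fin m) (fun _ => ZMod n)).symm.trans
    (Equiv.arrowCongr (Equiv.refl _) (Equiv.ofBijective _ (ph_bij n m)))

lemma Ph_apply (d n m : ℕ) [NeZero n] [NeZero m] (q : Fin d → Fin m) (p : Fin d → ZMod n)
    (l : Fin d) : Ph d n m (q, p) l = ph n m (q l, p l) := rfl

lemma Ph_step (d n m : ℕ) [NeZero n] [NeZero m] (q : Fin d → Fin m) (p : Fin d → ZMod n)
    (k : Fin d) (hp : p k ≠ -1) : sh k (Ph d n m (q, p)) = Ph d n m (q, sh k p) := by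
  funext l
  by_cases h : l = k
  · subst h
    simp [sh, Ph_apply, ph_step n m _ _ hp]
  · simp [sh, Ph_apply, h]

lemma spin_abs (b : Bool) : |spin' b| = 1 := by cases b <;> simp [spin']

lemma card_bad (d n : ℕ) [NeZero n] (k : Fin d) :
    (Finset.univ.filter fun p : Fin d → ZMod n => p k = -1).card = n ^ (d - 1) := by
  have : (Finset.univ.filter fun p : Fin d → ZMod n => p k = -1) =
      Fintype.piFinset (fun l => if l = k then {(-1 : ZMod n)} else Finset.univ) := by
    ext p
    simp only [Finset.mem_filter, Finset.mem_univ, true_and, Fintype.mem_piFinset]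
    constructor
    · intro h l
      by_cases hl : l = k
      · subst hl; simp [h]
      · simp [hl]
    · intro h; simpa using h k
  rw [this, Fintype.card_piFinset, ← Finset.mul_prod_erase _ _ (Finset.mem_univ k)]
  rw [Finset.prod_congr rfl (g := fun _ => n)]
  · simp
  · intro l hl
    simp at hl
    simp [hl, ZMod.card]

lemma En_block (d n m : ℕ) [NeZero n] [NeZero m] (σ : (Fin d → ZMod (n * m)) → Bool) :
    |En d (n * m) σ - ∑ q : Fin d → Fin m, En d n (fun p => σ (Ph d n m (q, p)))| ≤
      2 * d * n ^ (d - 1) * m ^ d := by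
  have h1 : En d (n * m) σ = ∑ q : Fin d → Fin m, ∑ p : Fin d → ZMod n, ∑ k : Fin d,
      spin' (σ (Ph d n m (q, p))) * spin' (σ (sh k (Ph d n m (q, p)))) := by
    unfold En
    rw [← Equiv.sum_comp (Ph d n m), Fintype.sum_prod_type]
  rw [h1]
  unfold En
  simp only [← Finset.sum_sub_distrib]
  have h2 : ∀ (q : Fin d → Fin m) (p : Fin d → ZMod n) (k : Fin d),
      |spin' (σ (Ph d n m (q, p))) * spin' (σ (sh k (Ph d n m (q, p)))) -
        spin' (σ (Ph d n m (q, p))) * spin' (σ (Ph d n m (q, sh k p)))| ≤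
        if p k = -1 then 2 else 0 := by
    intro q p k
    split_ifs with h
    · refine (abs_sub _ _).trans ?_
      rw [abs_mul, abs_mul, spin_abs, spin_abs, spin_abs]; norm_num
    · rw [Ph_step _ _ _ _ _ _ h]; simp
  calc _ ≤ ∑ q : Fin d → Fin m, ∑ p : Fin d → ZMod n, ∑ k : Fin d,
        (if p k = -1 then (2 : ℝ) else 0) := by
        refine (Finset.abs_sum_le_sum_abs _ _).trans (Finset.sum_le_sum fun q _ => ?_)
        refine (Finset.abs_sum_le_sum_abs _ _).trans (Finset.sum_le_sum fun p _ => ?_)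
        refine (Finset.abs_sum_le_sum_abs _ _).trans (Finset.sum_le_sum fun k _ => ?_)
        exact h2 q p k
    _ = _ := by
        rw [Finset.sum_const, Finset.sum_comm]
        simp only [← Finset.sum_filter, Finset.sum_const, card_bad]
        simp
        ring

lemma Mg_block (d n m : ℕ) [NeZero n] [NeZero m] (σ : (Fin d → ZMod (n * m)) → Bool) :
    Mg d (n * m) σ = ∑ q : Fin d → Fin m, Mg d n (fun p => σ (Ph d n m (q, p))) := by
  unfold Mg
  rw [← Equiv.sum_comp (Ph d n m), Fintype.sum_prod_type]

lemma Zr_pow (d n m : ℕ) [NeZero n] [NeZero m] (β h : ℝ) :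
    Zr d n β h ^ (m ^ d) = ∑ σ : (Fin d → ZMod (n * m)) → Bool,
      Real.exp (β * (∑ q : Fin d → Fin m, En d n (fun p => σ (Ph d n m (q, p))))
        + h * Mg d (n * m) σ) := by
  have h1 : Zr d n β h ^ (m ^ d) = ∏ _q : Fin d → Fin m, Zr d n β h := by simp
  rw [h1]
  unfold Zr
  rw [Finset.prod_univ_sum, Fintype.piFinset_univ]
  let e : ((Fin d → ZMod (n * m)) → Bool) ≃ ((Fin d → Fin m) → (Fin d → ZMod n) → Bool) :=
    (Equiv.arrowCongr (Ph d n m).symm (Equiv.refl _)).trans (Equiv.curry _ _ _)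
  rw [← Equiv.sum_comp e]
  refine Finset.sum_congr rfl fun σ _ => ?_
  rw [Mg_block, ← Real.exp_sum, Finset.mul_sum, Finset.mul_sum, ← Finset.sum_add_distrib]
  rfl

lemma Zr_pos (d n : ℕ) [NeZero n] (β h : ℝ) : 0 < Zr d n β h :=
  Finset.sum_pos (fun _ _ => Real.exp_pos _) Finset.univ_nonempty

lemma log_block (d n m : ℕ) [NeZero n] [NeZero m] (β h : ℝ) :
    |Real.log (Zr d (n * m) β h) - m ^ d * Real.log (Zr d n β h)| ≤
      |β| * (2 * d * n ^ (d - 1) * m ^ d) := by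
  set C := |β| * (2 * d * n ^ (d - 1) * m ^ d) with hC
  have hE : ∀ σ : (Fin d → ZMod (n * m)) → Bool, |β * En d (n * m) σ -
      β * ∑ q : Fin d → Fin m, En d n (fun p => σ (Ph d n m (q, p)))| ≤ C := by
    intro σ
    rw [← mul_sub, abs_mul]
    exact mul_le_mul_of_nonneg_left (En_block d n m σ) (abs_nonneg _)
  have u1 : Zr d (n * m) β h ≤ Real.exp C * Zr d n β h ^ (m ^ d) := by
    rw [Zr_pow, Zr, Finset.mul_sum]
    refine Finset.sum_le_sum fun σ _ => ?_
    rw [← Real.exp_add, Real.exp_le_exp]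
    have := (abs_le.mp (hE σ)).2
    linarith
  have u2 : Zr d n β h ^ (m ^ d) ≤ Real.exp C * Zr d (n * m) β h := by
    rw [Zr_pow, Zr, Finset.mul_sum]
    refine Finset.sum_le_sum fun σ _ => ?_
    rw [← Real.exp_add, Real.exp_le_exp]
    have := (abs_le.mp (hE σ)).1
    linarith
  have p1 := Zr_pos d n β h
  have p2 := Zr_pos d (n * m) β h
  have v1 := Real.log_le_log p2 u1
  have v2 := Real.log_le_log (by positivity) u2
  rw [Real.log_mul (Real.exp_pos _).ne' (by positivity), Real.log_exp, Real.log_pow] at v1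
  rw [Real.log_mul (Real.exp_pos _).ne' (by positivity), Real.log_exp, Real.log_pow] at v2
  push_cast at v1 v2
  rw [abs_le]
  constructor <;> linarith

noncomputable def lf (d : ℕ) (β h : ℝ) (n : ℕ) : ℝ :=
  if hn : n ≠ 0 then
    haveI : NeZero n := ⟨hn⟩
    ((n : ℝ) ^ d)⁻¹ * Real.log (Zr d n β h)
  else 0

lemma lf_eq (d : ℕ) (β h : ℝ) (n : ℕ) [NeZero n] :
    lf d β h n = ((n : ℝ) ^ d)⁻¹ * Real.log (Zr d n β h) := by
  unfold lf
  rw [dif_pos (NeZero.ne n)]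

lemma lf_block (d : ℕ) (hd : 1 ≤ d) (β h : ℝ) (n m : ℕ) (hn : n ≠ 0) (hm : m ≠ 0) :
    |lf d β h (n * m) - lf d β h n| ≤ |β| * (2 * d) / n := by
  have : NeZero n := ⟨hn⟩
  have : NeZero m := ⟨hm⟩
  rw [lf_eq, lf_eq]
  have hn' : (0 : ℝ) < n := by exact_mod_cast Nat.pos_of_ne_zero hn
  have hm' : (0 : ℝ) < m := by exact_mod_cast Nat.pos_of_ne_zero hm
  have e : (((n * m : ℕ) : ℝ) ^ d)⁻¹ * Real.log (Zr d (n * m) β h)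
      - ((n : ℝ) ^ d)⁻¹ * Real.log (Zr d n β h) =
      ((n : ℝ) ^ d * m ^ d)⁻¹ * (Real.log (Zr d (n * m) β h) - m ^ d * Real.log (Zr d n β h)) := by
    push_cast
    rw [mul_pow]
    field_simp
  rw [e, abs_mul, abs_of_pos (by positivity)]
  calc _ ≤ ((n : ℝ) ^ d * m ^ d)⁻¹ * (|β| * (2 * d * n ^ (d - 1) * m ^ d)) := by
        gcongr; exact log_block d n m β h
    _ = _ := by
        obtain ⟨d', rfl⟩ : ∃ d', d = d' + 1 := ⟨d - 1, by omega⟩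
        simp only [Nat.add_sub_cancel, pow_succ]
        field_simp

lemma lf_tendsto (d : ℕ) (hd : 1 ≤ d) (β h : ℝ) :
    ∃ L, Tendsto (lf d β h) atTop (nhds L) := by
  apply cauchySeq_tendsto_of_complete
  have hb : Tendsto (fun N : ℕ => |β| * (2 * d) / N + |β| * (2 * d) / N) atTop (nhds 0) := by
    simpa using (tendsto_const_div_atTop_nhds_zero_nat (|β| * (2 * d))).add
      (tendsto_const_div_atTop_nhds_zero_nat (|β| * (2 * d)))
  rw [Metric.cauchySeq_iff']
  intro ε hε
  obtain ⟨N, hN1, hN⟩ := ((eventually_ge_atTop 1).and (hb.eventually (gt_mem_nhds hε))).exists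
  refine ⟨N, fun n hn => ?_⟩
  have a1 := lf_block d hd β h n N (by omega) (by omega)
  have a2 := lf_block d hd β h N n (by omega) (by omega)
  rw [mul_comm N n] at a2
  have a3 : |β| * (2 * d) / n ≤ |β| * (2 * d) / N := by
    have : (0 : ℝ) < N := by exact_mod_cast hN1
    gcongr
  rw [Real.dist_eq]
  rw [abs_le] at a1 a2
  refine lt_of_le_of_lt ?_ hN
  rw [abs_le]
  constructor <;> linarith [a1.1, a1.2, a2.1, a2.2]

end IsingP

namespace IsingP

open Metric

/-- Existence of an analytic logarithm on a ball. -/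
lemma exists_log (p0 : ℂ × ℂ) (R : ℝ) (hR : 0 < R) (g : ℂ × ℂ → ℂ)
    (hg : AnalyticOnNhd ℂ g (ball p0 R)) (hg0 : ∀ p ∈ ball p0 R, g p ≠ 0) :
    ∃ L : ℂ × ℂ → ℂ, AnalyticOnNhd ℂ L (ball p0 R) ∧ (∀ p ∈ ball p0 R, Complex.exp (L p) = g p)
      ∧ L p0 = Complex.log (g p0) := by
  have hsc : IsSimplyConnected (ball p0 R) := by
    have := contractibleSpace_ball (x := p0) hR
    exact SimplyConnectedSpace.ofContractible _
  obtain ⟨f, hfc, hf⟩ := Complex.exists_continuousOn_eqOn_exp_comp hsc isOpen_ball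
    hg.continuousOn (by rintro ⟨p, hp, h⟩; exact hg0 p hp h)
  have hf' : ∀ p ∈ ball p0 R, Complex.exp (f p) = g p := fun p hp => hf hp
  have hfa : AnalyticOnNhd ℂ f (ball p0 R) := by
    intro x hx
    have hca : ContinuousAt f x := hfc.continuousAt (isOpen_ball.mem_nhds hx)
    have h1 : AnalyticAt ℂ (fun y => f x + Complex.log (g y / g x)) x := by
      refine analyticAt_const.add (AnalyticAt.clog ((hg x hx).div analyticAt_const (hg0 x hx)) ?_)
      rw [div_self (hg0 x hx)]
      exact Complex.one_mem_slitPlane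
    refine h1.congr ?_
    have hc2 : Tendsto (fun y => (f y - f x).im) (nhds x) (nhds 0) := by
      have := (Complex.continuous_im.continuousAt.comp (hca.sub continuousAt_const)
        : ContinuousAt (Complex.im ∘ fun y => f y - f x) x)
      simpa [ContinuousAt, Function.comp_def] using this
    filter_upwards [isOpen_ball.mem_nhds hx,
      hc2.eventually (lt_mem_nhds (show -Real.pi < 0 by linarith [Real.pi_pos])),
      hc2.eventually (gt_mem_nhds Real.pi_pos)] with y hy h2 h3
    rw [← hf' y hy, ← hf' x hx, ← Complex.exp_sub, Complex.log_exp h2 h3.le]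
    ring
  have hp0 : p0 ∈ ball p0 R := mem_ball_self hR
  refine ⟨fun p => f p - f p0 + Complex.log (g p0), ?_, ?_, by simp⟩
  · intro x hx
    exact ((hfa x hx).sub analyticAt_const).add analyticAt_const
  · intro p hp
    rw [Complex.exp_add, Complex.exp_sub, Complex.exp_log (hg0 _ hp0), hf' p hp, hf' p0 hp0,
      div_mul_cancel₀ _ (hg0 _ hp0)]

lemma bc_ball (p0 : ℂ × ℂ) (R M K : ℝ) (hM : 0 < M) (f : ℂ × ℂ → ℂ)
    (hf : AnalyticOnNhd ℂ f (ball p0 R)) (hre : ∀ p ∈ ball p0 R, (f p).re ≤ M)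
    (h0 : ‖f p0‖ ≤ K) (p : ℂ × ℂ) (hp : p ∈ ball p0 (R / 2)) : ‖f p‖ ≤ 2 * M + 3 * K := by
  have hmem : ∀ t ∈ ball (0 : ℂ) 2, p0 + t • (p - p0) ∈ ball p0 R := by
    intro t ht
    rw [mem_ball, dist_eq_norm] at hp
    rw [mem_ball_zero_iff] at ht
    rw [mem_ball, dist_eq_norm, add_sub_cancel_left, norm_smul]
    nlinarith [norm_nonneg (p - p0), norm_nonneg t]
  have hd : DifferentiableOn ℂ (fun t : ℂ => f (p0 + t • (p - p0))) (ball 0 2) := by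
    intro t ht
    have h1 := (hf _ (hmem t ht)).differentiableAt
    have h2 : DifferentiableAt ℂ (fun t : ℂ => p0 + t • (p - p0)) t := by fun_prop
    exact (DifferentiableAt.comp t h1 h2).differentiableWithinAt
  have := Complex.borelCaratheodory (z := 1) hM hd (fun t ht => hre _ (hmem t ht)) two_pos
    (by simp)
  simp at this
  norm_num at this
  linarith

lemma dfam (f : ℂ × ℂ → ℂ) (p0 : ℂ × ℂ) (R : ℝ) (hf : AnalyticOnNhd ℂ f (ball p0 R)) (j : ℕ) :
    ∃ g : ℂ × ℂ → ℂ, AnalyticOnNhd ℂ g (ball p0 R) ∧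
      ∀ p ∈ ball p0 R, iteratedDeriv j (fun x => f (x, p.2)) p.1 = g p := by
  induction j with
  | zero => exact ⟨f, hf, fun p _ => by simp⟩
  | succ j ih =>
    obtain ⟨g, hg, hgf⟩ := ih
    refine ⟨fun p => fderiv ℂ g p (1, 0), ?_, ?_⟩
    · intro x hx
      exact (ContinuousLinearMap.apply ℂ ℂ ((1 : ℂ), (0 : ℂ))).analyticAt _ |>.comp
        (hg.fderiv x hx)
    · rintro ⟨x, y⟩ hp
      rw [iteratedDeriv_succ]
      have hev : iteratedDeriv j (fun x => f (x, y)) =ᶠ[nhds x] fun x => g (x, y) := by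
        have hc : Continuous fun t : ℂ => (t, y) := by fun_prop
        have := hc.continuousAt.preimage_mem_nhds (isOpen_ball.mem_nhds hp : ball p0 R ∈ nhds (x, y))
        filter_upwards [this] with t ht
        exact hgf (t, y) ht
      have h1 := (hg _ hp).differentiableAt.hasFDerivAt
      have h2 : HasDerivAt (fun t : ℂ => (t, y)) ((1 : ℂ), (0 : ℂ)) x :=
        (hasDerivAt_id x).prodMk (hasDerivAt_const x y)
      simp only
      rw [hev.deriv_eq]
      exact (h1.comp_hasDerivAt x h2).deriv

lemma hasSum_of_eq {u v : ℕ → ℂ} {s : ℂ} (h : HasSum u s) (e : ∀ k, v k = u k) :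
    HasSum v s := by
  rwa [show v = u from funext e]

lemma two_var (f : ℂ × ℂ → ℂ) (p0 : ℂ × ℂ) (R C ρ : ℝ) (hρ : 0 < ρ) (hρR : ρ < R)
    (hf : AnalyticOnNhd ℂ f (ball p0 R)) (hC : ∀ p ∈ ball p0 R, ‖f p‖ ≤ C) :
    ∃ a : ℕ × ℕ → ℂ, (∀ q, ‖a q‖ ≤ C / ρ ^ q.1 / ρ ^ q.2) ∧
      ∀ p ∈ ball p0 ρ, HasSum (fun q => a q * (p.1 - p0.1) ^ q.1 * (p.2 - p0.2) ^ q.2) (f p) := by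
  choose g hg hgf using dfam f p0 R hf
  obtain ⟨x0, y0⟩ := p0
  have mem : ∀ x y, x ∈ closedBall x0 ρ → y ∈ closedBall y0 ρ → (x, y) ∈ ball (x0, y0) R := by
    intro x y hx hy
    rw [mem_closedBall] at hx hy
    rw [mem_ball, Prod.dist_eq]
    exact (max_le hx hy).trans_lt hρR
  have hx0 : x0 ∈ closedBall x0 ρ := mem_closedBall_self hρ.le
  have hy0 : y0 ∈ closedBall y0 ρ := mem_closedBall_self hρ.le
  have d1 : ∀ u : ℂ × ℂ → ℂ, AnalyticOnNhd ℂ u (ball (x0, y0) R) → ∀ y ∈ closedBall y0 ρ,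
      DifferentiableOn ℂ (fun x => u (x, y)) (closedBall x0 ρ) := by
    intro u hu y hy x hx
    have h1 := (hu _ (mem x y hx hy)).differentiableAt
    have h2 : DifferentiableAt ℂ (fun t : ℂ => (t, y)) x := by fun_prop
    exact (DifferentiableAt.comp x h1 h2).differentiableWithinAt
  have d2 : ∀ u : ℂ × ℂ → ℂ, AnalyticOnNhd ℂ u (ball (x0, y0) R) →
      DifferentiableOn ℂ (fun y => u (x0, y)) (closedBall y0 ρ) := by
    intro u hu y hy
    have h1 := (hu _ (mem x0 y hx0 hy)).differentiableAt
    have h2 : DifferentiableAt ℂ (fun t : ℂ => (x0, t)) y := by fun_prop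
    exact (DifferentiableAt.comp y h1 h2).differentiableWithinAt
  have b1 : ∀ j, ∀ y ∈ closedBall y0 ρ, ‖g j (x0, y)‖ ≤ j.factorial * C / ρ ^ j := by
    intro j y hy
    rw [← hgf j _ (mem x0 y hx0 hy)]
    refine Complex.norm_iteratedDeriv_le_of_forall_mem_sphere_norm_le j hρ
      ((d1 f hf y hy).diffContOnCl_ball (le_refl _)) fun z hz => ?_
    exact hC _ (mem z y (sphere_subset_closedBall hz) hy)
  have b2 : ∀ j k, ‖iteratedDeriv k (fun y => g j (x0, y)) y0‖ ≤
      k.factorial * (j.factorial * C / ρ ^ j) / ρ ^ k := by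
    intro j k
    refine Complex.norm_iteratedDeriv_le_of_forall_mem_sphere_norm_le k hρ
      ((d2 (g j) (hg j)).diffContOnCl_ball (le_refl _)) fun z hz => ?_
    exact b1 j z (sphere_subset_closedBall hz)
  set a : ℕ × ℕ → ℂ := fun q => ((q.1.factorial : ℂ))⁻¹ * ((q.2.factorial : ℂ))⁻¹ *
    iteratedDeriv q.2 (fun y => g q.1 (x0, y)) y0 with ha
  have hb : ∀ q, ‖a q‖ ≤ C / ρ ^ q.1 / ρ ^ q.2 := by
    rintro ⟨j, k⟩
    simp only [ha, norm_mul, norm_inv, Complex.norm_natCast]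
    have hj : (0 : ℝ) < j.factorial := by exact_mod_cast j.factorial_pos
    have hk : (0 : ℝ) < k.factorial := by exact_mod_cast k.factorial_pos
    calc _ ≤ (j.factorial : ℝ)⁻¹ * (k.factorial : ℝ)⁻¹ *
          (k.factorial * (j.factorial * C / ρ ^ j) / ρ ^ k) := by
          gcongr; exact b2 j k
      _ = _ := by field_simp
  refine ⟨a, hb, ?_⟩
  rintro ⟨x, y⟩ hp
  rw [mem_ball, Prod.dist_eq, max_lt_iff] at hp
  obtain ⟨hx, hy⟩ := hp
  simp only at hx hy ⊢
  have hsum : Summable (fun q : ℕ × ℕ => a q * (x - x0) ^ q.1 * (y - y0) ^ q.2) := by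
    rw [dist_eq_norm] at hx hy
    have s1 : Summable fun j : ℕ => (‖x - x0‖ / ρ) ^ j :=
      summable_geometric_of_lt_one (by positivity) (by rwa [div_lt_one hρ])
    have s2 : Summable fun j : ℕ => (‖y - y0‖ / ρ) ^ j :=
      summable_geometric_of_lt_one (by positivity) (by rwa [div_lt_one hρ])
    have s3 := (s1.mul_of_nonneg s2 (fun _ => by positivity) (fun _ => by positivity)).mul_left C
    refine Summable.of_norm_bounded s3 ?_
    rintro ⟨j, k⟩
    simp only [norm_mul, norm_pow, div_pow]
    calc _ ≤ C / ρ ^ j / ρ ^ k * ‖x - x0‖ ^ j * ‖y - y0‖ ^ k := by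
          gcongr; exact hb (j, k)
      _ = _ := by field_simp
  have inner : ∀ j, HasSum (fun k => a (j, k) * (x - x0) ^ j * (y - y0) ^ k)
      ((j.factorial : ℂ)⁻¹ * (x - x0) ^ j * g j (x0, y)) := by
    intro j
    have := Complex.hasSum_taylorSeries_on_ball ((d2 (g j) (hg j)).mono ball_subset_closedBall)
      (mem_ball.mpr hy)
    have := this.mul_left ((j.factorial : ℂ)⁻¹ * (x - x0) ^ j)
    refine hasSum_of_eq this fun k => ?_
    simp only [ha, smul_eq_mul]
    ring
  have outer : HasSum (fun j : ℕ => (j.factorial : ℂ)⁻¹ * (x - x0) ^ j * g j (x0, y)) (f (x, y)) := by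
    have hyc := ball_subset_closedBall (mem_ball.mpr hy)
    have := Complex.hasSum_taylorSeries_on_ball ((d1 f hf y hyc).mono ball_subset_closedBall)
      (mem_ball.mpr hx)
    refine hasSum_of_eq this fun j => ?_
    rw [← hgf j _ (mem x0 y hx0 hyc)]
    simp only [smul_eq_mul]
    ring
  have h3 := hsum.hasSum.prod_fiberwise inner
  rw [outer.unique h3]
  exact hsum.hasSum

/-- The monomial `x ^ j * y ^ (n - j)` as a multilinear map. -/
noncomputable def mono2 (n j : ℕ) :
    ContinuousMultilinearMap ℝ (fun _ : Fin n => ℝ × ℝ) ℝ :=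
  (ContinuousMultilinearMap.mkPiAlgebraFin ℝ n ℝ).compContinuousLinearMap
    (fun i => if (i : ℕ) < j then ContinuousLinearMap.fst ℝ ℝ ℝ else ContinuousLinearMap.snd ℝ ℝ ℝ)

lemma mono2_norm (n j : ℕ) : ‖mono2 n j‖ ≤ 1 := by
  refine ContinuousMultilinearMap.opNorm_le_bound zero_le_one fun m => ?_
  simp only [mono2, ContinuousMultilinearMap.compContinuousLinearMap_apply,
    ContinuousMultilinearMap.mkPiAlgebraFin_apply, List.prod_ofFn, norm_prod, one_mul]
  refine Finset.prod_le_prod (fun _ _ => norm_nonneg _) fun i _ => ?_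
  split_ifs
  · exact norm_fst_le _
  · exact norm_snd_le _

lemma mono2_apply (j k : ℕ) (z : ℝ × ℝ) : mono2 (j + k) j (fun _ => z) = z.1 ^ j * z.2 ^ k := by
  simp only [mono2, ContinuousMultilinearMap.compContinuousLinearMap_apply,
    ContinuousMultilinearMap.mkPiAlgebraFin_apply, List.prod_ofFn]
  rw [Fin.prod_univ_add]
  simp

lemma analytic_of_hasSum (b : ℕ × ℕ → ℝ) (p0 : ℝ × ℝ) (C ρ : ℝ) (hρ : 0 < ρ)
    (hb : ∀ q, ‖b q‖ ≤ C / ρ ^ q.1 / ρ ^ q.2) (F : ℝ × ℝ → ℝ)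
    (hF : ∀ p ∈ ball p0 ρ, HasSum (fun q => b q * (p.1 - p0.1) ^ q.1 * (p.2 - p0.2) ^ q.2) (F p)) :
    AnalyticOnNhd ℝ F (ball p0 (ρ / 2)) := by
  let P : FormalMultilinearSeries ℝ (ℝ × ℝ) ℝ := fun n =>
    ∑ q ∈ Finset.HasAntidiagonal.antidiagonal n, b q • mono2 n q.1
  let r : NNReal := ⟨ρ / 2, by positivity⟩
  have hr : (r : ℝ) = ρ / 2 := rfl
  have hPn : ∀ n, ‖P n‖ ≤ (n + 1) * (C / ρ ^ n) := by
    intro n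
    calc ‖P n‖ ≤ ∑ q ∈ Finset.HasAntidiagonal.antidiagonal n, C / ρ ^ n := by
          refine norm_sum_le_of_le _ fun q hq => ?_
          rw [norm_smul]
          calc ‖b q‖ * ‖mono2 n q.1‖ ≤ ‖b q‖ * 1 := by gcongr; exact mono2_norm _ _
            _ ≤ C / ρ ^ q.1 / ρ ^ q.2 := by rw [mul_one]; exact hb q
            _ = C / ρ ^ n := by
              rw [← Finset.HasAntidiagonal.mem_antidiagonal.mp hq, pow_add]; field_simp
      _ = _ := by simp
  have hps : HasFPowerSeriesOnBall F P p0 r := by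
    refine ⟨?_, by rw [ENNReal.coe_pos, ← NNReal.coe_pos, hr]; positivity, ?_⟩
    · apply P.le_radius_of_summable
      have s1 : Summable fun n : ℕ => (n : ℝ) ^ 1 * (1 / 2 : ℝ) ^ n :=
        summable_pow_mul_geometric_of_norm_lt_one 1 (by norm_num)
      have s2 : Summable fun n : ℕ => (1 / 2 : ℝ) ^ n :=
        summable_geometric_of_lt_one (by norm_num) (by norm_num)
      refine Summable.of_nonneg_of_le (fun n => by positivity) (fun n => ?_)
        ((s1.add s2).mul_left C)
      calc ‖P n‖ * (r : ℝ) ^ n ≤ ((n + 1) * (C / ρ ^ n)) * (r : ℝ) ^ n := by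
            gcongr; exact hPn n
        _ = _ := by rw [hr]; simp only [div_pow, one_pow]; field_simp
    · intro y hy
      have hy' : ‖y‖ < ρ / 2 := by
        rw [Metric.eball_coe] at hy
        simpa [hr] using hy
      have h1 := hF (p0 + y) (by
        rw [mem_ball, dist_eq_norm, add_sub_cancel_left]; linarith)
      simp only [Prod.fst_add, Prod.snd_add, add_sub_cancel_left] at h1
      have h2 := (Finset.HasAntidiagonal.sigmaAntidiagonalEquivProd (A := ℕ)).hasSum_iff.mpr h1
      have h3 := h2.sigma (g := fun n => P n fun _ => y) (fun n => by
        have := hasSum_fintype (fun c : Finset.HasAntidiagonal.antidiagonal n =>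
          b c.1 * y.1 ^ c.1.1 * y.2 ^ c.1.2)
        convert this using 1
        · funext c; rfl
        have hP : (P n fun _ => y) = ∑ q ∈ Finset.HasAntidiagonal.antidiagonal n,
            b q * mono2 n q.1 (fun _ => y) := by
          simp only [P]
          simp
        rw [hP]
        rw [Finset.sum_coe_sort (Finset.HasAntidiagonal.antidiagonal n)
          (fun c => b c * y.1 ^ c.1 * y.2 ^ c.2)]
        refine Finset.sum_congr rfl fun q hq => ?_
        obtain ⟨j, k⟩ := q
        have := Finset.HasAntidiagonal.mem_antidiagonal.mp hq
        simp only at this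
        subst this
        rw [mono2_apply]; ring)
      exact h3
  have := hps.analyticOnNhd
  rwa [Metric.eball_coe] at this

lemma limit_analytic (f : ℕ → ℂ × ℂ → ℂ) (p0 : ℝ × ℝ) (R C : ℝ) (hR : 0 < R)
    (hf : ∀ N, AnalyticOnNhd ℂ (f N) (ball ((p0.1 : ℂ), (p0.2 : ℂ)) R))
    (hC : ∀ N, ∀ p ∈ ball ((p0.1 : ℂ), (p0.2 : ℂ)) R, ‖f N p‖ ≤ C) (F : ℝ × ℝ → ℝ)
    (hF : ∀ p ∈ ball p0 R,
      Tendsto (fun N => (f N ((p.1 : ℂ), (p.2 : ℂ))).re) atTop (nhds (F p))) :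
    AnalyticOnNhd ℝ F (ball p0 (R / 4)) := by
  set ρ := R / 2 with hρdef
  have hρ : 0 < ρ := by positivity
  choose a ha hs using fun N => two_var (f N) _ R C ρ hρ (by linarith) (hf N) (hC N)
  let U : Ultrafilter ℕ := Ultrafilter.of atTop
  have hU : (U : Filter ℕ) ≤ atTop := Ultrafilter.of_le _
  have hlim : ∀ q : ℕ × ℕ, ∃ c : ℂ, ‖c‖ ≤ C / ρ ^ q.1 / ρ ^ q.2 ∧
      Tendsto (fun N => a N q) U (nhds c) := by
    intro q
    obtain ⟨c, hc, h⟩ := (isCompact_closedBall (0 : ℂ) (C / ρ ^ q.1 / ρ ^ q.2)).ultrafilter_le_nhds'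
      (U.map fun N => a N q) (by
        rw [Ultrafilter.mem_map]
        exact Filter.univ_mem' fun N => by simpa using ha N q)
    exact ⟨c, by simpa using hc, h⟩
  choose c hcb hc using hlim
  have := analytic_of_hasSum (fun q => (c q).re) p0 C ρ hρ
    (fun q => (Complex.abs_re_le_norm _).trans (hcb q)) F ?_
  · convert this using 2; rw [hρdef]; ring
  intro p hp
  have hp' : ((p.1 : ℂ), (p.2 : ℂ)) ∈ ball ((p0.1 : ℂ), (p0.2 : ℂ)) ρ := by
    rw [mem_ball, Prod.dist_eq] at hp ⊢
    simpa [Complex.dist_eq, ← Complex.ofReal_sub, Real.dist_eq] using hp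
  set x := p.1 - p0.1 with hx
  set y := p.2 - p0.2 with hy
  have hxy : |x| < ρ ∧ |y| < ρ := by
    rw [mem_ball, Prod.dist_eq, max_lt_iff] at hp
    simpa [Real.dist_eq] using hp
  have hbd : Summable (fun q : ℕ × ℕ => C * ((|x| / ρ) ^ q.1 * (|y| / ρ) ^ q.2)) := by
    have s1 : Summable fun j : ℕ => (|x| / ρ) ^ j :=
      summable_geometric_of_lt_one (by positivity) (by rw [div_lt_one hρ]; exact hxy.1)
    have s2 : Summable fun j : ℕ => (|y| / ρ) ^ j :=
      summable_geometric_of_lt_one (by positivity) (by rw [div_lt_one hρ]; exact hxy.2)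
    exact (s1.mul_of_nonneg s2 (fun _ => by positivity) (fun _ => by positivity)).mul_left C
  have bnd : ∀ (z : ℂ) (q : ℕ × ℕ), ‖z‖ ≤ C / ρ ^ q.1 / ρ ^ q.2 →
      ‖z * (x : ℂ) ^ q.1 * (y : ℂ) ^ q.2‖ ≤ C * ((|x| / ρ) ^ q.1 * (|y| / ρ) ^ q.2) := by
    intro z q hz
    simp only [norm_mul, norm_pow, Complex.norm_real, Real.norm_eq_abs, div_pow]
    calc _ ≤ C / ρ ^ q.1 / ρ ^ q.2 * |x| ^ q.1 * |y| ^ q.2 := by gcongr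
      _ = _ := by field_simp
  have hdom := tendsto_tsum_of_dominated_convergence (𝓕 := (U : Filter ℕ))
    (f := fun N q => a N q * (x : ℂ) ^ q.1 * (y : ℂ) ^ q.2)
    (g := fun q => c q * (x : ℂ) ^ q.1 * (y : ℂ) ^ q.2) hbd
    (fun q => ((hc q).mul_const _).mul_const _)
    (Filter.Eventually.of_forall fun N q => bnd _ q (ha N q))
  have hval : ∀ N, ∑' q, a N q * (x : ℂ) ^ q.1 * (y : ℂ) ^ q.2 = f N ((p.1 : ℂ), (p.2 : ℂ)) := by
    intro N
    have := (hs N _ hp').tsum_eq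
    simpa [hx, hy] using this
  simp only [hval] at hdom
  have hre := (Complex.continuous_re.tendsto _).comp hdom
  have hFp := (hF p (ball_subset_ball (by linarith) hp)).mono_left hU
  have heq := tendsto_nhds_unique hFp hre
  have hsm : Summable (fun q => c q * (x : ℂ) ^ q.1 * (y : ℂ) ^ q.2) :=
    Summable.of_norm_bounded hbd fun q => bnd _ q (hcb q)
  have h4 := Complex.hasSum_re hsm.hasSum
  rw [heq]
  convert h4 using 2 with q
  rw [mul_assoc (c q), ← Complex.ofReal_pow, ← Complex.ofReal_pow, ← Complex.ofReal_mul,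
    Complex.re_mul_ofReal, mul_assoc]

end IsingP

namespace IsingP

open Metric

lemma Zc_alt (d n : ℕ) [NeZero n] (β h : ℂ) :
    Zc d n β h = ∑ σ : (Fin d → ZMod n) → Bool,
      Complex.exp (β * (En d n σ : ℂ) + h * (Mg d n σ : ℂ)) := by
  unfold Zc En Mg
  push_cast
  rfl

lemma Zc_ofReal (d n : ℕ) [NeZero n] (β h : ℝ) : Zc d n β h = (Zr d n β h : ℂ) := by
  rw [Zc_alt]
  unfold Zr
  push_cast
  rfl

lemma Zc_analytic (d n : ℕ) [NeZero n] (s : Set (ℂ × ℂ)) :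
    AnalyticOnNhd ℂ (fun p : ℂ × ℂ => Zc d n p.1 p.2) s := by
  intro x _
  simp only [Zc_alt]
  refine Finset.analyticAt_fun_sum _ fun σ _ => ?_
  exact ((analyticAt_fst.mul analyticAt_const).add (analyticAt_snd.mul analyticAt_const)).cexp

lemma En_abs (d n : ℕ) [NeZero n] (σ : (Fin d → ZMod n) → Bool) :
    |En d n σ| ≤ (n : ℝ) ^ d * d := by
  unfold En
  calc _ ≤ ∑ i : Fin d → ZMod n, ∑ k : Fin d, (1 : ℝ) := by
        refine (Finset.abs_sum_le_sum_abs _ _).trans (Finset.sum_le_sum fun i _ => ?_)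
        refine (Finset.abs_sum_le_sum_abs _ _).trans (Finset.sum_le_sum fun k _ => ?_)
        rw [abs_mul, spin_abs, spin_abs, one_mul]
    _ = _ := by simp [ZMod.card]

lemma Mg_abs (d n : ℕ) [NeZero n] (σ : (Fin d → ZMod n) → Bool) :
    |Mg d n σ| ≤ (n : ℝ) ^ d := by
  unfold Mg
  calc _ ≤ ∑ i : Fin d → ZMod n, (1 : ℝ) := by
        refine (Finset.abs_sum_le_sum_abs _ _).trans (Finset.sum_le_sum fun i _ => ?_)
        rw [spin_abs]
    _ = _ := by simp [ZMod.card]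

lemma Zc_norm (d n : ℕ) [NeZero n] (β h : ℂ) :
    ‖Zc d n β h‖ ≤ Real.exp ((n : ℝ) ^ d * (Real.log 2 + ‖β‖ * d + ‖h‖)) := by
  rw [Zc_alt]
  calc _ ≤ ∑ σ : (Fin d → ZMod n) → Bool, Real.exp ((n : ℝ) ^ d * (‖β‖ * d + ‖h‖)) := by
        refine norm_sum_le_of_le _ fun σ _ => ?_
        rw [Complex.norm_exp, Real.exp_le_exp]
        refine (Complex.re_le_norm _).trans ((norm_add_le _ _).trans ?_)
        rw [norm_mul, norm_mul, Complex.norm_real, Complex.norm_real, Real.norm_eq_abs,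
          Real.norm_eq_abs]
        have h1 := mul_le_mul_of_nonneg_left (En_abs d n σ) (norm_nonneg β)
        have h2 := mul_le_mul_of_nonneg_left (Mg_abs d n σ) (norm_nonneg h)
        nlinarith
    _ = _ := by
        rw [Finset.sum_const, Finset.card_univ, Fintype.card_fun, Fintype.card_bool,
          Fintype.card_fun, ZMod.card, Fintype.card_fin, nsmul_eq_mul, add_assoc,
          mul_add _ (Real.log 2), Real.exp_add]
        congr 1
        rw [mul_comm, Real.exp_mul, Real.exp_log two_pos]
        push_cast
        rw [← Real.rpow_natCast]
        push_cast
        rfl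

lemma torusZ_eq (d N : ℕ) (hN : 0 < N) [NeZero (2 * N)] (β h : ℝ) :
    torusZ d β h N = Zr d (2 * N) β h := by
  unfold torusZ
  rw [dif_pos hN]
  rfl

end IsingP

open IsingP Metric in
theorem pressure_analytic_nonzero_field (d : ℕ) (hd : 1 ≤ d) (β₀ h₀ : ℝ)
    (hβ₀ : 0 ≤ β₀) (hh₀ : h₀ ≠ 0) :
    ∃ U : Set (ℝ × ℝ), IsOpen U ∧ (β₀, h₀) ∈ U ∧
      ∃ F : ℝ × ℝ → ℝ, AnalyticOnNhd ℝ F U ∧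
        ∀ p ∈ U, Filter.Tendsto
          (fun N : ℕ => ((2 * N : ℝ) ^ d)⁻¹ * Real.log (IsingP.torusZ d p.1 p.2 N))
          Filter.atTop (nhds (F p)) := by
  obtain ⟨ε, hε, hz⟩ := Metric.eventually_nhds_iff_ball.mp (zero_free d β₀ h₀ hβ₀ hh₀)
  choose Fq hFq using fun p : ℝ × ℝ => lf_tendsto d hd p.1 p.2
  set R := min ε 1 with hRdef
  have hR : 0 < R := lt_min hε one_pos
  have hR1 : R ≤ 1 := min_le_right _ _
  have hz' : ∀ p ∈ ball ((β₀ : ℂ), (h₀ : ℂ)) R, ∀ (n : ℕ) [NeZero n], 2 ≤ n →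
      Zc d n p.1 p.2 ≠ 0 := fun p hp => hz p (ball_subset_ball (min_le_left _ _) hp)
  have hlog : ∀ N : ℕ, ∃ L : ℂ × ℂ → ℂ, AnalyticOnNhd ℂ L (ball ((β₀ : ℂ), (h₀ : ℂ)) R) ∧
      (∀ p ∈ ball ((β₀ : ℂ), (h₀ : ℂ)) R, Complex.exp (L p) = Zc d (2 * (N + 1)) p.1 p.2) ∧
      L ((β₀ : ℂ), (h₀ : ℂ)) = Complex.log (Zc d (2 * (N + 1)) β₀ h₀) := fun N =>
    exists_log _ R hR (fun p => Zc d (2 * (N + 1)) p.1 p.2) (Zc_analytic _ _ _)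
      fun p hp => hz' p hp _ (by omega)
  choose L hLa hLe hL0 using hlog
  have hre : ∀ N, ∀ p ∈ ball ((β₀ : ℂ), (h₀ : ℂ)) R,
      (L N p).re = Real.log ‖Zc d (2 * (N + 1)) p.1 p.2‖ := by
    intro N p hp
    rw [← hLe N p hp, Complex.norm_exp, Real.log_exp]
  let c : ℕ → ℝ := fun N => (((2 * (N + 1) : ℕ) : ℝ) ^ d)⁻¹
  have hc : ∀ N, 0 < c N := fun N => by
    simp only [c]; positivity
  let f : ℕ → ℂ × ℂ → ℂ := fun N p => (c N : ℂ) * L N p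
  have hfa : ∀ N, AnalyticOnNhd ℂ (f N) (ball ((β₀ : ℂ), (h₀ : ℂ)) R) := fun N x hx =>
    analyticAt_const.mul (hLa N x hx)
  have hfre : ∀ N p, (f N p).re = c N * (L N p).re := fun N p => by
    simp only [f, Complex.re_ofReal_mul]
  set M := Real.log 2 + (‖(β₀ : ℂ)‖ + 1) * d + (‖(h₀ : ℂ)‖ + 1) with hM
  have hMpos : 0 < M := by
    have := Real.log_pos (one_lt_two)
    positivity
  have hfM : ∀ N, ∀ p ∈ ball ((β₀ : ℂ), (h₀ : ℂ)) R, (f N p).re ≤ M := by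
    intro N p hp
    have hn := hz' p hp (2 * (N + 1)) (by omega)
    have h1 := Real.log_le_log (norm_pos_iff.mpr hn) (Zc_norm d (2 * (N + 1)) p.1 p.2)
    rw [Real.log_exp, ← hre N p hp] at h1
    rw [hfre]
    have h2 := mul_le_mul_of_nonneg_left h1 (hc N).le
    rw [← mul_assoc] at h2
    have h3 : c N * ((2 * (N + 1) : ℕ) : ℝ) ^ d = 1 := by
      simp only [c]
      exact inv_mul_cancel₀ (by positivity)
    rw [h3, one_mul] at h2
    refine h2.trans ?_
    rw [mem_ball, Prod.dist_eq, max_lt_iff, dist_eq_norm, dist_eq_norm] at hp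
    have h4 : ‖p.1‖ ≤ ‖(β₀ : ℂ)‖ + 1 := by
      have := norm_le_norm_add_norm_sub (β₀ : ℂ) p.1
      have := norm_sub_norm_le p.1 (β₀ : ℂ)
      linarith [hp.1]
    have h5 : ‖p.2‖ ≤ ‖(h₀ : ℂ)‖ + 1 := by
      have := norm_sub_norm_le p.2 (h₀ : ℂ)
      linarith [hp.2]
    rw [hM]
    gcongr
  have hcomp : Tendsto (fun N : ℕ => 2 * (N + 1)) atTop atTop :=
    tendsto_atTop_mono (fun N => by simp only [id]; omega) tendsto_id
  have hlfre : ∀ N (p : ℝ × ℝ), ((p.1 : ℂ), (p.2 : ℂ)) ∈ ball ((β₀ : ℂ), (h₀ : ℂ)) R →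
      (f N ((p.1 : ℂ), (p.2 : ℂ))).re = lf d p.1 p.2 (2 * (N + 1)) := by
    intro N p hp
    rw [hfre, hre N _ hp, lf_eq, Zc_ofReal, Complex.norm_real, Real.norm_eq_abs,
      abs_of_pos (Zr_pos _ _ _ _)]
  have hbd := Metric.isBounded_range_of_tendsto _ (hFq (β₀, h₀))
  obtain ⟨K, hK⟩ := hbd.exists_norm_le
  have hf0 : ∀ N, ‖f N ((β₀ : ℂ), (h₀ : ℂ))‖ ≤ K := by
    intro N
    have h1 : f N ((β₀ : ℂ), (h₀ : ℂ)) = ((lf d β₀ h₀ (2 * (N + 1)) : ℝ) : ℂ) := by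
      simp only [f]
      rw [hL0, lf_eq, Zc_ofReal, ← Complex.ofReal_log (Zr_pos _ _ _ _).le]
      push_cast
      simp [c]
    rw [h1, Complex.norm_real]
    exact hK _ ⟨_, rfl⟩
  have hball : ∀ p : ℝ × ℝ, p ∈ ball (β₀, h₀) (R / 2) →
      ((p.1 : ℂ), (p.2 : ℂ)) ∈ ball ((β₀ : ℂ), (h₀ : ℂ)) R := by
    intro p hp
    have hp := ball_subset_ball (half_le_self hR.le) hp
    rw [mem_ball, Prod.dist_eq] at hp ⊢
    simpa [Complex.dist_eq, ← Complex.ofReal_sub, Real.dist_eq] using hp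
  have hF := limit_analytic f (β₀, h₀) (R / 2) (2 * M + 3 * K) (half_pos hR)
    (fun N => (hfa N).mono (ball_subset_ball (half_le_self hR.le)))
    (fun N p hp => bc_ball _ R M K hMpos (f N) (hfa N) (hfM N) (hf0 N) p hp) Fq
    (fun p hp => by
      simp only [hlfre _ p (hball p hp)]
      exact (hFq p).comp hcomp)
  refine ⟨ball (β₀, h₀) (R / 2 / 4), isOpen_ball, mem_ball_self (by positivity), Fq, hF, ?_⟩
  intro p _
  have hcomp2 : Tendsto (fun N : ℕ => 2 * N) atTop atTop :=
    tendsto_atTop_mono (fun N => by simp only [id]; omega) tendsto_id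
  refine ((hFq p).comp hcomp2).congr' ?_
  filter_upwards [eventually_gt_atTop 0] with N hN
  have : NeZero (2 * N) := ⟨by omega⟩
  simp only [Function.comp]
  rw [lf_eq, torusZ_eq d N hN]
  push_cast
  rfl
end
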